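/- Let λ₁≥…≥λ_N be the eigenvalues of an N×N GOE matrix and let ε>0. There is a constant C>0 such that for all 0 ≤ s ≤ N^{4/15}, | E[ #{i : λ_i ≥ 2 − s·N^{−2/3}} ] − (2/(3π))·s^{3/2} | ≤ C. Moreover there is C₁>0 such that for all C₁ ≤ s ≤ N^{2/3−ε}, Var( #{i : λ_i ≥ 2 − s·N^{−2/3}} ) ≤ C·log(s). -/

import Mathlib

open MeasureTheory Complex ProbabilityTheory
open scoped RealInnerProductSpace BigOperators

noncomputable section

abbrev ESp (N : ℕ) := EuclideanSpace ℝ (Fin N)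

/-- Surface (uniform, up to normalization) measure on the unit sphere of `ℝ^N`. -/
def sphereMeas (N : ℕ) : Measure (Metric.sphere (0 : ESp N) 1) :=
  (volume : Measure (ESp N)).toSphere

/-- Gibbs weight `exp((β/2)⟨σ, Mσ⟩)` where `σ = √N · x` and `x` is on the unit sphere. -/
def gibbsWeight (N : ℕ) (β : ℝ) (M : Matrix (Fin N) (Fin N) ℝ)
    (x : Metric.sphere (0 : ESp N) 1) : ℝ :=
  Real.exp ((β * N / 2) * ⟪(x : ESp N), Matrix.toEuclideanLin M (x : ESp N)⟫)

/-- Gibbs expectation of a two-replica observable `φ` (in unit-sphere coordinates). -/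
def gibbsExpect (N : ℕ) (β : ℝ) (M : Matrix (Fin N) (Fin N) ℝ)
    (φ : ESp N → ESp N → ℝ) : ℝ :=
  (∫ x, ∫ y, gibbsWeight N β M x * gibbsWeight N β M y * φ (x : ESp N) (y : ESp N)
      ∂(sphereMeas N) ∂(sphereMeas N))
   / (∫ x, gibbsWeight N β M x ∂(sphereMeas N)) ^ 2

/-- Overlap `R₁₂ = σ⁽¹⁾·σ⁽²⁾/N` in unit-sphere coordinates. -/
def overlapFn (N : ℕ) (x y : ESp N) : ℝ := ⟪x, y⟫

/-- The function `G(z) = βz - N⁻¹ ∑ log(z - λᵢ)` (principal branch). -/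
def Gfn (N : ℕ) (β : ℝ) (lam : Fin N → ℝ) (z : ℂ) : ℂ :=
  β * z - (1 / (N : ℂ)) * ∑ i, Complex.log (z - lam i)

/-- `∫_{γ-i∞}^{γ+i∞} f(z) dz` parametrized as `i ∫_ℝ f(γ+it) dt`. -/
def lineInt (γ : ℝ) (f : ℂ → ℂ) : ℂ := Complex.I * ∫ t : ℝ, f (γ + t * Complex.I)

def lineInt2 (γ : ℝ) (F : ℂ → ℂ → ℂ) : ℂ :=
  Complex.I * Complex.I * ∫ t : ℝ, ∫ s : ℝ, F (γ + t * Complex.I) (γ + s * Complex.I)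

/-- Semicircle density. -/
def rhoSC (x : ℝ) : ℝ := Real.sqrt (max (4 - x ^ 2) 0) / (2 * Real.pi)

/-- iid standard Gaussian coefficients `g_{ij}`. -/
def gMeasure (N : ℕ) : Measure (Fin N → Fin N → ℝ) :=
  Measure.pi fun _ => Measure.pi fun _ => gaussianReal 0 1

/-- GOE matrix built from iid standard Gaussians. -/
def Hmat (N : ℕ) (g : Fin N → Fin N → ℝ) : Matrix (Fin N) (Fin N) ℝ :=
  fun i j => if i = j then Real.sqrt (2 / N) * g i i else (g i j + g j i) / Real.sqrt (2 * N)

/-- GOE matrix with zero diagonal. -/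
def Mmat (N : ℕ) (g : Fin N → Fin N → ℝ) : Matrix (Fin N) (Fin N) ℝ :=
  fun i j => if i = j then 0 else (g i j + g j i) / Real.sqrt (2 * N)

lemma Hmat_isHermitian (N : ℕ) (g : Fin N → Fin N → ℝ) : (Hmat N g).IsHermitian := by
  unfold Matrix.IsHermitian
  ext i j
  simp only [Matrix.conjTranspose_apply, star_trivial, Hmat]
  by_cases h : i = j
  · subst h; rfl
  · rw [if_neg fun hh => h hh.symm, if_neg h]; ring

lemma Mmat_isHermitian (N : ℕ) (g : Fin N → Fin N → ℝ) : (Mmat N g).IsHermitian := by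
  unfold Matrix.IsHermitian
  ext i j
  simp only [Matrix.conjTranspose_apply, star_trivial, Mmat]
  by_cases h : i = j
  · subst h; rfl
  · rw [if_neg fun hh => h hh.symm, if_neg h]; ring

/-- Eigenvalues of a real symmetric matrix, in decreasing order. -/
def evalsDesc {N : ℕ} {A : Matrix (Fin N) (Fin N) ℝ} (hA : A.IsHermitian) : Fin N → ℝ :=
  fun i => - (fun j => - hA.eigenvalues j) ((Tuple.sort fun j => - hA.eigenvalues j) i)

/-- Decreasing eigenvalues of the GOE matrix. -/
def evalsH (N : ℕ) (g : Fin N → Fin N → ℝ) : Fin N → ℝ := evalsDesc (Hmat_isHermitian N g)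

/-- Decreasing eigenvalues of the zero-diagonal GOE matrix. -/
def evalsM (N : ℕ) (g : Fin N → Fin N → ℝ) : Fin N → ℝ := evalsDesc (Mmat_isHermitian N g)

/-- `m̃_N(w) = N⁻¹ ∑_{j≥2} (λ_j - w)⁻¹`. -/
def mtil (N : ℕ) (lam : Fin N → ℝ) (w : ℝ) : ℝ :=
  (1 / (N:ℝ)) * ∑ j ∈ Finset.univ.filter (fun j : Fin N => (j : ℕ) ≠ 0), 1 / (lam j - w)

/-- `m̃_N'(w) = N⁻¹ ∑_{j≥2} (λ_j - w)⁻²`. -/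
def mtil' (N : ℕ) (lam : Fin N → ℝ) (w : ℝ) : ℝ :=
  (1 / (N:ℝ)) * ∑ j ∈ Finset.univ.filter (fun j : Fin N => (j : ℕ) ≠ 0), 1 / (lam j - w) ^ 2

/-- Rigidity: `|λ_i - γ_i| ≤ N^{ε₁/10} min(i, N+1-i)^{-1/3} N^{-2/3}` (1-based `i`). -/
def rigidityCond (N : ℕ) (ε₁ : ℝ) (lam γcl : Fin N → ℝ) : Prop :=
  ∀ i : Fin N, |lam i - γcl i| ≤
    (N:ℝ) ^ (ε₁ / 10) * ((min ((i:ℕ)+1) (N - (i:ℕ)) : ℕ) : ℝ) ^ (-(1:ℝ)/3) * (N:ℝ) ^ (-(2:ℝ)/3)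

/-- Classical locations: `∫_{-2}^{γ_i} ρ_sc = i/N` (1-based `i`). -/
def classicalLoc (N : ℕ) (γcl : Fin N → ℝ) : Prop :=
  ∀ i : Fin N, ∫ x in (-2:ℝ)..(γcl i), rhoSC x = (((i:ℕ) + 1 : ℕ) : ℝ) / N

/-- Keyhole contour integral around `-b`: rays below/above `(-∞, -b-r)` plus the
counterclockwise circle of radius `r`, for an integrand `f(z)·(z+b)^s`
(principal branch, boundary values on the rays). -/
def keyholeInt (b r : ℝ) (s : ℂ) (f : ℂ → ℂ) : ℂ :=
  (∫ x in Set.Iio (-b - r),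
      f x * Complex.exp (s * Real.log (-(x + b))) * Complex.exp (-(Real.pi:ℂ) * s * Complex.I))
  + (∫ θ in (-Real.pi)..Real.pi,
      f (-b + r * Complex.exp (θ * Complex.I)) *
        Complex.exp (s * ((Real.log r : ℂ) + θ * Complex.I)) *
        (Complex.I * r * Complex.exp (θ * Complex.I)))
  - (∫ x in Set.Iio (-b - r),
      f x * Complex.exp (s * Real.log (-(x + b))) * Complex.exp ((Real.pi:ℂ) * s * Complex.I))

/-- Integral over the contour `Γ̂ = Γ₁ ∪ Γ₃` (counterclockwise around the branch cut). -/
def hatInt (X η₀ : ℝ) (ηf ηf' : ℝ → ℝ) (F : ℂ → ℂ) : ℂ :=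
  (-Complex.I) * (∫ t in (0:ℝ)..η₀, F (-X - t * Complex.I))
  + (∫ E in (-X)..(0:ℝ), F (E - ηf E * Complex.I) * (1 - ηf' E * Complex.I))
  - (∫ E in (-X)..(0:ℝ), F (E + ηf E * Complex.I) * (1 + ηf' E * Complex.I))
  - Complex.I * (∫ t in (0:ℝ)..η₀, F (-X + t * Complex.I))

def hatInt2 (X η₀ : ℝ) (ηf ηf' : ℝ → ℝ) (F : ℂ → ℂ → ℂ) : ℂ :=
  hatInt X η₀ ηf ηf' fun z => hatInt X η₀ ηf ηf' fun w => F z w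

/-- Resolvent of a real matrix at complex spectral parameter. -/
def resolventM (N : ℕ) (A : Matrix (Fin N) (Fin N) ℝ) (z : ℂ) : Matrix (Fin N) (Fin N) ℂ :=
  (A.map (fun x => (x : ℂ)) - z • (1 : Matrix (Fin N) (Fin N) ℂ))⁻¹

/-- Empirical Stieltjes transform `N⁻¹ tr (A - z)⁻¹`. -/
def stTrans (N : ℕ) (A : Matrix (Fin N) (Fin N) ℝ) (z : ℂ) : ℂ :=
  (1 / (N:ℂ)) * Matrix.trace (resolventM N A z)

/-- Stieltjes transform of the semicircle law. -/
def mSC (z : ℂ) : ℂ := ∫ x in (-2:ℝ)..2, (rhoSC x : ℂ) / ((x:ℂ) - z)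


/-- Number of GOE eigenvalues `≥ c`. -/
def countAboveH (N : ℕ) (g : Fin N → Fin N → ℝ) (c : ℝ) : ℕ :=
  (Finset.univ.filter fun i : Fin N => c ≤ evalsH N g i).card

/-- One step of the pivot recursion `d ↦ a - c - b / d`, together with the number of positive
pivots seen so far. -/
def chainStep (c : ℝ) (s : ℕ × ℝ) (p : ℝ × ℝ) : ℕ × ℝ :=
  (s.1 + if 0 < p.1 - c - p.2 / s.2 then 1 else 0, p.1 - c - p.2 / s.2)

/-- The moment properties of the noise `(a, b)` used in one step of the recursion. -/
structure IsNoise (μ : Measure (ℝ × ℝ)) (v x : ℝ) : Prop where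
  prob : IsProbabilityMeasure μ
  integrable_fst_pow : Integrable (fun p => p.1 ^ 4) μ
  integrable_snd_pow : Integrable (fun p => (p.2 - x) ^ 4) μ
  integral_fst : ∫ p, p.1 ∂μ = 0
  integral_snd : ∫ p, (p.2 - x) ∂μ = 0
  integral_mul : ∫ p, p.1 * (p.2 - x) ∂μ = 0
  integral_fst_sq : ∫ p, p.1 ^ 2 ∂μ = 2 * v
  integral_snd_sq : ∫ p, (p.2 - x) ^ 2 ∂μ = 2 * x * v
  integral_fst_pow : ∫ p, p.1 ^ 4 ∂μ ≤ 60 * v ^ 2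
  integral_snd_pow : ∫ p, (p.2 - x) ^ 4 ∂μ ≤ 60 * v ^ 2
  snd_nonneg : ∀ᵐ p ∂μ, 0 ≤ p.2
  fst_ne : ∀ f : ℝ → ℝ, Measurable f → ∀ᵐ p ∂μ, p.1 ≠ f p.2

namespace IsNoise

variable {μ : Measure (ℝ × ℝ)} {v x : ℝ}

lemma integrable_of_abs_le (h : IsNoise μ v x) {f : ℝ × ℝ → ℝ} (hf : Measurable f) {K : ℝ}
    (hK : ∀ p, |f p| ≤ K * (1 + p.1 ^ 4 + (p.2 - x) ^ 4)) : Integrable f μ := by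
  have := h.prob
  refine Integrable.mono' (g := fun p => K * (1 + p.1 ^ 4 + (p.2 - x) ^ 4)) ?_
    hf.aestronglyMeasurable (Filter.Eventually.of_forall hK)
  exact (((integrable_const 1).add h.integrable_fst_pow).add h.integrable_snd_pow).const_mul K

lemma integrable_fst (h : IsNoise μ v x) : Integrable (fun p => p.1) μ :=
  h.integrable_of_abs_le (K := 1) (by fun_prop) fun p => by
    rw [abs_le]; constructor <;> nlinarith [sq_nonneg (p.1 ^ 2 - 1), sq_nonneg (p.1 - 1),
      sq_nonneg (p.1 + 1), sq_nonneg ((p.2 - x) ^ 2)]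

lemma integrable_snd (h : IsNoise μ v x) : Integrable (fun p => p.2 - x) μ :=
  h.integrable_of_abs_le (K := 1) (by fun_prop) fun p => by
    rw [abs_le]; constructor <;> nlinarith [sq_nonneg ((p.2 - x) ^ 2 - 1), sq_nonneg (p.2 - x - 1),
      sq_nonneg (p.2 - x + 1), sq_nonneg (p.1 ^ 2)]

lemma integrable_fst_sq (h : IsNoise μ v x) : Integrable (fun p => p.1 ^ 2) μ :=
  h.integrable_of_abs_le (K := 1) (by fun_prop) fun p => by
    rw [abs_le]; constructor <;> nlinarith [sq_nonneg (p.1 ^ 2 - 1), sq_nonneg (p.1),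
      sq_nonneg ((p.2 - x) ^ 2)]

lemma integrable_snd_sq (h : IsNoise μ v x) : Integrable (fun p => (p.2 - x) ^ 2) μ :=
  h.integrable_of_abs_le (K := 1) (by fun_prop) fun p => by
    rw [abs_le]; constructor <;> nlinarith [sq_nonneg ((p.2 - x) ^ 2 - 1), sq_nonneg (p.2 - x),
      sq_nonneg (p.1 ^ 2)]

lemma integrable_mul (h : IsNoise μ v x) : Integrable (fun p => p.1 * (p.2 - x)) μ :=
  h.integrable_of_abs_le (K := 1) (by fun_prop) fun p => by
    rw [abs_le]; constructor <;> nlinarith [sq_nonneg ((p.2 - x) ^ 2 - 1), sq_nonneg (p.1 ^ 2 - 1),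
      sq_nonneg (p.1 - (p.2 - x)), sq_nonneg (p.1 + (p.2 - x))]

end IsNoise

/-- The potential used while the recursion is hyperbolic: it rises from `0` to `1` between the
attracting and the repelling fixed point. -/
def hypF (κ c d : ℝ) : ℝ :=
  if 0 < d then 0 else min 1 ((max (d + c / 2 + κ / 2) 0) ^ 4 / κ ^ 4)

def hypJ (κ c : ℝ) (s : ℕ × ℝ) : ℝ := (s.1 : ℝ) ^ 2 + (2 * s.1 + 1) * hypF κ c s.2

lemma hypF_nonneg (κ c d : ℝ) : 0 ≤ hypF κ c d := by
  unfold hypF; split_ifs <;> positivity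

lemma hypF_le_one (κ c d : ℝ) : hypF κ c d ≤ 1 := by
  unfold hypF; split_ifs
  · norm_num
  · exact min_le_left _ _

lemma measurable_hypF (κ c : ℝ) : Measurable (hypF κ c) := by
  unfold hypF
  exact Measurable.ite measurableSet_Ioi measurable_const (by fun_prop)

lemma measurable_chainStep (c : ℝ) :
    Measurable (fun q : (ℕ × ℝ) × (ℝ × ℝ) => chainStep c q.1 q.2) := by
  unfold chainStep
  have h : Measurable fun q : (ℕ × ℝ) × (ℝ × ℝ) => q.2.1 - c - q.2.2 / q.1.2 := by fun_prop
  refine Measurable.prodMk ?_ h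
  exact (measurable_fst.comp measurable_fst).add
    (Measurable.ite (measurableSet_lt measurable_const h) measurable_const measurable_const)

lemma measurable_hypJ (κ c : ℝ) : Measurable (hypJ κ c) := by
  unfold hypJ
  have := (measurable_hypF κ c).comp (measurable_snd : Measurable (Prod.snd : ℕ × ℝ → ℝ))
  have h2 : Measurable fun s : ℕ × ℝ => (s.1 : ℝ) := by fun_prop
  exact (h2.pow_const 2).add (((measurable_const.mul h2).add measurable_const).mul this)

set_option maxHeartbeats 800000 in
/-- One-step bound for the quartic part of the potential. -/
lemma quartic_step {μ : Measure (ℝ × ℝ)} {v x κ y w : ℝ} (h : IsNoise μ v x) (hv : 0 < v)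
    (hx0 : 0 ≤ x) (hx1 : x ≤ 1) (hκ : 0 < κ) (hκ1 : κ ≤ 1) (hvκ : 8 * v ≤ κ ^ 3)
    (hy0 : 0 ≤ y) (hw : 1 / 4 ≤ w) :
    Integrable (fun p => (y * (1 - κ / 2) + (p.1 + (p.2 - x) / w)) ^ 4) μ ∧
    (∫ p, (y * (1 - κ / 2) + (p.1 + (p.2 - x) / w)) ^ 4 ∂μ) / (κ ^ 2 - v) ^ 2 ≤
      y ^ 4 / κ ^ 4 + 1400000 * v ^ 2 / κ ^ 5 := by
  have := h.prob
  have hw0 : 0 < w := by linarith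
  set i : ℝ := w⁻¹ with hi
  have hi0 : 0 < i := by positivity
  have hi4 : i ≤ 4 := by
    rw [hi, inv_le_comm₀ hw0 (by norm_num)]; linarith
  have hi2 : i ^ 2 ≤ 16 := by nlinarith
  have hi44 : i ^ 4 ≤ 256 := by nlinarith [sq_nonneg i]
  set Y := y * (1 - κ / 2) with hY
  have hY0 : 0 ≤ Y := mul_nonneg hy0 (by linarith)
  have hYy : Y ≤ y := by nlinarith
  have e1 : ∀ p : ℝ × ℝ, (p.2 - x) / w = (p.2 - x) * i := fun p => div_eq_mul_inv _ _
  simp only [e1]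
  have pw : ∀ p : ℝ × ℝ, (Y + (p.1 + (p.2 - x) * i)) ^ 4 ≤
      Y ^ 4 + 4 * Y ^ 3 * p.1 + 4 * Y ^ 3 * i * (p.2 - x) + 16 * Y ^ 2 * p.1 ^ 2 +
      256 * Y ^ 2 * (p.2 - x) ^ 2 + 24 * p.1 ^ 4 + 6144 * (p.2 - x) ^ 4 := by
    intro p
    set a := p.1
    set ξ := p.2 - x
    have q1 : ∀ ζ : ℝ, (Y + ζ) ^ 4 ≤ Y ^ 4 + 4 * Y ^ 3 * ζ + 8 * Y ^ 2 * ζ ^ 2 + 3 * ζ ^ 4 := by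
      intro ζ; nlinarith [sq_nonneg (ζ * (Y - ζ))]
    have q2 : (a + ξ * i) ^ 2 ≤ 2 * a ^ 2 + 32 * ξ ^ 2 := by
      have : ξ ^ 2 * i ^ 2 ≤ ξ ^ 2 * 16 := by gcongr
      nlinarith [sq_nonneg (a - ξ * i)]
    have q3 : (a + ξ * i) ^ 4 ≤ 8 * a ^ 4 + 2048 * ξ ^ 4 := by
      have h1 : (a + ξ * i) ^ 4 = ((a + ξ * i) ^ 2) ^ 2 := by ring
      have h2 : ((a + ξ * i) ^ 2) ^ 2 ≤ (2 * a ^ 2 + 32 * ξ ^ 2) ^ 2 := by gcongr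
      nlinarith [sq_nonneg (a ^ 2 - 16 * ξ ^ 2)]
    have q4 := q1 (a + ξ * i)
    have q5 : 8 * Y ^ 2 * (a + ξ * i) ^ 2 ≤ 8 * Y ^ 2 * (2 * a ^ 2 + 32 * ξ ^ 2) := by gcongr
    linarith
  have i1 := h.integrable_fst
  have i2 := h.integrable_snd
  have i3 := h.integrable_fst_sq
  have i4 := h.integrable_snd_sq
  have i5 := h.integrable_fst_pow
  have i6 := h.integrable_snd_pow
  have iR : Integrable (fun p : ℝ × ℝ => Y ^ 4 + 4 * Y ^ 3 * p.1 + 4 * Y ^ 3 * i * (p.2 - x) +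
      16 * Y ^ 2 * p.1 ^ 2 +
      256 * Y ^ 2 * (p.2 - x) ^ 2 + 24 * p.1 ^ 4 + 6144 * (p.2 - x) ^ 4) μ := by
    fun_prop
  have iL : Integrable (fun p : ℝ × ℝ => (Y + (p.1 + (p.2 - x) * i)) ^ 4) μ := by
    refine iR.mono' (by fun_prop) (Filter.Eventually.of_forall fun p => ?_)
    rw [Real.norm_eq_abs, abs_of_nonneg (by positivity)]; exact pw p
  refine ⟨iL, ?_⟩
  have hI : ∫ p, (Y + (p.1 + (p.2 - x) * i)) ^ 4 ∂μ ≤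
      Y ^ 4 + 16 * Y ^ 2 * (2 * v) + 256 * Y ^ 2 * (2 * x * v) + 24 * (60 * v ^ 2) +
        6144 * (60 * v ^ 2) := by
    refine (integral_mono iL iR pw).trans ?_
    rw [integral_add (by fun_prop) (by fun_prop), integral_add (by fun_prop) (by fun_prop),
      integral_add (by fun_prop) (by fun_prop), integral_add (by fun_prop) (by fun_prop),
      integral_add (by fun_prop) (by fun_prop), integral_add (by fun_prop) (by fun_prop)]
    simp only [integral_const_mul, h.integral_fst, h.integral_snd, h.integral_fst_sq,
      h.integral_snd_sq, integral_const, probReal_univ, smul_eq_mul, one_mul, mul_zero,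
      add_zero]
    have := h.integral_fst_pow
    have := h.integral_snd_pow
    linarith
  have hY4 : Y ^ 4 ≤ y ^ 4 * (1 - κ / 2) := by
    rw [hY, mul_pow]
    gcongr
    have h0 : 0 ≤ 1 - κ / 2 := by linarith
    have h1 : 1 - κ / 2 ≤ 1 := by linarith
    calc (1 - κ / 2) ^ 4 ≤ (1 - κ / 2) ^ 1 := pow_le_pow_of_le_one h0 h1 (by norm_num)
      _ = _ := pow_one _
  have hY2 : Y ^ 2 ≤ y ^ 2 := by gcongr
  have hkv : v ≤ κ ^ 2 / 8 := by nlinarith [pow_pos hκ 2, pow_pos hκ 3]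
  have hA : κ * (544 * v * y ^ 2) ≤ κ * (y ^ 4 * κ / 4) + 300000 * v ^ 2 := by
    nlinarith [sq_nonneg (κ * y ^ 2 / 2 - 544 * v), sq_nonneg v]
  have hB : ∫ p, (Y + (p.1 + (p.2 - x) * i)) ^ 4 ∂μ ≤ y ^ 4 * (1 - κ / 4) + 700000 * v ^ 2 / κ := by
    have h3 : 544 * v * y ^ 2 ≤ y ^ 4 * κ / 4 + 300000 * v ^ 2 / κ := by
      rw [← mul_le_mul_iff_right₀ hκ]
      calc _ ≤ _ := hA
        _ = _ := by field_simp
    have h4 : 370080 * v ^ 2 ≤ 400000 * v ^ 2 / κ := by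
      rw [le_div_iff₀ hκ]; nlinarith [sq_nonneg v]
    have h5 : 256 * Y ^ 2 * (2 * x * v) ≤ 512 * v * y ^ 2 := by
      have : Y ^ 2 * (x * v) ≤ y ^ 2 * (1 * v) := by gcongr
      linarith
    have h6 : Y ^ 2 * v ≤ y ^ 2 * v := by gcongr
    have h7 : 700000 * v ^ 2 / κ = 300000 * v ^ 2 / κ + 400000 * v ^ 2 / κ := by ring
    rw [h7]; nlinarith
  have hden : 0 < (κ ^ 2 - v) ^ 2 := by
    have : 0 < κ ^ 2 - v := by nlinarith [pow_pos hκ 2]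
    positivity
  rw [div_le_iff₀ hden]
  refine hB.trans ?_
  have c1 : (1 - κ / 4) * κ ^ 4 ≤ (κ ^ 2 - v) ^ 2 := by nlinarith [pow_pos hκ 2, sq_nonneg v]
  have c2 : κ ^ 4 / 2 ≤ (κ ^ 2 - v) ^ 2 := by
    have : 7 / 8 * κ ^ 2 ≤ κ ^ 2 - v := by linarith
    calc κ ^ 4 / 2 ≤ (7 / 8 * κ ^ 2) ^ 2 := by nlinarith [pow_pos hκ 4]
      _ ≤ _ := by gcongr
  have d1 : y ^ 4 * (1 - κ / 4) ≤ y ^ 4 / κ ^ 4 * (κ ^ 2 - v) ^ 2 := by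
    calc y ^ 4 * (1 - κ / 4) = y ^ 4 / κ ^ 4 * ((1 - κ / 4) * κ ^ 4) := by field_simp
      _ ≤ _ := by gcongr
  have d2 : 700000 * v ^ 2 / κ ≤ 1400000 * v ^ 2 / κ ^ 5 * (κ ^ 2 - v) ^ 2 := by
    calc 700000 * v ^ 2 / κ = 1400000 * v ^ 2 / κ ^ 5 * (κ ^ 4 / 2) := by field_simp; norm_num
      _ ≤ _ := by gcongr
  linarith

set_option maxHeartbeats 800000 in
lemma hyp_step {μ : Measure (ℝ × ℝ)} {v x κ κ' c : ℝ} (h : IsNoise μ v x) (hv : 0 < v)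
    (hx0 : 0 ≤ x) (hx1 : x ≤ 1) (hc1 : 1 ≤ c) (hc2 : c ≤ 2) (hκ : 0 < κ) (hκ' : 0 < κ')
    (hκx : κ ^ 2 = c ^ 2 / 4 - x) (hκκ : κ' ^ 2 = κ ^ 2 - v) (hvκ : 8 * v ≤ κ ^ 3) (s : ℕ × ℝ) :
    ∫ p, hypJ κ' c (chainStep c s p) ∂μ ≤
      hypJ κ c s + (2 * s.1 + 1) * (1400000 * v ^ 2 / κ ^ 5) := by
  have := h.prob
  obtain ⟨n, d⟩ := s
  have hκc : κ ≤ c / 2 := by nlinarith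
  have hκ'κ : κ' ≤ κ := by nlinarith
  have hκ1 : κ ≤ 1 := by linarith
  have hn : (0:ℝ) < 2 * n + 1 := by positivity
  have he : 0 ≤ 1400000 * v ^ 2 / κ ^ 5 := by positivity
  have hQ : ∀ p : ℝ × ℝ, hypJ κ' c (chainStep c (n, d) p) ≤ (n:ℝ) ^ 2 + (2 * n + 1) *
      min 1 ((max (p.1 - c - p.2 / d + c / 2 + κ' / 2) 0) ^ 4 / κ' ^ 4) := by
    intro p
    unfold chainStep
    generalize p.1 - c - p.2 / (n, d).2 = e
    by_cases hd : 0 < e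
    · have : min 1 ((max (e + c / 2 + κ' / 2) 0) ^ 4 / κ' ^ 4) = 1 := by
        apply min_eq_left
        rw [one_le_div (by positivity)]
        gcongr
        refine le_max_of_le_left ?_
        linarith
      simp only [hypJ, hypF, if_pos hd, this]; push_cast; linarith
    · simp only [hypJ, hypF, if_neg hd]; simp
  have hm : Measurable fun p : ℝ × ℝ => chainStep c (n, d) p :=
    (measurable_chainStep c).comp (measurable_const.prodMk measurable_id)
  have hint : ∀ f : ℝ × ℝ → ℝ, Measurable f → (∀ p, 0 ≤ f p) → (∀ p, f p ≤ (n:ℝ)^2 + (2 * n + 1)) →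
      Integrable f μ := fun f hf h0 h1 =>
    Integrable.of_bound hf.aestronglyMeasurable ((n:ℝ)^2 + (2 * n + 1))
      (Filter.Eventually.of_forall fun p => by
        rw [Real.norm_eq_abs, abs_of_nonneg (h0 p)]; exact h1 p)
  have hJ0 : ∀ p, 0 ≤ hypJ κ' c (chainStep c (n, d) p) := fun p => by
    unfold hypJ; have := hypF_nonneg κ' c (chainStep c (n, d) p).2; positivity
  have hJ1 : ∀ p, hypJ κ' c (chainStep c (n, d) p) ≤ (n:ℝ) ^ 2 + (2 * n + 1) := fun p => by
    refine (hQ p).trans ?_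
    have := min_le_left 1 ((max (p.1 - c - p.2 / d + c / 2 + κ' / 2) 0) ^ 4 / κ' ^ 4)
    nlinarith
  have hJi := hint _ ((measurable_hypJ κ' c).comp hm) hJ0 hJ1
  by_cases hd : d ≤ 0 ∧ κ / 2 ≤ d + c / 2
  · have hF : hypF κ c d = 1 := by
      unfold hypF
      rw [if_neg (not_lt.mpr hd.1)]
      apply min_eq_left
      rw [one_le_div (by positivity)]
      gcongr
      refine le_max_of_le_left ?_
      linarith [hd.2]
    have : hypJ κ c (n, d) = (n:ℝ) ^ 2 + (2 * n + 1) := by simp [hypJ, hF]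
    rw [this]
    have h2 : ∫ p, hypJ κ' c (chainStep c (n, d) p) ∂μ ≤ ∫ _p, ((n:ℝ) ^ 2 + (2 * n + 1)) ∂μ :=
      integral_mono hJi (integrable_const _) hJ1
    simp only [integral_const, probReal_univ, smul_eq_mul, one_mul] at h2
    nlinarith
  · obtain ⟨ds, hds0, hds1, hmono, hFy⟩ : ∃ ds : ℝ, -c / 2 - κ / 2 ≤ ds ∧ ds ≤ -c / 2 + κ / 2 ∧
        (∀ b : ℝ, 0 ≤ b → - (b / d) ≤ - (b / ds)) ∧
        hypF κ c d = (ds + c / 2 + κ / 2) ^ 4 / κ ^ 4 := by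
      by_cases hdp : 0 < d
      · refine ⟨-c / 2 - κ / 2, le_rfl, by linarith, fun b hb => ?_, ?_⟩
        · have h1 : 0 ≤ b / d := by positivity
          have h2 : b / (-c / 2 - κ / 2) ≤ 0 := div_nonpos_of_nonneg_of_nonpos hb (by linarith)
          linarith
        · simp only [hypF, if_pos hdp]
          rw [show -c / 2 - κ / 2 + c / 2 + κ / 2 = 0 by ring]; simp
      · have hd1 : d + c / 2 < κ / 2 := by
          by_contra hcon; exact hd ⟨not_lt.mp hdp, not_lt.mp hcon⟩
        have hdn : d < 0 := by linarith
        refine ⟨max d (-c / 2 - κ / 2), le_max_right _ _, max_le (by linarith) (by linarith),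
          fun b hb => ?_, ?_⟩
        · rw [← div_neg, ← div_neg]
          have h1 : 0 < -max d (-c / 2 - κ / 2) := by
            rw [neg_pos]; exact max_lt hdn (by linarith)
          have h2 := le_max_left d (-c / 2 - κ / 2)
          gcongr
        · have hmx : max d (-c / 2 - κ / 2) + c / 2 + κ / 2 = max (d + c / 2 + κ / 2) 0 := by
            rcases le_total d (-c / 2 - κ / 2) with hle | hle
            · rw [max_eq_right hle, max_eq_right (by linarith)]; ring
            · rw [max_eq_left hle, max_eq_left (by linarith)]
          rw [hmx]
          unfold hypF
          rw [if_neg hdp]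
          apply min_eq_right
          rw [div_le_one (by positivity)]
          gcongr
          exact max_le (by linarith) hκ.le
    set r := ds + c / 2 with hr
    set w := c / 2 - r with hw
    have hwds : ds = -w := by rw [hw, hr]; ring
    have hw4 : 1 / 4 ≤ w := by rw [hw, hr]; linarith
    have hw0 : 0 < w := by linarith
    set y := r + κ / 2 with hy
    have hy0 : 0 ≤ y := by rw [hy, hr]; linarith
    have hyκ : y ≤ κ := by rw [hy, hr]; linarith
    obtain ⟨qi, qb⟩ := quartic_step h hv hx0 hx1 hκ hκ1 hvκ hy0 hw4
    have hkey : ∀ p : ℝ × ℝ, 0 ≤ p.2 → hypJ κ' c (chainStep c (n, d) p) ≤ (n:ℝ) ^ 2 + (2 * n + 1) *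
        ((y * (1 - κ / 2) + (p.1 + (p.2 - x) / w)) ^ 4 / (κ ^ 2 - v) ^ 2) := by
      intro p hp
      refine (hQ p).trans ?_
      rw [← hκκ, ← pow_mul]
      gcongr
      refine (min_le_right _ _).trans ?_
      gcongr ?_ / κ' ^ 4
      have h1 : max (p.1 - c - p.2 / d + c / 2 + κ' / 2) 0 ≤
          |y * (1 - κ / 2) + (p.1 + (p.2 - x) / w)| := by
        refine max_le (le_trans ?_ (le_abs_self _)) (abs_nonneg _)
        have h2 := hmono p.2 hp
        rw [hwds, div_neg, neg_neg] at h2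
        have h3 : x / w = c / 2 + r - (κ ^ 2 - r ^ 2) / w := by
          rw [hκx]; field_simp; rw [hw]; ring
        have h4 : y * (κ / 2) ≤ (κ ^ 2 - r ^ 2) / w := by
          rw [le_div_iff₀ hw0]
          have hr2 : r ^ 2 ≤ κ ^ 2 / 4 := by
            rw [hy] at hy0 hyκ; nlinarith
          have hw34 : w ≤ 3 / 2 := by rw [hw]; rw [hy] at hy0; linarith
          calc y * (κ / 2) * w ≤ κ * (κ / 2) * (3 / 2) := by gcongr
            _ ≤ _ := by nlinarith
        have h5 : (p.2 - x) / w = p.2 / w - x / w := by ring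
        rw [h5, h3]
        have e1 : y = r + κ / 2 := rfl
        have e2 : y * (1 - κ / 2) = y - y * (κ / 2) := by ring
        linarith
      calc (max (p.1 - c - p.2 / d + c / 2 + κ' / 2) 0) ^ 4
          ≤ |y * (1 - κ / 2) + (p.1 + (p.2 - x) / w)| ^ 4 := by gcongr
        _ = _ := by rw [← abs_pow, abs_of_nonneg (by positivity)]
    have hfin : ∫ p, hypJ κ' c (chainStep c (n, d) p) ∂μ ≤
        ∫ p, ((n:ℝ) ^ 2 + (2 * n + 1) *
        ((y * (1 - κ / 2) + (p.1 + (p.2 - x) / w)) ^ 4 / (κ ^ 2 - v) ^ 2)) ∂μ := by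
      refine integral_mono_ae hJi ?_ ?_
      · exact (integrable_const _).add ((qi.div_const _).const_mul _)
      · filter_upwards [h.snd_nonneg] with p hp using hkey p hp
    rw [integral_add (integrable_const _) ((qi.div_const _).const_mul _), integral_const_mul,
      integral_div] at hfin
    simp only [integral_const, probReal_univ, smul_eq_mul, one_mul] at hfin
    refine hfin.trans ?_
    simp only [hypJ, hFy]
    have := mul_le_mul_of_nonneg_left qb hn.le
    linarith

/-- The angle under which the pivot `d` is seen from the fixed point `-c/2 ± iη` of the recursion. -/
def phase (η c d : ℝ) : ℝ := Real.pi / 2 - Real.arctan ((d + c / 2) / η)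

lemma phase_pos (η c d : ℝ) : 0 < phase η c d := by
  unfold phase; linarith [Real.arctan_lt_pi_div_two ((d + c / 2) / η)]

lemma phase_lt_pi (η c d : ℝ) : phase η c d < Real.pi := by
  unfold phase; linarith [Real.neg_pi_div_two_lt_arctan ((d + c / 2) / η)]

lemma measurable_phase (η c : ℝ) : Measurable (phase η c) := by
  unfold phase
  exact measurable_const.sub (Real.measurable_arctan.comp (by fun_prop))

lemma phase_eq_arg {η : ℝ} (hη : 0 < η) (c d : ℝ) :
    phase η c d = Complex.arg ⟨d + c / 2, η⟩ := by
  set t := (d + c / 2) / η with ht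
  have h1 : (⟨d + c / 2, η⟩ : ℂ) = ((η * Real.sqrt (1 + t ^ 2) : ℝ) : ℂ) *
      (Complex.cos (phase η c d : ℝ) + Complex.sin (phase η c d : ℝ) * I) := by
    have hs : 0 < Real.sqrt (1 + t ^ 2) := Real.sqrt_pos.mpr (by positivity)
    have e1 : Real.cos (phase η c d) = t / Real.sqrt (1 + t ^ 2) := by
      rw [phase, Real.cos_pi_div_two_sub, Real.sin_arctan]
    have e2 : Real.sin (phase η c d) = 1 / Real.sqrt (1 + t ^ 2) := by
      rw [phase, Real.sin_pi_div_two_sub, Real.cos_arctan]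
    rw [← Complex.ofReal_cos, ← Complex.ofReal_sin, e1, e2]
    apply Complex.ext
    · simp only [add_re, ofReal_re, mul_re, I_re, mul_zero, ofReal_im, I_im,
        mul_one, sub_self, add_zero, zero_mul, sub_zero]
      rw [ht]; field_simp
    · simp only [add_im, ofReal_re, mul_im, I_re, mul_zero, ofReal_im, I_im,
        mul_one, zero_add, add_zero, zero_mul]
      field_simp
  rw [h1, Complex.arg_mul_cos_add_sin_mul_I (by positivity)]
  exact ⟨by linarith [phase_pos η c d, Real.pi_pos], (phase_lt_pi η c d).le⟩

lemma arg_sub_arg {w w' : ℂ} (hw : 0 < w.im) (hw' : 0 < w'.im) :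
    arg w' - arg w = arg (1 + (w' - w) / w) := by
  have h0 : w ≠ 0 := fun h => by simp [h] at hw
  have h0' : w' ≠ 0 := fun h => by simp [h] at hw'
  have key : ∀ x : ℂ, 0 < x.im → 0 < arg x ∧ arg x < Real.pi := by
    intro x hx
    refine ⟨?_, ?_⟩
    · rcases (Complex.arg_nonneg_iff.mpr hx.le).lt_or_eq with h | h
      · exact h
      · exact absurd ((Complex.arg_eq_zero_iff.mp h.symm).2) hx.ne'
    · refine lt_of_le_of_ne (Complex.arg_le_pi x) fun h => ?_
      exact absurd ((Complex.arg_eq_pi_iff.mp h).2) hx.ne'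
  obtain ⟨a1, a2⟩ := key w hw
  obtain ⟨b1, b2⟩ := key w' hw'
  have e : 1 + (w' - w) / w = w' * w⁻¹ := by field_simp; ring
  have hi : arg w⁻¹ = -arg w := by rw [Complex.arg_inv, if_neg a2.ne]
  rw [e, Complex.arg_mul h0' (inv_ne_zero h0), hi, sub_eq_add_neg]
  rw [hi]; exact ⟨by linarith, by linarith⟩

/-- The unperturbed recursion is a rotation of the phase. -/
lemma phase_rotation {η c d : ℝ} (hη : 0 < η) (hc : 0 < c) (hd : d ≠ 0) :
    phase η c (-c - (c ^ 2 / 4 + η ^ 2) / d) =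
      phase η c d - Real.arctan (2 * η / c) + if 0 < d then Real.pi else 0 := by
  have hxy : (d + c / 2) / η * (2 * η / c) = 1 + 2 * d / c := by field_simp; ring
  have hq : ((d + c / 2) / η + 2 * η / c) / (1 - (d + c / 2) / η * (2 * η / c)) =
      (-c - (c ^ 2 / 4 + η ^ 2) / d + c / 2) / η := by
    rw [hxy]
    have : 1 - (1 + 2 * d / c) ≠ 0 := by
      have : 2 * d / c ≠ 0 := by positivity
      intro h; apply this; linarith
    rw [div_eq_div_iff this hη.ne']
    field_simp
    ring
  unfold phase
  rw [← hq]
  by_cases h : 0 < d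
  · rw [if_pos h]
    have := Real.arctan_add_eq_add_pi (x := (d + c / 2) / η) (y := 2 * η / c)
      (by rw [hxy]; have : 0 < 2 * d / c := by positivity
          linarith) (by positivity)
    linarith
  · rw [if_neg h]
    have hd' : d < 0 := lt_of_le_of_ne (not_lt.mp h) hd
    have := Real.arctan_add (x := (d + c / 2) / η) (y := 2 * η / c)
      (by rw [hxy]; have : 2 * d / c < 0 := div_neg_of_neg_of_pos (by linarith) hc
          linarith)
    linarith

/-- The inverse of the distance of the image pivot from the fixed point. -/
def pertU (η c d : ℝ) : ℂ := (⟨-c / 2 - (c ^ 2 / 4 + η ^ 2) / d, η⟩ : ℂ)⁻¹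

def pertE (η η' c d : ℝ) (p : ℝ × ℝ) : ℂ :=
  (p.1 + (η' - η : ℝ) * I) * pertU η c d - (p.2 - (c ^ 2 / 4 + η ^ 2) : ℝ) * (pertU η c d / d)

lemma phase_step {η η' c d : ℝ} (hη : 0 < η) (hη' : 0 < η') (hc : 0 < c) (hd : d ≠ 0)
    (p : ℝ × ℝ) :
    phase η' c (p.1 - c - p.2 / d) = phase η c d - Real.arctan (2 * η / c) +
      (if 0 < d then Real.pi else 0) + arg (1 + pertE η η' c d p) := by
  rw [← phase_rotation hη hc hd, phase_eq_arg hη', phase_eq_arg hη]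
  have h := arg_sub_arg (w := ⟨-c - (c ^ 2 / 4 + η ^ 2) / d + c / 2, η⟩)
    (w' := ⟨p.1 - c - p.2 / d + c / 2, η'⟩) hη hη'
  have e : ((⟨p.1 - c - p.2 / d + c / 2, η'⟩ : ℂ) - ⟨-c - (c ^ 2 / 4 + η ^ 2) / d + c / 2, η⟩) /
      ⟨-c - (c ^ 2 / 4 + η ^ 2) / d + c / 2, η⟩ = pertE η η' c d p := by
    unfold pertE pertU
    rw [show -c - (c ^ 2 / 4 + η ^ 2) / d + c / 2 = -c / 2 - (c ^ 2 / 4 + η ^ 2) / d by ring,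
      div_eq_mul_inv]
    generalize (⟨-c / 2 - (c ^ 2 / 4 + η ^ 2) / d, η⟩ : ℂ)⁻¹ = u
    rw [show ∀ x y : ℂ, (x * u - y * (u / (d : ℂ))) = (x - y / d) * u by intros; ring]
    congr 1
    apply Complex.ext
    · simp [-ofReal_add, -ofReal_sub, -ofReal_pow, ← ofReal_div]; ring
    · simp [-ofReal_add, -ofReal_sub, -ofReal_pow, ← ofReal_div]
  rw [e] at h
  linarith

section arg

lemma abs_arg_one_add_le (E : ℂ) : |arg (1 + E)| ≤ 7 * ‖E‖ := by
  rcases lt_or_ge ‖E‖ (1 / 2) with h | h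
  · have h1 := Complex.norm_log_one_add_half_le_self h.le
    have h2 := Complex.abs_im_le_norm (log (1 + E))
    rw [Complex.log_im] at h2
    linarith [norm_nonneg E]
  · have := Complex.abs_arg_le_pi (1 + E)
    linarith [Real.pi_lt_d2]

lemma abs_arg_one_add_sub_le (E : ℂ) : |arg (1 + E) - E.im| ≤ 15 * ‖E‖ ^ 2 := by
  rcases lt_or_ge ‖E‖ (1 / 2) with h | h
  · have h1 := Complex.norm_log_one_add_sub_self_le (h.trans (by norm_num))
    have h2 := Complex.abs_im_le_norm (log (1 + E) - E)
    rw [Complex.sub_im, Complex.log_im] at h2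
    have h3 : (1 - ‖E‖)⁻¹ ≤ 2 := by
      rw [inv_le_comm₀ (by linarith) (by norm_num)]; linarith
    have h4 : ‖E‖ ^ 2 * (1 - ‖E‖)⁻¹ ≤ ‖E‖ ^ 2 * 2 := by gcongr
    nlinarith [sq_nonneg ‖E‖]
  · have h1 := abs_sub (arg (1 + E)) E.im
    have h2 := abs_arg_one_add_le E
    have h3 := Complex.abs_im_le_norm E
    have h4 := Complex.abs_arg_le_pi (1 + E)
    nlinarith [Real.pi_lt_d2]

lemma abs_arg_one_add_sub_sub_le (E : ℂ) :
    |arg (1 + E) - (E - E ^ 2 / 2).im| ≤ 31 * ‖E‖ ^ 3 := by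
  rcases lt_or_ge ‖E‖ (1 / 2) with h | h
  · have h1 := Complex.norm_log_sub_logTaylor_le 2 (h.trans (by norm_num))
    have e : logTaylor (2 + 1) E = E - E ^ 2 / 2 := by
      simp [Complex.logTaylor_succ, Complex.logTaylor_zero]; ring
    have h2 := Complex.abs_im_le_norm (log (1 + E) - (E - E ^ 2 / 2))
    rw [Complex.sub_im, Complex.log_im] at h2
    rw [e] at h1
    have h3 : (1 - ‖E‖)⁻¹ ≤ 2 := by
      rw [inv_le_comm₀ (by linarith) (by norm_num)]; linarith
    have h4 : ‖E‖ ^ 3 * (1 - ‖E‖)⁻¹ ≤ ‖E‖ ^ 3 * 2 := by gcongr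
    norm_num at h1
    have := pow_nonneg (norm_nonneg E) 3
    linarith
  · have h1 := abs_arg_one_add_sub_le E
    have h2 := Complex.abs_im_le_norm (E ^ 2 / 2)
    rw [norm_div, norm_pow, Complex.norm_two] at h2
    have e : arg (1 + E) - (E - E ^ 2 / 2).im = (arg (1 + E) - E.im) + (E ^ 2 / 2 : ℂ).im := by
      rw [Complex.sub_im]; ring
    rw [e]
    refine (abs_add_le _ _).trans ?_
    have h3 : ‖E‖ ^ 2 * (1 / 2) ≤ ‖E‖ ^ 2 * ‖E‖ := by gcongr
    nlinarith

end arg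

/-- An affine complex combination of the noise variables. -/
def linNoise (x : ℝ) (u V κ : ℂ) (p : ℝ × ℝ) : ℂ := p.1 * u - (p.2 - x : ℝ) * V + κ

lemma measurable_linNoise (x : ℝ) (u V κ : ℂ) : Measurable (linNoise x u V κ) := by
  unfold linNoise; fun_prop

lemma norm_linNoise_le (x : ℝ) (u V κ : ℂ) (p : ℝ × ℝ) :
    ‖linNoise x u V κ p‖ ≤ |p.1| * ‖u‖ + |p.2 - x| * ‖V‖ + ‖κ‖ := by
  unfold linNoise
  refine (norm_add_le _ _).trans (add_le_add_left ((norm_sub_le _ _).trans ?_) _)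
  rw [norm_mul, norm_mul, Complex.norm_real, Complex.norm_real, Real.norm_eq_abs, Real.norm_eq_abs]

lemma norm_linNoise_sq_le (x : ℝ) (u V κ : ℂ) (p : ℝ × ℝ) :
    ‖linNoise x u V κ p‖ ^ 2 ≤
      3 * ‖u‖ ^ 2 * p.1 ^ 2 + 3 * ‖V‖ ^ 2 * (p.2 - x) ^ 2 + 3 * ‖κ‖ ^ 2 := by
  have h := norm_linNoise_le x u V κ p
  have h2 : ‖linNoise x u V κ p‖ ^ 2 ≤ (|p.1| * ‖u‖ + |p.2 - x| * ‖V‖ + ‖κ‖) ^ 2 := by gcongr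
  have e1 : (|p.1| * ‖u‖) ^ 2 = ‖u‖ ^ 2 * p.1 ^ 2 := by rw [mul_pow, sq_abs]; ring
  have e2 : (|p.2 - x| * ‖V‖) ^ 2 = ‖V‖ ^ 2 * (p.2 - x) ^ 2 := by rw [mul_pow, sq_abs]; ring
  nlinarith [sq_nonneg (|p.1| * ‖u‖ - |p.2 - x| * ‖V‖), sq_nonneg (|p.1| * ‖u‖ - ‖κ‖),
    sq_nonneg (|p.2 - x| * ‖V‖ - ‖κ‖)]

lemma norm_linNoise_pow_le (x : ℝ) (u V κ : ℂ) (p : ℝ × ℝ) :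
    ‖linNoise x u V κ p‖ ^ 4 ≤
      27 * ‖u‖ ^ 4 * p.1 ^ 4 + 27 * ‖V‖ ^ 4 * (p.2 - x) ^ 4 + 27 * ‖κ‖ ^ 4 := by
  have h := norm_linNoise_sq_le x u V κ p
  have h2 : (‖linNoise x u V κ p‖ ^ 2) ^ 2 ≤ (3 * ‖u‖ ^ 2 * p.1 ^ 2 +
    3 * ‖V‖ ^ 2 * (p.2 - x) ^ 2 + 3 * ‖κ‖ ^ 2) ^ 2 := by gcongr
  nlinarith [sq_nonneg (‖u‖ ^ 2 * p.1 ^ 2 - ‖V‖ ^ 2 * (p.2 - x) ^ 2),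
    sq_nonneg (‖u‖ ^ 2 * p.1 ^ 2 - ‖κ‖ ^ 2), sq_nonneg (‖V‖ ^ 2 * (p.2 - x) ^ 2 - ‖κ‖ ^ 2)]

namespace IsNoise

variable {μ : Measure (ℝ × ℝ)} {v x : ℝ}

lemma integrable_norm_sq (h : IsNoise μ v x) (u V κ : ℂ) :
    Integrable (fun p => ‖linNoise x u V κ p‖ ^ 2) μ := by
  have := h.prob
  refine Integrable.mono' (((h.integrable_fst_sq.const_mul (3 * ‖u‖ ^ 2)).add
    (h.integrable_snd_sq.const_mul (3 * ‖V‖ ^ 2))).add (integrable_const (3 * ‖κ‖ ^ 2)))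
    ((measurable_linNoise x u V κ).norm.pow_const 2).aestronglyMeasurable
    (Filter.Eventually.of_forall fun p => ?_)
  rw [Real.norm_eq_abs, abs_of_nonneg (by positivity)]
  exact norm_linNoise_sq_le x u V κ p

lemma integrable_norm_pow (h : IsNoise μ v x) (u V κ : ℂ) :
    Integrable (fun p => ‖linNoise x u V κ p‖ ^ 4) μ := by
  have := h.prob
  refine Integrable.mono' (((h.integrable_fst_pow.const_mul (27 * ‖u‖ ^ 4)).add
    (h.integrable_snd_pow.const_mul (27 * ‖V‖ ^ 4))).add (integrable_const (27 * ‖κ‖ ^ 4)))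
    ((measurable_linNoise x u V κ).norm.pow_const 4).aestronglyMeasurable
    (Filter.Eventually.of_forall fun p => ?_)
  rw [Real.norm_eq_abs, abs_of_nonneg (by positivity)]
  exact norm_linNoise_pow_le x u V κ p

lemma integral_norm_sq_le (h : IsNoise μ v x) (u V κ : ℂ) :
    ∫ p, ‖linNoise x u V κ p‖ ^ 2 ∂μ ≤ 6 * v * ‖u‖ ^ 2 + 6 * x * v * ‖V‖ ^ 2 + 3 * ‖κ‖ ^ 2 := by
  have := h.prob
  have i1 := h.integrable_fst_sq.const_mul (3 * ‖u‖ ^ 2)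
  have i2 := h.integrable_snd_sq.const_mul (3 * ‖V‖ ^ 2)
  refine (integral_mono (h.integrable_norm_sq u V κ) ((i1.add i2).add
    (integrable_const (3 * ‖κ‖ ^ 2))) (norm_linNoise_sq_le x u V κ)).trans ?_
  rw [integral_add' (i1.add i2) (integrable_const _), integral_add' i1 i2]
  simp only [integral_const_mul, h.integral_fst_sq, h.integral_snd_sq, integral_const,
    probReal_univ, smul_eq_mul, one_mul]
  apply le_of_eq; ring

lemma integral_norm_pow_le (h : IsNoise μ v x) (u V κ : ℂ) :
    ∫ p, ‖linNoise x u V κ p‖ ^ 4 ∂μ ≤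
      1620 * v ^ 2 * ‖u‖ ^ 4 + 1620 * v ^ 2 * ‖V‖ ^ 4 + 27 * ‖κ‖ ^ 4 := by
  have := h.prob
  have i1 := h.integrable_fst_pow.const_mul (27 * ‖u‖ ^ 4)
  have i2 := h.integrable_snd_pow.const_mul (27 * ‖V‖ ^ 4)
  refine (integral_mono (h.integrable_norm_pow u V κ) ((i1.add i2).add
    (integrable_const (27 * ‖κ‖ ^ 4))) (norm_linNoise_pow_le x u V κ)).trans ?_
  rw [integral_add' (i1.add i2) (integrable_const _), integral_add' i1 i2]
  simp only [integral_const_mul, integral_const,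
    probReal_univ, smul_eq_mul, one_mul]
  have e1 := mul_le_mul_of_nonneg_left h.integral_fst_pow (show 0 ≤ 27 * ‖u‖ ^ 4 by positivity)
  have e2 := mul_le_mul_of_nonneg_left h.integral_snd_pow (show 0 ≤ 27 * ‖V‖ ^ 4 by positivity)
  linarith

lemma integral_im (h : IsNoise μ v x) (u V κ : ℂ) :
    Integrable (fun p => (linNoise x u V κ p).im) μ ∧
      ∫ p, (linNoise x u V κ p).im ∂μ = κ.im := by
  have := h.prob
  have e : (fun p => (linNoise x u V κ p).im) =
      fun p => u.im * p.1 + (-V.im) * (p.2 - x) + κ.im := by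
    funext p
    simp [linNoise, -ofReal_sub]; ring
  have i1 := h.integrable_fst.const_mul u.im
  have i2 := h.integrable_snd.const_mul (-V.im)
  rw [e]
  refine ⟨(i1.add i2).add (integrable_const _), ?_⟩
  rw [integral_add (by fun_prop) (by fun_prop), integral_add i1 i2]
  simp only [integral_const_mul, h.integral_fst, h.integral_snd, integral_const,
    probReal_univ, smul_eq_mul, one_mul]
  ring

lemma integral_sq_im (h : IsNoise μ v x) (u V κ : ℂ) :
    Integrable (fun p => (linNoise x u V κ p ^ 2).im) μ ∧
      ∫ p, (linNoise x u V κ p ^ 2).im ∂μ = (κ ^ 2).im + 2 * v * (u ^ 2).im +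
        2 * x * v * (V ^ 2).im := by
  have := h.prob
  have e : (fun p => (linNoise x u V κ p ^ 2).im) =
      fun p => (u ^ 2).im * p.1 ^ 2 + (V ^ 2).im * (p.2 - x) ^ 2 +
        (-(2 * u * V).im) * (p.1 * (p.2 - x)) + (2 * u * κ).im * p.1 +
        (-(2 * V * κ).im) * (p.2 - x) + (κ ^ 2).im := by
    funext p
    simp [linNoise, -ofReal_sub, pow_two]; ring
  have i1 := h.integrable_fst_sq.const_mul (u ^ 2).im
  have i2 := h.integrable_snd_sq.const_mul (V ^ 2).im
  have i3 := h.integrable_mul.const_mul (-(2 * u * V).im)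
  have i4 := h.integrable_fst.const_mul (2 * u * κ).im
  have i5 := h.integrable_snd.const_mul (-(2 * V * κ).im)
  rw [e]
  refine ⟨((((i1.add i2).add i3).add i4).add i5).add (integrable_const _), ?_⟩
  rw [integral_add (by fun_prop) (by fun_prop), integral_add (by fun_prop) (by fun_prop),
    integral_add (by fun_prop) (by fun_prop), integral_add (by fun_prop) (by fun_prop),
    integral_add i1 i2]
  simp only [integral_const_mul, h.integral_fst, h.integral_snd, h.integral_mul, h.integral_fst_sq,
    h.integral_snd_sq, integral_const, probReal_univ, smul_eq_mul, one_mul]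
  ring

lemma measurable_arg (x : ℝ) (u V κ : ℂ) :
    Measurable fun p => arg (1 + linNoise x u V κ p) :=
  Complex.measurable_arg.comp (measurable_const.add (measurable_linNoise x u V κ))

lemma integrable_comp_arg (h : IsNoise μ v x) (u V κ : ℂ) {f : ℝ → ℝ} (hf : Continuous f) :
    Integrable (fun p => f (arg (1 + linNoise x u V κ p))) μ := by
  have := h.prob
  obtain ⟨C, hC⟩ := (isCompact_Icc (a := -Real.pi) (b := Real.pi)).exists_bound_of_continuousOn
    hf.continuousOn
  refine Integrable.of_bound (hf.measurable.comp (measurable_arg x u V κ)).aestronglyMeasurable C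
    (Filter.Eventually.of_forall fun p => hC _ ?_)
  exact ⟨(Complex.neg_pi_lt_arg _).le, Complex.arg_le_pi _⟩

lemma integral_arg_sq_le (h : IsNoise μ v x) (u V κ : ℂ) :
    ∫ p, arg (1 + linNoise x u V κ p) ^ 2 ∂μ ≤
      49 * (6 * v * ‖u‖ ^ 2 + 6 * x * v * ‖V‖ ^ 2 + 3 * ‖κ‖ ^ 2) := by
  refine (integral_mono (h.integrable_comp_arg u V κ (f := fun t => t ^ 2) (by fun_prop))
    ((h.integrable_norm_sq u V κ).const_mul 49) fun p => ?_).trans ?_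
  · have h1 := abs_arg_one_add_le (linNoise x u V κ p)
    have h2 : |arg (1 + linNoise x u V κ p)| ^ 2 ≤ (7 * ‖linNoise x u V κ p‖) ^ 2 := by gcongr
    rw [sq_abs] at h2
    simp only
    linarith
  · rw [integral_const_mul]
    have := h.integral_norm_sq_le u V κ
    linarith

lemma abs_integral_arg_le (h : IsNoise μ v x) (u V κ : ℂ) :
    |∫ p, arg (1 + linNoise x u V κ p) ∂μ| ≤
      |κ.im| + 15 * (6 * v * ‖u‖ ^ 2 + 6 * x * v * ‖V‖ ^ 2 + 3 * ‖κ‖ ^ 2) := by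
  obtain ⟨i1, e1⟩ := h.integral_im u V κ
  have i0 := h.integrable_comp_arg u V κ continuous_id
  simp only [id] at i0
  have h1 : |∫ p, (arg (1 + linNoise x u V κ p) - (linNoise x u V κ p).im) ∂μ| ≤
      ∫ p, 15 * ‖linNoise x u V κ p‖ ^ 2 ∂μ := by
    refine (abs_integral_le_integral_abs).trans (integral_mono (i0.sub i1).abs
      ((h.integrable_norm_sq u V κ).const_mul 15) fun p => abs_arg_one_add_sub_le _)
  rw [integral_sub i0 i1, e1, integral_const_mul] at h1
  have h2 := h.integral_norm_sq_le u V κ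
  have h3 := abs_add_le (∫ p, arg (1 + linNoise x u V κ p) ∂μ - κ.im) κ.im
  rw [sub_add_cancel] at h3
  linarith

lemma abs_integral_arg_sub_le (h : IsNoise μ v x) (u V κ : ℂ) {η : ℝ} (hη : 0 < η) :
    |∫ p, arg (1 + linNoise x u V κ p) ∂μ - (κ.im - (κ ^ 2).im / 2 - v * (u ^ 2).im -
        x * v * (V ^ 2).im)| ≤
      31 / 2 * (η * (6 * v * ‖u‖ ^ 2 + 6 * x * v * ‖V‖ ^ 2 + 3 * ‖κ‖ ^ 2) +
        (1620 * v ^ 2 * ‖u‖ ^ 4 + 1620 * v ^ 2 * ‖V‖ ^ 4 + 27 * ‖κ‖ ^ 4) / η) := by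
  obtain ⟨i1, e1⟩ := h.integral_im u V κ
  obtain ⟨i2, e2⟩ := h.integral_sq_im u V κ
  have i0 := h.integrable_comp_arg u V κ continuous_id
  simp only [id] at i0
  have i3 : Integrable (fun p => (linNoise x u V κ p).im - (linNoise x u V κ p ^ 2).im / 2) μ :=
    i1.sub (i2.div_const 2)
  have b2 := h.integrable_norm_sq u V κ
  have b4 := h.integrable_norm_pow u V κ
  have h1 : |∫ p, (arg (1 + linNoise x u V κ p) - ((linNoise x u V κ p).im -
      (linNoise x u V κ p ^ 2).im / 2)) ∂μ| ≤
      ∫ p, (31 / 2 * η * ‖linNoise x u V κ p‖ ^ 2 + 31 / 2 / η * ‖linNoise x u V κ p‖ ^ 4) ∂μ := by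
    refine (abs_integral_le_integral_abs).trans (integral_mono (i0.sub i3).abs
      ((b2.const_mul _).add (b4.const_mul _)) fun p => ?_)
    have h2 := abs_arg_one_add_sub_sub_le (linNoise x u V κ p)
    rw [Complex.sub_im, show (linNoise x u V κ p ^ 2 / 2 : ℂ).im = (linNoise x u V κ p ^ 2).im / 2 by
      simp] at h2
    refine h2.trans ?_
    set e := ‖linNoise x u V κ p‖
    have he : 0 ≤ e := norm_nonneg _
    have : 31 / 2 * η * e ^ 2 + 31 / 2 / η * e ^ 4 - 31 * e ^ 3 =
        31 / 2 / η * e ^ 2 * (η - e) ^ 2 := by field_simp; ring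
    have h5 : 0 ≤ 31 / 2 / η * e ^ 2 * (η - e) ^ 2 := by positivity
    linarith
  rw [integral_sub i0 i3, integral_sub i1 (i2.div_const 2), e1, integral_div, e2,
    integral_add (b2.const_mul _) (b4.const_mul _), integral_const_mul, integral_const_mul] at h1
  have h2 := h.integral_norm_sq_le u V κ
  have h3 := h.integral_norm_pow_le u V κ
  have h4 : κ.im - (κ ^ 2).im / 2 - v * (u ^ 2).im - x * v * (V ^ 2).im =
    κ.im - ((κ ^ 2).im + 2 * v * (u ^ 2).im + 2 * x * v * (V ^ 2).im) / 2 := by ring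
  rw [h4]
  refine h1.trans ?_
  rw [mul_add, mul_div_assoc', ← mul_assoc]
  rw [show 31 / 2 * (1620 * v ^ 2 * ‖u‖ ^ 4 + 1620 * v ^ 2 * ‖V‖ ^ 4 + 27 * ‖κ‖ ^ 4) / η =
    31 / 2 / η * (1620 * v ^ 2 * ‖u‖ ^ 4 + 1620 * v ^ 2 * ‖V‖ ^ 4 + 27 * ‖κ‖ ^ 4) by ring]
  gcongr

end IsNoise

section

/-- Correction term turning the phase into an approximate martingale. -/
def phaseCor (c α : ℝ) : ℝ := 5 * c / 16 * Real.cos (2 * α) - c / 16 * Real.cos (4 * α)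

def phaseCor' (c α : ℝ) : ℝ := -(5 * c / 8) * Real.sin (2 * α) + c / 4 * Real.sin (4 * α)

lemma hasDerivAt_phaseCor (c α : ℝ) : HasDerivAt (phaseCor c) (phaseCor' c α) α := by
  have h : ∀ m : ℝ, HasDerivAt (fun α : ℝ => Real.cos (m * α)) (-Real.sin (m * α) * m) α := by
    intro m
    have h1 : HasDerivAt (fun α : ℝ => m * α) m α := by
      simpa using (hasDerivAt_id α).const_mul m
    exact h1.cos
  have := ((h 2).const_mul (5 * c / 16)).sub ((h 4).const_mul (c / 16))
  refine this.congr_deriv ?_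
  unfold phaseCor'; ring

lemma hasDerivAt_phaseCor' (c α : ℝ) : HasDerivAt (phaseCor' c)
    (-(5 * c / 4) * Real.cos (2 * α) + c * Real.cos (4 * α)) α := by
  have h : ∀ m : ℝ, HasDerivAt (fun α : ℝ => Real.sin (m * α)) (Real.cos (m * α) * m) α := by
    intro m
    have h1 : HasDerivAt (fun α : ℝ => m * α) m α := by
      simpa using (hasDerivAt_id α).const_mul m
    exact h1.sin
  have := ((h 2).const_mul (-(5 * c / 8))).add ((h 4).const_mul (c / 4))
  refine this.congr_deriv ?_
  ring

lemma continuous_phaseCor (c : ℝ) : Continuous (phaseCor c) := by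
  unfold phaseCor; fun_prop

variable {c : ℝ}

lemma abs_phaseCor_le (hc0 : 0 ≤ c) (hc2 : c ≤ 2) (α : ℝ) : |phaseCor c α| ≤ 1 := by
  have h1 := Real.neg_one_le_cos (2 * α)
  have h2 := Real.cos_le_one (2 * α)
  have h3 := Real.neg_one_le_cos (4 * α)
  have h4 := Real.cos_le_one (4 * α)
  unfold phaseCor
  rw [abs_le]; constructor <;> nlinarith

lemma abs_phaseCor'_le (hc0 : 0 ≤ c) (hc2 : c ≤ 2) (α : ℝ) : |phaseCor' c α| ≤ 2 := by
  have h1 := Real.neg_one_le_sin (2 * α)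
  have h2 := Real.sin_le_one (2 * α)
  have h3 := Real.neg_one_le_sin (4 * α)
  have h4 := Real.sin_le_one (4 * α)
  unfold phaseCor'
  rw [abs_le]; constructor <;> nlinarith

lemma abs_phaseCor_sub_le (hc0 : 0 ≤ c) (hc2 : c ≤ 2) (α β : ℝ) :
    |phaseCor c β - phaseCor c α| ≤ 2 * |β - α| := by
  have := (convex_univ (𝕜 := ℝ) (E := ℝ)).norm_image_sub_le_of_norm_hasDerivWithin_le
    (f := phaseCor c) (f' := phaseCor' c) (C := 2)
    (fun x _ => (hasDerivAt_phaseCor c x).hasDerivWithinAt)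
    (fun x _ => abs_phaseCor'_le hc0 hc2 x) (Set.mem_univ α) (Set.mem_univ β)
  simpa using this

lemma abs_phaseCor'_sub_le (hc0 : 0 ≤ c) (hc2 : c ≤ 2) (α β : ℝ) :
    |phaseCor' c β - phaseCor' c α| ≤ 5 * |β - α| := by
  have := (convex_univ (𝕜 := ℝ) (E := ℝ)).norm_image_sub_le_of_norm_hasDerivWithin_le
    (f := phaseCor' c) (C := 5)
    (fun x _ => (hasDerivAt_phaseCor' c x).hasDerivWithinAt)
    (fun x _ => ?_) (Set.mem_univ α) (Set.mem_univ β)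
  · simpa using this
  · have h1 := Real.neg_one_le_cos (2 * x)
    have h2 := Real.cos_le_one (2 * x)
    have h3 := Real.neg_one_le_cos (4 * x)
    have h4 := Real.cos_le_one (4 * x)
    rw [Real.norm_eq_abs, abs_le]; constructor <;> nlinarith

lemma abs_phaseCor_taylor (hc0 : 0 ≤ c) (hc2 : c ≤ 2) (α h : ℝ) :
    |phaseCor c (α + h) - phaseCor c α - phaseCor' c α * h| ≤ 5 * h ^ 2 := by
  have := (convex_segment (𝕜 := ℝ) α (α + h)).norm_image_sub_le_of_norm_hasDerivWithin_le
    (f := fun x => phaseCor c x - phaseCor' c α * x)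
    (f' := fun x => phaseCor' c x - phaseCor' c α) (C := 5 * |h|)
    (fun x _ => ((hasDerivAt_phaseCor c x).sub
      (by simpa using (hasDerivAt_id x).const_mul (phaseCor' c α))).hasDerivWithinAt)
    (fun x hx => (abs_phaseCor'_sub_le hc0 hc2 α x).trans ?_) (left_mem_segment _ _ _)
    (right_mem_segment _ _ _)
  · rw [Real.norm_eq_abs, Real.norm_eq_abs, add_sub_cancel_left, mul_assoc, ← abs_mul,
      abs_mul_self] at this
    refine le_trans (le_of_eq ?_) (this.trans (le_of_eq ?_))
    · congr 1; ring
    · ring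
  · have h2 := norm_sub_le_of_mem_segment hx
    simp only [Real.norm_eq_abs, add_sub_cancel_left] at h2
    gcongr

lemma phaseCor_add_pi (c α : ℝ) : phaseCor c (α + Real.pi) = phaseCor c α := by
  unfold phaseCor
  rw [show 2 * (α + Real.pi) = 2 * α + 2 * Real.pi by ring,
    show 4 * (α + Real.pi) = 4 * α + 2 * Real.pi + 2 * Real.pi by ring, Real.cos_add_two_pi,
    Real.cos_add_two_pi, Real.cos_add_two_pi]

/-- The corrected total phase: `π` times the number of positive pivots plus a bounded term. -/
def totalPhase (η β c : ℝ) (s : ℕ × ℝ) : ℝ :=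
  Real.pi * (s.1 - if 0 < s.2 then 1 else 0) - phase η c s.2 + β * phaseCor c (phase η c s.2)

lemma measurable_totalPhase (η β c : ℝ) : Measurable (totalPhase η β c) := by
  unfold totalPhase
  have h1 : Measurable fun s : ℕ × ℝ => phase η c s.2 := (measurable_phase η c).comp measurable_snd
  have h2 : Measurable fun s : ℕ × ℝ => (if 0 < s.2 then 1 else 0 : ℝ) :=
    Measurable.ite (measurableSet_lt measurable_const measurable_snd) measurable_const
      measurable_const
  have h3 : Measurable fun s : ℕ × ℝ => (s.1 : ℝ) := by fun_prop
  exact ((measurable_const.mul (h3.sub h2)).sub h1).add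
    (((continuous_phaseCor c).measurable.comp h1).const_mul β)

def pertV (η c d : ℝ) : ℂ := pertU η c d / d

/-- The deterministic part of the perturbation. -/
def pertK (x η η' c d : ℝ) : ℂ :=
  (η' - η : ℝ) * I * pertU η c d - (x - (c ^ 2 / 4 + η ^ 2) : ℝ) * pertV η c d

lemma pertE_eq (x η η' c d : ℝ) (p : ℝ × ℝ) :
    pertE η η' c d p = linNoise x (pertU η c d) (pertV η c d) (pertK x η η' c d) p := by
  unfold pertE linNoise pertK pertV
  push_cast; ring

lemma totalPhase_step {η η' c : ℝ} {s : ℕ × ℝ} (hη : 0 < η) (hη' : 0 < η') (hc : 0 < c)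
    (hd : s.2 ≠ 0) (x β β' : ℝ) (p : ℝ × ℝ) :
    totalPhase η' β' c (chainStep c s p) - totalPhase η β c s =
      Real.arctan (2 * η / c) -
        arg (1 + linNoise x (pertU η c s.2) (pertV η c s.2) (pertK x η η' c s.2) p) +
      (β' * phaseCor c (phase η c s.2 +
        (arg (1 + linNoise x (pertU η c s.2) (pertV η c s.2) (pertK x η η' c s.2) p) -
          Real.arctan (2 * η / c))) - β * phaseCor c (phase η c s.2)) := by
  have h := phase_step hη hη' hc hd p
  rw [← pertE_eq]
  set A := arg (1 + pertE η η' c s.2 p)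
  have h1 : phaseCor c (phase η' c (p.1 - c - p.2 / s.2)) =
      phaseCor c (phase η c s.2 + (A - Real.arctan (2 * η / c))) := by
    rw [h]
    split_ifs
    · rw [show phase η c s.2 - Real.arctan (2 * η / c) + Real.pi + A =
        phase η c s.2 + (A - Real.arctan (2 * η / c)) + Real.pi by ring, phaseCor_add_pi]
    · congr 1; ring
  unfold totalPhase chainStep
  simp only
  rw [h1, h]
  push_cast
  split_ifs <;> ring

section bounds

variable {η d : ℝ}

lemma norm_pertU_le (hη : 0 < η) (c d : ℝ) : η * ‖pertU η c d‖ ≤ 1 := by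
  unfold pertU
  rw [norm_inv, ← div_eq_mul_inv]
  have h := Complex.abs_im_le_norm ⟨-c / 2 - (c ^ 2 / 4 + η ^ 2) / d, η⟩
  rw [abs_of_pos hη] at h
  exact div_le_one_of_le₀ h (norm_nonneg _)

/-- The conjugate-free factorisation of the perturbation coefficients. -/
def pertW (η c d : ℝ) : ℂ := (⟨d + c / 2, η⟩ : ℂ)⁻¹

lemma norm_pertW_le (hη : 0 < η) (c d : ℝ) : η * ‖pertW η c d‖ ≤ 1 := by
  unfold pertW
  rw [norm_inv, ← div_eq_mul_inv]
  have h := Complex.abs_im_le_norm ⟨d + c / 2, η⟩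
  rw [abs_of_pos hη] at h
  exact div_le_one_of_le₀ h (norm_nonneg _)

lemma pertZ_ne (hη : 0 < η) (c : ℝ) : (⟨-c / 2, η⟩ : ℂ) ≠ 0 := by
  intro h; have := congrArg Complex.im h; simp at this; linarith

lemma norm_pertZ_inv_le (hc : 1 ≤ c) (η : ℝ) : ‖(⟨-c / 2, η⟩ : ℂ)⁻¹‖ ≤ 2 := by
  have h := Complex.abs_re_le_norm ⟨-c / 2, η⟩
  rw [show |(⟨-c / 2, η⟩ : ℂ).re| = c / 2 by
    simp only; rw [abs_of_neg (by linarith)]; ring] at h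
  rw [norm_inv, inv_le_comm₀ (by linarith) (by norm_num)]; linarith

lemma pertU_eq (hη : 0 < η) (c : ℝ) (hd : d ≠ 0) :
    pertU η c d = d * pertW η c d * (⟨-c / 2, η⟩ : ℂ)⁻¹ := by
  have hz := pertZ_ne hη c
  have hd' : (d : ℂ) ≠ 0 := by exact_mod_cast hd
  have hw : (⟨d + c / 2, η⟩ : ℂ) ≠ 0 := by
    intro h; have := congrArg Complex.im h; simp at this; linarith
  have hu : (⟨-c / 2 - (c ^ 2 / 4 + η ^ 2) / d, η⟩ : ℂ) ≠ 0 := by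
    intro h; have := congrArg Complex.im h; simp at this; linarith
  have key : (⟨-c / 2 - (c ^ 2 / 4 + η ^ 2) / d, η⟩ : ℂ) * d = ⟨-c / 2, η⟩ * ⟨d + c / 2, η⟩ := by
    apply Complex.ext
    · simp; field_simp; ring
    · simp; ring
  unfold pertU pertW
  rw [← div_eq_mul_inv, ← div_eq_mul_inv, eq_div_iff hz, eq_div_iff hw, inv_mul_eq_div, div_mul_eq_mul_div,
    div_eq_iff hu, ← key]
  ring

lemma pertV_eq (hη : 0 < η) (c : ℝ) (hd : d ≠ 0) :
    pertV η c d = pertW η c d * (⟨-c / 2, η⟩ : ℂ)⁻¹ := by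
  have hd' : (d : ℂ) ≠ 0 := by exact_mod_cast hd
  rw [pertV, pertU_eq hη c hd]; field_simp

lemma norm_pertV_le (hη : 0 < η) (hc : 1 ≤ c) (hd : d ≠ 0) : η * ‖pertV η c d‖ ≤ 2 := by
  rw [pertV_eq hη c hd, norm_mul, ← mul_assoc]
  calc _ ≤ 1 * 2 := mul_le_mul (norm_pertW_le hη c d) (norm_pertZ_inv_le hc η) (norm_nonneg _)
        zero_le_one
    _ = 2 := by norm_num

lemma norm_pertU_sub_le (hη : 0 < η) (hc : 1 ≤ c) (hd : d ≠ 0) :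
    ‖pertU η c d - pertW η c d‖ ≤ 2 := by
  have hz := pertZ_ne hη c
  have hw : (⟨d + c / 2, η⟩ : ℂ) ≠ 0 := by
    intro h; have := congrArg Complex.im h; simp at this; linarith
  have e : pertU η c d - pertW η c d =
      (⟨d + c / 2, -η⟩ / ⟨d + c / 2, η⟩) * (⟨-c / 2, η⟩ : ℂ)⁻¹ := by
    rw [pertU_eq hη c hd]
    have h1 : (d : ℂ) - ⟨-c / 2, η⟩ = ⟨d + c / 2, -η⟩ := by
      apply Complex.ext <;> simp; ring
    rw [← h1]
    unfold pertW
    generalize (⟨-c / 2, η⟩ : ℂ) = z at *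
    generalize (⟨d + c / 2, η⟩ : ℂ) = w at *
    field_simp
  have h2 : ‖(⟨d + c / 2, -η⟩ : ℂ)‖ = ‖(⟨d + c / 2, η⟩ : ℂ)‖ := by
    have : (⟨d + c / 2, -η⟩ : ℂ) = (starRingEnd ℂ) ⟨d + c / 2, η⟩ := by
      apply Complex.ext <;> simp
    rw [this, Complex.norm_conj]
  rw [e, norm_mul, norm_div, h2, div_self (norm_ne_zero_iff.mpr hw), one_mul]
  exact norm_pertZ_inv_le hc η

lemma abs_pertU_sq_im_le (hη : 0 < η) (hc : 1 ≤ c) (hd : d ≠ 0) :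
    η * |(pertU η c d ^ 2).im - (pertW η c d ^ 2).im| ≤ 4 := by
  rw [← Complex.sub_im]
  have h1 := Complex.abs_im_le_norm (pertU η c d ^ 2 - pertW η c d ^ 2)
  rw [sq_sub_sq, norm_mul] at h1
  have h2 := norm_pertU_sub_le hη hc hd
  have h3 := norm_add_le (pertU η c d) (pertW η c d)
  have h4 := norm_pertU_le hη c d
  have h5 := norm_pertW_le hη c d
  rw [sq_sub_sq]
  calc _ ≤ η * (‖pertU η c d + pertW η c d‖ * ‖pertU η c d - pertW η c d‖) := by gcongr
    _ ≤ η * ((‖pertU η c d‖ + ‖pertW η c d‖) * 2) := by gcongr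
    _ ≤ 4 := by linarith

lemma abs_pertV_sq_im_le (hη : 0 < η) (hc : 1 ≤ c) (hd : d ≠ 0) :
    η * |(c ^ 2 / 4 + η ^ 2) * (pertV η c d ^ 2).im - (pertW η c d ^ 2).im| ≤ 4 := by
  have hz := pertZ_ne hη c
  have e : (c ^ 2 / 4 + η ^ 2) * (pertV η c d ^ 2).im - (pertW η c d ^ 2).im =
      (-(2 * η : ℝ) * I * (⟨-c / 2, η⟩ : ℂ)⁻¹ * pertW η c d ^ 2).im := by
    rw [pertV_eq hη c hd, ← Complex.im_ofReal_mul, ← Complex.sub_im]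
    congr 1
    have h1 : ((c ^ 2 / 4 + η ^ 2 : ℝ) : ℂ) = ⟨-c / 2, η⟩ * (⟨-c / 2, η⟩ - (2 * η : ℝ) * I) := by
      apply Complex.ext
      · rw [Complex.ofReal_re]; simp; ring
      · rw [Complex.ofReal_im]; simp; ring
    rw [h1]
    generalize (⟨-c / 2, η⟩ : ℂ) = z at *
    field_simp
    ring
  rw [e]
  have h5 := norm_pertW_le hη c d
  have h6 := norm_pertZ_inv_le hc η
  refine (mul_le_mul_of_nonneg_left (Complex.abs_im_le_norm _) hη.le).trans ?_
  simp only [norm_mul, norm_neg, Complex.norm_real, Complex.norm_I, norm_pow, Real.norm_eq_abs,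
    abs_of_pos hη, mul_one, Nat.abs_ofNat]
  calc η * (2 * η * ‖(⟨-c / 2, η⟩ : ℂ)⁻¹‖ * ‖pertW η c d‖ ^ 2)
      = 2 * ‖(⟨-c / 2, η⟩ : ℂ)⁻¹‖ * (η * ‖pertW η c d‖) ^ 2 := by ring
    _ ≤ 2 * 2 * 1 ^ 2 := by gcongr
    _ = 4 := by norm_num

lemma sin_phase_mul_cos_phase (hη : 0 < η) (c d : ℝ) :
    Real.sin (2 * phase η c d) = 2 * η * (pertW η c d).re := by
  have hs : 0 < 1 + ((d + c / 2) / η) ^ 2 := by positivity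
  have hq := Real.sq_sqrt hs.le
  rw [Real.sin_two_mul]
  unfold phase pertW
  rw [Real.sin_pi_div_two_sub, Real.cos_pi_div_two_sub, Real.sin_arctan, Real.cos_arctan,
    Complex.inv_re, Complex.normSq_mk]
  rw [show 2 * (1 / √(1 + ((d + c / 2) / η) ^ 2)) * ((d + c / 2) / η / √(1 + ((d + c / 2) / η) ^ 2))
    = 2 * ((d + c / 2) / η) / (√(1 + ((d + c / 2) / η) ^ 2)) ^ 2 by ring, hq]
  have : (d + c / 2) * (d + c / 2) + η * η ≠ 0 := by nlinarith [sq_nonneg (d + c / 2), pow_pos hη 2]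
  simp only
  field_simp
  ring

lemma sin_phase_sub (hη : 0 < η) (c d : ℝ) :
    Real.sin (2 * phase η c d) - Real.sin (4 * phase η c d) / 2 =
      -(2 * η ^ 2) * (pertW η c d ^ 2).im := by
  have h1 := sin_phase_mul_cos_phase hη c d
  have h2 : 1 - Real.cos (2 * phase η c d) = -(2 * η) * (pertW η c d).im := by
    have hs : 0 < 1 + ((d + c / 2) / η) ^ 2 := by positivity
    have hq := Real.sq_sqrt hs.le
    rw [Real.cos_two_mul]
    unfold phase pertW
    rw [Real.cos_pi_div_two_sub, Real.sin_arctan,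
      Complex.inv_im, Complex.normSq_mk, div_pow, hq]
    have : (d + c / 2) * (d + c / 2) + η * η ≠ 0 := by
      nlinarith [sq_nonneg (d + c / 2), pow_pos hη 2]
    simp only
    field_simp
    ring
  rw [show 4 * phase η c d = 2 * (2 * phase η c d) by ring, Real.sin_two_mul (2 * phase η c d)]
  have h3 : Real.sin (2 * phase η c d) - 2 * Real.sin (2 * phase η c d) *
    Real.cos (2 * phase η c d) / 2 = Real.sin (2 * phase η c d) *
      (1 - Real.cos (2 * phase η c d)) := by ring
  rw [h3, h1, h2, pow_two (pertW η c d), Complex.mul_im]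
  ring

end bounds

end

lemma arctan_le_self {y : ℝ} (hy : 0 ≤ y) : Real.arctan y ≤ y := by
  have := Real.le_tan (Real.arctan_nonneg.mpr hy) (Real.arctan_lt_pi_div_two y)
  rwa [Real.tan_arctan] at this

lemma sub_arctan_le {y : ℝ} (hy : 0 ≤ y) : y - Real.arctan y ≤ y ^ 3 := by
  have hd (x : ℝ) : HasDerivAt (fun y : ℝ => y ^ 3 - y + Real.arctan y)
      (3 * x ^ 2 - 1 + 1 / (1 + x ^ 2)) x := by
    refine (((hasDerivAt_pow 3 x).sub (hasDerivAt_id x)).add (Real.hasDerivAt_arctan x)).congr_deriv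
      ?_
    norm_num
  have hmono : MonotoneOn (fun y : ℝ => y ^ 3 - y + Real.arctan y) (Set.Ici 0) := by
    refine monotoneOn_of_deriv_nonneg (convex_Ici 0)
      (fun x _ => (hd x).continuousAt.continuousWithinAt)
      (fun x _ => (hd x).differentiableAt.differentiableWithinAt) fun x hx => ?_
    rw [interior_Ici, Set.mem_Ioi] at hx
    rw [(hd x).deriv]
    have : 3 * x ^ 2 - 1 + 1 / (1 + x ^ 2) = (2 * x ^ 2 + 3 * x ^ 4) / (1 + x ^ 2) := by
      field_simp; ring
    rw [this]; positivity
  have := hmono (Set.mem_Ici.mpr le_rfl) (Set.mem_Ici.mpr hy) hy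
  simp at this
  linarith

lemma turning_step {μ : Measure (ℝ × ℝ)} {x η c : ℝ} (h : IsNoise μ (η ^ 3) x) (hη : 0 < η)
    (hη1 : η ≤ 1) (hx1 : x ≤ 1) (hc1 : 1 ≤ c)
    (hxX : |x - (c ^ 2 / 4 + η ^ 2)| ≤ 6 * η ^ 2) {s : ℕ × ℝ} (hd : s.2 ≠ 0) :
    |∫ p, (totalPhase η 0 c (chainStep c s p) - totalPhase η 0 c s) ∂μ| ≤ 50000 * η ∧
    ∫ p, (totalPhase η 0 c (chainStep c s p) - totalPhase η 0 c s) ^ 2 ∂μ ≤ 50000 * η := by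
  have := h.prob
  have e := totalPhase_step hη hη (by linarith : 0 < c) hd x 0 0
  simp only [zero_mul, sub_zero, add_zero] at e
  have hκ0 : pertK x η η c s.2 = -((x - (c ^ 2 / 4 + η ^ 2) : ℝ) * pertV η c s.2) := by
    simp [pertK]
  have hκ : ‖pertK x η η c s.2‖ ≤ 12 * η := by
    rw [hκ0, norm_neg, norm_mul, Complex.norm_real, Real.norm_eq_abs]
    have := norm_pertV_le hη hc1 hd
    calc _ ≤ 6 * η ^ 2 * ‖pertV η c s.2‖ := by gcongr
      _ = 6 * η * (η * ‖pertV η c s.2‖) := by ring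
      _ ≤ 6 * η * 2 := by gcongr
      _ = _ := by ring
  have hu := norm_pertU_le hη c s.2
  have hV := norm_pertV_le hη hc1 hd
  set u := pertU η c s.2
  set V := pertV η c s.2
  set κ := pertK x η η c s.2
  have hM : 6 * η ^ 3 * ‖u‖ ^ 2 + 6 * x * η ^ 3 * ‖V‖ ^ 2 + 3 * ‖κ‖ ^ 2 ≤ 462 * η := by
    have h1 : 6 * η ^ 3 * ‖u‖ ^ 2 ≤ 6 * η := by
      calc _ = 6 * η * (η * ‖u‖) ^ 2 := by ring
        _ ≤ 6 * η * 1 ^ 2 := by gcongr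
        _ = _ := by ring
    have h2 : 6 * x * η ^ 3 * ‖V‖ ^ 2 ≤ 24 * η := by
      calc _ = 6 * x * η * (η * ‖V‖) ^ 2 := by ring
        _ ≤ 6 * 1 * η * 2 ^ 2 := by gcongr
        _ = _ := by ring
    have h3 : 3 * ‖κ‖ ^ 2 ≤ 432 * η := by
      calc _ ≤ 3 * (12 * η) ^ 2 := by gcongr
        _ = 432 * η * η := by ring
        _ ≤ 432 * η * 1 := by gcongr
        _ = _ := by ring
    linarith
  have hθ0 : 0 ≤ Real.arctan (2 * η / c) := Real.arctan_nonneg.mpr (by positivity)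
  have hθ : Real.arctan (2 * η / c) ≤ 2 * η := by
    refine (arctan_le_self (by positivity)).trans ?_
    exact div_le_self (by positivity) hc1
  set θ := Real.arctan (2 * η / c)
  have iA := h.integrable_comp_arg u V κ continuous_id
  have iA2 := h.integrable_comp_arg u V κ (f := fun t => t ^ 2) (by fun_prop)
  have iB := h.integrable_comp_arg u V κ (f := fun t => (θ - t) ^ 2) (by fun_prop)
  simp only [id] at iA
  simp only [e]
  constructor
  · rw [integral_sub (integrable_const _) iA]
    simp only [integral_const, probReal_univ, smul_eq_mul, one_mul]
    have h1 := h.abs_integral_arg_le u V κ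
    have h2 := Complex.abs_im_le_norm κ
    have h3 := abs_sub θ (∫ p, arg (1 + linNoise x u V κ p) ∂μ)
    rw [abs_of_nonneg hθ0] at h3
    linarith
  · have h1 := h.integral_arg_sq_le u V κ
    have h2 : ∫ p, (θ - arg (1 + linNoise x u V κ p)) ^ 2 ∂μ ≤
        ∫ p, (2 * θ ^ 2 + 2 * arg (1 + linNoise x u V κ p) ^ 2) ∂μ := by
      refine integral_mono iB ((integrable_const _).add (iA2.const_mul 2)) fun p => ?_
      simp only
      nlinarith [sq_nonneg (θ + arg (1 + linNoise x u V κ p))]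
    rw [integral_add (integrable_const _) (iA2.const_mul 2)] at h2
    simp only [integral_const_mul, integral_const, probReal_univ, smul_eq_mul, one_mul] at h2
    have h3 : θ ^ 2 ≤ 4 * η := by
      calc θ ^ 2 ≤ (2 * η) ^ 2 := by gcongr
        _ = 4 * η * η := by ring
        _ ≤ 4 * η * 1 := by gcongr
        _ = _ := by ring
    linarith

set_option maxHeartbeats 4000000 in
lemma elliptic_step {μ : Measure (ℝ × ℝ)} {x η η' β β' c : ℝ} (h : IsNoise μ (β * η ^ 3) x)
    (hη : 0 < η) (hη1 : η ≤ 1) (hx1 : x ≤ 1) (hc1 : 1 ≤ c) (hc2 : c ≤ 2)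
    (hxη : x = c ^ 2 / 4 + η ^ 2) (hη' : 0 < η') (hηη : η' ^ 2 = η ^ 2 + β * η ^ 3)
    (hβ : 0 < β) (hβ8 : 8 * β ≤ 1) (hβ' : 0 < β') (hββ : β' ≤ β) {s : ℕ × ℝ} (hd : s.2 ≠ 0) :
    |∫ p, (totalPhase η' β' c (chainStep c s p) - totalPhase η β c s -
      Real.arctan (2 * η / c)) ∂μ| ≤ 460000 * (β * η ^ 2 + β ^ 2 * η) + 5 * (β - β') ∧
    ∫ p, (totalPhase η' β' c (chainStep c s p) - totalPhase η β c s -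
      Real.arctan (2 * η / c)) ^ 2 ∂μ ≤ 4000 * β * η + 4 * (β - β') := by
  have := h.prob
  have hc0 : 0 ≤ c := by linarith
  have e := totalPhase_step hη hη' (by linarith : 0 < c) hd x β β'
  have hδ0 : 0 ≤ η' - η := by
    have : η ^ 2 ≤ η' ^ 2 := by rw [hηη]; have := pow_pos hη 3; nlinarith
    have := abs_le_of_sq_le_sq' this hη'.le
    linarith [this.2]
  have hδe : (η' - η) * (η' + η) = β * η ^ 3 := by linarith [hηη]
  have hδ : 2 * (η' - η) ≤ β * η ^ 2 := by
    have h1 : (η' - η) * (2 * η) ≤ (η' - η) * (η' + η) := by gcongr; linarith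
    have h2 : η * (2 * (η' - η)) ≤ η * (β * η ^ 2) := by linarith only [h1, hδe]
    exact le_of_mul_le_mul_left h2 hη
  have hκ0 : pertK x η η' c s.2 = (η' - η : ℝ) * I * pertU η c s.2 := by
    simp [pertK, hxη]
  have hu := norm_pertU_le hη c s.2
  have hV := norm_pertV_le hη hc1 hd
  have hU := norm_pertW_le hη c s.2
  have hu2 := abs_pertU_sq_im_le hη hc1 hd
  have hV2 := abs_pertV_sq_im_le hη hc1 hd
  have huU := norm_pertU_sub_le hη hc1 hd
  have hS1 := sin_phase_mul_cos_phase hη c s.2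
  have hS2 := sin_phase_sub hη c s.2
  rw [← hxη] at hV2
  set u := pertU η c s.2
  set V := pertV η c s.2
  set U := pertW η c s.2
  set κ := pertK x η η' c s.2
  set α := phase η c s.2
  set δ := η' - η with hδd
  clear_value u V U κ α δ
  have hκ : ‖κ‖ ≤ β * η / 2 := by
    rw [hκ0, norm_mul, norm_mul, Complex.norm_real, Real.norm_eq_abs, Complex.norm_I, mul_one,
      abs_of_nonneg hδ0]
    calc δ * ‖u‖ ≤ (β * η ^ 2 / 2) * ‖u‖ := by gcongr; linarith
      _ = (β * η / 2) * (η * ‖u‖) := by ring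
      _ ≤ (β * η / 2) * 1 := by gcongr
      _ = _ := by ring
  have hβη : β * η ≤ 1 := by
    calc β * η ≤ 1 * 1 := by gcongr; linarith
      _ = 1 := one_mul 1
  have hβη0 : 0 < β * η := by positivity
  have hM2 : 6 * (β * η ^ 3) * ‖u‖ ^ 2 + 6 * x * (β * η ^ 3) * ‖V‖ ^ 2 + 3 * ‖κ‖ ^ 2 ≤
      31 * (β * η) := by
    have h1 : 6 * (β * η ^ 3) * ‖u‖ ^ 2 ≤ 6 * (β * η) := by
      calc _ = 6 * (β * η) * (η * ‖u‖) ^ 2 := by ring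
        _ ≤ 6 * (β * η) * 1 ^ 2 := by gcongr
        _ = _ := by ring
    have h2 : 6 * x * (β * η ^ 3) * ‖V‖ ^ 2 ≤ 24 * (β * η) := by
      calc _ = 6 * x * (β * η) * (η * ‖V‖) ^ 2 := by ring
        _ ≤ 6 * 1 * (β * η) * 2 ^ 2 := by gcongr
        _ = _ := by ring
    have h3 : 3 * ‖κ‖ ^ 2 ≤ β * η := by
      calc _ ≤ 3 * (β * η / 2) ^ 2 := by gcongr
        _ = (3 / 4 * (β * η)) * (β * η) := by ring
        _ ≤ 1 * (β * η) := by gcongr; linarith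
        _ = _ := by ring
    linarith
  have hM4 : (1620 * (β * η ^ 3) ^ 2 * ‖u‖ ^ 4 + 1620 * (β * η ^ 3) ^ 2 * ‖V‖ ^ 4 +
      27 * ‖κ‖ ^ 4) / η ≤ 28000 * (β ^ 2 * η) := by
    rw [div_le_iff₀ hη]
    have h1 : 1620 * (β * η ^ 3) ^ 2 * ‖u‖ ^ 4 ≤ 1620 * (β ^ 2 * η ^ 2) := by
      calc _ = 1620 * (β ^ 2 * η ^ 2) * (η * ‖u‖) ^ 4 := by ring
        _ ≤ 1620 * (β ^ 2 * η ^ 2) * 1 ^ 4 := by gcongr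
        _ = _ := by ring
    have h2 : 1620 * (β * η ^ 3) ^ 2 * ‖V‖ ^ 4 ≤ 25920 * (β ^ 2 * η ^ 2) := by
      calc _ = 1620 * (β ^ 2 * η ^ 2) * (η * ‖V‖) ^ 4 := by ring
        _ ≤ 1620 * (β ^ 2 * η ^ 2) * 2 ^ 4 := by gcongr
        _ = _ := by ring
    have h3 : 27 * ‖κ‖ ^ 4 ≤ 27 * (β ^ 2 * η ^ 2) := by
      calc _ ≤ 27 * (β * η / 2) ^ 4 := by gcongr
        _ = 27 * (β ^ 2 * η ^ 2) * ((β * η) ^ 2 / 16) := by ring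
        _ ≤ 27 * (β ^ 2 * η ^ 2) * (1 ^ 2 / 1) := by gcongr; norm_num
        _ = _ := by ring
    have h4 : 0 ≤ β ^ 2 * η ^ 2 := by positivity
    linarith only [h1, h2, h3, h4]
  have hy0 : 0 ≤ 2 * η / c := by positivity
  have hy : 2 * η / c ≤ 2 * η := div_le_self (by positivity) hc1
  have hθ0 : 0 ≤ Real.arctan (2 * η / c) := Real.arctan_nonneg.mpr hy0
  have hθy : Real.arctan (2 * η / c) ≤ 2 * η / c := arctan_le_self hy0
  have hθ3 : 2 * η / c - Real.arctan (2 * η / c) ≤ 8 * η ^ 3 := by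
    refine (sub_arctan_le hy0).trans ?_
    calc (2 * η / c) ^ 3 ≤ (2 * η) ^ 3 := by gcongr
      _ = _ := by ring
  have hyc : 2 * η / c * c = 2 * η := by field_simp
  set y := 2 * η / c
  set θ := Real.arctan y
  clear_value θ y
  have hcont := continuous_phaseCor c
  have iA := h.integrable_comp_arg u V κ continuous_id
  have iA2 := h.integrable_comp_arg u V κ (f := fun t => t ^ 2) (by fun_prop)
  have iG := h.integrable_comp_arg u V κ (f := fun t => phaseCor c (α + (t - θ)) - phaseCor c α)
    (by fun_prop)
  have iT := h.integrable_comp_arg u V κ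
    (f := fun t => phaseCor c (α + (t - θ)) - phaseCor c α - phaseCor' c α * (t - θ))
    (by fun_prop)
  have iH := h.integrable_comp_arg u V κ
    (f := fun t => (θ - t + (β' * phaseCor c (α + (t - θ)) - β * phaseCor c α) - θ) ^ 2)
    (by fun_prop)
  simp only [id] at iA
  simp only [e]
  have bA := h.abs_integral_arg_le u V κ
  have bA2 := h.integral_arg_sq_le u V κ
  have bA3 := h.abs_integral_arg_sub_le u V κ hη
  have hκi := Complex.abs_im_le_norm κ
  have hg := abs_phaseCor_le hc0 hc2 α
  have hg' := abs_phaseCor'_le hc0 hc2 α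
  have hA1 : |∫ p, arg (1 + linNoise x u V κ p) ∂μ| ≤ 466 * (β * η) := by linarith
  have hA2 : ∫ p, arg (1 + linNoise x u V κ p) ^ 2 ∂μ ≤ 1519 * (β * η) := by linarith
  have hA20 : 0 ≤ ∫ p, arg (1 + linNoise x u V κ p) ^ 2 ∂μ := integral_nonneg fun p => sq_nonneg _
  constructor
  · have hre : ∀ t : ℝ, θ - t + (β' * phaseCor c (α + (t - θ)) - β * phaseCor c α) - θ =
        β' * (phaseCor c (α + (t - θ)) - phaseCor c α) - t - (β - β') * phaseCor c α := by
      intro t; ring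
    simp only [hre]
    have iG' := iG.const_mul β'
    have iGA : Integrable (fun p => β' * (phaseCor c (α + (arg (1 + linNoise x u V κ p) - θ)) -
        phaseCor c α) - arg (1 + linNoise x u V κ p)) μ := iG'.sub iA
    rw [integral_sub iGA (integrable_const _), integral_sub iG' iA]
    simp only [integral_const_mul, integral_const, probReal_univ, smul_eq_mul, one_mul]
    have t1 : |∫ p, (phaseCor c (α + (arg (1 + linNoise x u V κ p) - θ)) - phaseCor c α) ∂μ -
        phaseCor' c α * (∫ p, arg (1 + linNoise x u V κ p) ∂μ - θ)| ≤
        15190 * (β * η) + 40 * η ^ 2 := by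
      have h1 : |∫ p, (phaseCor c (α + (arg (1 + linNoise x u V κ p) - θ)) - phaseCor c α -
          phaseCor' c α * (arg (1 + linNoise x u V κ p) - θ)) ∂μ| ≤
          ∫ p, (10 * arg (1 + linNoise x u V κ p) ^ 2 + 10 * θ ^ 2) ∂μ := by
        refine (abs_integral_le_integral_abs).trans (integral_mono iT.abs
          ((iA2.const_mul 10).add (integrable_const _)) fun p => ?_)
        refine (abs_phaseCor_taylor hc0 hc2 α _).trans ?_
        linarith only [sq_nonneg (θ + arg (1 + linNoise x u V κ p))]
      have iAθ : Integrable (fun p => arg (1 + linNoise x u V κ p) - θ) μ :=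
        iA.sub (integrable_const θ)
      rw [integral_sub iG (iAθ.const_mul _),
        integral_add (iA2.const_mul 10) (integrable_const _)] at h1
      simp only [integral_const_mul] at h1
      rw [integral_sub iA (integrable_const θ)] at h1
      simp only [integral_const, probReal_univ, smul_eq_mul, one_mul] at h1
      have : θ ^ 2 ≤ (2 * η) ^ 2 := by gcongr; linarith
      linarith only [h1, hA2, this]
    -- the main term
    have t2 : |(κ.im - (κ ^ 2).im / 2 - β * η ^ 3 * (u ^ 2).im - x * (β * η ^ 3) * (V ^ 2).im) -
        β * η * (5 / 4 * Real.sin (2 * α) - Real.sin (4 * α) / 2)| ≤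
        9 * (β * η ^ 2) + β ^ 2 * η := by
      have k1 : κ.im = δ * u.re := by rw [hκ0]; simp
      have k2 : |(κ ^ 2).im / 2| ≤ β ^ 2 * η / 8 := by
        have k3 := Complex.abs_im_le_norm (κ ^ 2)
        rw [norm_pow] at k3
        have : ‖κ‖ ^ 2 ≤ (β * η / 2) ^ 2 := by gcongr
        rw [abs_div, Nat.abs_ofNat]
        have h4 : β ^ 2 * η * η ≤ β ^ 2 * η * 1 := by gcongr
        linarith only [k3, this, h4]
      have k4 : |δ * u.re - δ * U.re| ≤ β * η ^ 2 := by
        rw [← mul_sub, abs_mul, abs_of_nonneg hδ0, ← Complex.sub_re]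
        have := Complex.abs_re_le_norm (u - U)
        calc _ ≤ δ * 2 := by gcongr; linarith
          _ ≤ _ := by linarith
      have k5 : |δ * U.re - β * η * Real.sin (2 * α) / 4| ≤ β ^ 2 * η / 4 := by
        rw [hS1, show δ * U.re - β * η * (2 * η * U.re) / 4 = (δ - β * η ^ 2 / 2) * U.re by ring,
          abs_mul]
        have k6 : |δ - β * η ^ 2 / 2| ≤ η * (β ^ 2 * η / 4) := by
          rw [abs_of_nonpos (by linarith)]
          have k7 : δ * δ + δ * (2 * η) = β * η ^ 3 := by rw [← hδe, hδd]; ring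
          have k8 : δ * δ ≤ (β * η ^ 2 / 2) * (β * η ^ 2 / 2) := by
            gcongr <;> linarith
          have k9 : β ^ 2 * η ^ 3 * η ≤ β ^ 2 * η ^ 3 * 1 := by gcongr
          have : η * (2 * (β * η ^ 2 / 2 - δ)) ≤ η * (2 * (η * (β ^ 2 * η / 4))) := by
            have : 0 ≤ β ^ 2 * η ^ 3 := by positivity
            linarith only [k7, k8, k9, this]
          linarith only [le_of_mul_le_mul_left this hη]
        have k10 := Complex.abs_re_le_norm U
        calc _ ≤ η * (β ^ 2 * η / 4) * ‖U‖ := by gcongr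
          _ = (β ^ 2 * η / 4) * (η * ‖U‖) := by ring
          _ ≤ (β ^ 2 * η / 4) * 1 := by gcongr
          _ = _ := by ring
      have k11 : |β * η ^ 3 * (u ^ 2).im - β * η ^ 3 * (U ^ 2).im| ≤ 4 * (β * η ^ 2) := by
        rw [← mul_sub, abs_mul, abs_of_pos (by positivity)]
        calc _ = β * η ^ 2 * (η * |(u ^ 2).im - (U ^ 2).im|) := by ring
          _ ≤ β * η ^ 2 * 4 := by gcongr
          _ = _ := by ring
      have k12 : |x * (β * η ^ 3) * (V ^ 2).im - β * η ^ 3 * (U ^ 2).im| ≤ 4 * (β * η ^ 2) := by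
        rw [show x * (β * η ^ 3) * (V ^ 2).im - β * η ^ 3 * (U ^ 2).im =
          β * η ^ 3 * (x * (V ^ 2).im - (U ^ 2).im) by ring, abs_mul, abs_of_pos (by positivity)]
        calc _ = β * η ^ 2 * (η * |x * (V ^ 2).im - (U ^ 2).im|) := by ring
          _ ≤ β * η ^ 2 * 4 := by gcongr
          _ = _ := by ring
      have k13 : β * η * (Real.sin (2 * α) - Real.sin (4 * α) / 2) =
          - 2 * (β * η ^ 3 * (U ^ 2).im) := by rw [hS2]; ring
      rw [k1]
      have p1 := abs_le.mp k2
      have p2 := abs_le.mp k4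
      have p3 := abs_le.mp k5
      have p4 := abs_le.mp k11
      have p5 := abs_le.mp k12
      have : 0 < β ^ 2 * η := by positivity
      rw [abs_le]
      constructor <;> linarith only [p1, p2, p3, p4, p5, k13, this]
    have t3 : |β * (phaseCor' c α * θ) + β * η * (5 / 4 * Real.sin (2 * α) - Real.sin (4 * α) / 2)|
        ≤ 16 * (β * η ^ 2) := by
      have k1 : β * η * (5 / 4 * Real.sin (2 * α) - Real.sin (4 * α) / 2) =
          - (β * (phaseCor' c α * y)) := by
        have k2 : phaseCor' c α * y =
          (y * c) * (-5 / 8 * Real.sin (2 * α) + Real.sin (4 * α) / 4) := by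
          unfold phaseCor'; ring
        rw [k2, hyc]; ring
      rw [k1, show β * (phaseCor' c α * θ) + -(β * (phaseCor' c α * y)) =
        β * (phaseCor' c α * (θ - y)) by ring, abs_mul, abs_mul, abs_of_pos hβ,
        abs_of_nonpos (by linarith : θ - y ≤ 0)]
      calc _ ≤ β * (2 * (8 * η ^ 3)) := by
            gcongr
            · linarith
            · linarith
        _ = 16 * (β * η ^ 2) * η := by ring
        _ ≤ 16 * (β * η ^ 2) * 1 := by gcongr
        _ = _ := by ring
    set IA := ∫ p, arg (1 + linNoise x u V κ p) ∂μ
    set IG := ∫ p, (phaseCor c (α + (arg (1 + linNoise x u V κ p) - θ)) - phaseCor c α) ∂μ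
    clear_value IA IG
    have t4 : |β' * (IG - phaseCor' c α * (IA - θ))| ≤ 15190 * (β ^ 2 * η) + 40 * (β * η ^ 2) := by
      rw [abs_mul, abs_of_pos hβ']
      calc _ ≤ β * (15190 * (β * η) + 40 * η ^ 2) := by gcongr
        _ = _ := by ring
    have t5 : |β' * (phaseCor' c α * IA)| ≤ 932 * (β ^ 2 * η) := by
      rw [abs_mul, abs_mul, abs_of_pos hβ']
      calc _ ≤ β * (2 * (466 * (β * η))) := by gcongr
        _ = _ := by ring
    have t6 : |(β - β') * (phaseCor' c α * θ)| ≤ 4 * (β - β') := by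
      rw [abs_mul, abs_mul, abs_of_nonneg (by linarith : 0 ≤ β - β'), abs_of_nonneg hθ0]
      have : θ ≤ 2 := by linarith
      calc _ ≤ (β - β') * (2 * 2) := by
            have : 0 ≤ β - β' := by linarith
            gcongr
        _ = _ := by ring
    have t7 : |(β - β') * phaseCor c α| ≤ β - β' := by
      rw [abs_mul, abs_of_nonneg (by linarith : 0 ≤ β - β')]
      exact mul_le_of_le_one_right (by linarith) hg
    have t8 : 31 / 2 * (η * (6 * (β * η ^ 3) * ‖u‖ ^ 2 + 6 * x * (β * η ^ 3) * ‖V‖ ^ 2 +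
        3 * ‖κ‖ ^ 2) + (1620 * (β * η ^ 3) ^ 2 * ‖u‖ ^ 4 + 1620 * (β * η ^ 3) ^ 2 * ‖V‖ ^ 4 +
        27 * ‖κ‖ ^ 4) / η) ≤ 31 / 2 * (η * (31 * (β * η)) + 28000 * (β ^ 2 * η)) := by
      gcongr
    have p0 := abs_le.mp (bA3.trans t8)
    have p2 := abs_le.mp t2
    have p3 := abs_le.mp t3
    have p4 := abs_le.mp t4
    have p5 := abs_le.mp t5
    have p6 := abs_le.mp t6
    have p7 := abs_le.mp t7
    have q1 : 0 < β ^ 2 * η := by positivity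
    have q2 : 0 < β * η ^ 2 := by positivity
    have q3 : η * (31 * (β * η)) = 31 * (β * η ^ 2) := by ring
    rw [q3] at p0
    have q4 : β' * IG = β' * (IG - phaseCor' c α * (IA - θ)) + β' * (phaseCor' c α * IA) -
      β * (phaseCor' c α * θ) + (β - β') * (phaseCor' c α * θ) := by ring
    rw [q4]
    generalize β' * (IG - phaseCor' c α * (IA - θ)) = X1 at *
    generalize β' * (phaseCor' c α * IA) = X2 at *
    generalize β * (phaseCor' c α * θ) = X3 at *
    generalize (β - β') * (phaseCor' c α * θ) = X4 at *
    generalize (β - β') * phaseCor c α = X5 at *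
    generalize β * η * (5 / 4 * Real.sin (2 * α) - Real.sin (4 * α) / 2) = X6 at *
    rw [abs_le]
    constructor <;> linarith only [p0, p2, p3, p4, p5, p6, p7, q1, q2]
  · have hb : ∀ t : ℝ, (θ - t + (β' * phaseCor c (α + (t - θ)) - β * phaseCor c α) - θ) ^ 2 ≤
        5 / 2 * t ^ 2 + (16 * (β * η) + 4 * (β - β')) := by
      intro t
      have k1 : |β' * phaseCor c (α + (t - θ)) - β * phaseCor c α| ≤
          β * (2 * |t - θ|) + (β - β') := by
        rw [show β' * phaseCor c (α + (t - θ)) - β * phaseCor c α =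
          β' * (phaseCor c (α + (t - θ)) - phaseCor c α) - (β - β') * phaseCor c α by ring]
        refine (abs_sub _ _).trans ?_
        rw [abs_mul, abs_mul, abs_of_pos hβ', abs_of_nonneg (by linarith : 0 ≤ β - β')]
        have := abs_phaseCor_sub_le hc0 hc2 α (α + (t - θ))
        rw [add_sub_cancel_left] at this
        have h0 : 0 ≤ β - β' := by linarith
        calc _ ≤ β * (2 * |t - θ|) + (β - β') * 1 := by gcongr
          _ = _ := by ring
      set G := β' * phaseCor c (α + (t - θ)) - β * phaseCor c α
      have k2 : G ^ 2 ≤ (β * (2 * |t - θ|) + (β - β')) ^ 2 := by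
        rw [← sq_abs G]; gcongr
      have k3 : (β * (2 * |t - θ|) + (β - β')) ^ 2 ≤
          8 * (β ^ 2 * (t - θ) ^ 2) + 2 * (β - β') ^ 2 := by
        have := sq_abs (t - θ)
        rw [← this]
        linarith only [sq_nonneg (β * (2 * |t - θ|) - (β - β'))]
      have k4 : (t - θ) ^ 2 ≤ 2 * t ^ 2 + 8 * η ^ 2 := by
        have : θ ^ 2 ≤ (2 * η) ^ 2 := by gcongr; linarith
        linarith only [sq_nonneg (t + θ), this]
      have k5 : β ^ 2 * (t - θ) ^ 2 ≤ β ^ 2 * (2 * t ^ 2 + 8 * η ^ 2) := by gcongr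
      have k6 : β ^ 2 ≤ 1 / 64 := by nlinarith
      have k7 : β ^ 2 * t ^ 2 ≤ 1 / 64 * t ^ 2 := by gcongr
      have k8 : β ^ 2 * η ^ 2 ≤ (1 / 8) * (β * η) := by
        calc β ^ 2 * η ^ 2 = β * (β * η) * η := by ring
          _ ≤ (1 / 8) * (β * η) * 1 := by gcongr; linarith
          _ = _ := by ring
      have k9 : (β - β') ^ 2 ≤ β - β' := by
        rw [sq]
        exact mul_le_of_le_one_left (by linarith) (by linarith)
      clear_value G
      have k10 : (θ - t + G - θ) ^ 2 ≤ 2 * t ^ 2 + 2 * G ^ 2 := by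
        have := sq_nonneg (t + G)
        linarith [show (θ - t + G - θ) ^ 2 = 2 * t ^ 2 + 2 * G ^ 2 - (t + G) ^ 2 by ring]
      have k11 : 0 ≤ t ^ 2 := sq_nonneg t
      have k12 : β ^ 2 * (2 * t ^ 2 + 8 * η ^ 2) =
        2 * (β ^ 2 * t ^ 2) + 8 * (β ^ 2 * η ^ 2) := by ring
      linarith only [k2, k3, k5, k7, k8, k9, k10, k11, k12]
    have h2 := integral_mono iH ((iA2.const_mul (5 / 2)).add
      (integrable_const (16 * (β * η) + 4 * (β - β')))) fun p => hb _
    rw [integral_add' (iA2.const_mul (5 / 2)) (integrable_const _)] at h2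
    simp only [integral_const_mul] at h2
    simp only [integral_const, probReal_univ, smul_eq_mul, one_mul] at h2
    linarith

/-- The law of (number of positive pivots, last pivot) after `k` steps. -/
def chainLaw (c : ℝ) (μ : ℕ → Measure (ℝ × ℝ)) : ℕ → Measure (ℕ × ℝ)
  | 0 => Measure.dirac (0, 1)
  | k + 1 => ((chainLaw c μ k).prod (μ k)).map fun q => chainStep c q.1 q.2

section chain

variable {μ : ℕ → Measure (ℝ × ℝ)} {N k : ℕ} {v c : ℝ}

lemma isProbabilityMeasure_chainLaw (h : ∀ k < N, IsNoise (μ k) v (k * v)) (hk : k ≤ N) :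
    IsProbabilityMeasure (chainLaw c μ k) := by
  induction k with
  | zero => unfold chainLaw; infer_instance
  | succ k ih =>
    have := ih (by omega)
    have := (h k (by omega)).prob
    exact Measure.isProbabilityMeasure_map (measurable_chainStep c).aemeasurable

lemma ae_chainLaw (h : ∀ k < N, IsNoise (μ k) v (k * v)) (hk : k ≤ N) :
    ∀ᵐ s ∂chainLaw c μ k, s.1 ≤ k ∧ s.2 ≠ 0 := by
  induction k with
  | zero => simp [chainLaw]
  | succ k ih =>
    have ih := ih (by omega)
    have := isProbabilityMeasure_chainLaw (c := c) h (by omega : k ≤ N)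
    have hN := h k (by omega)
    have := hN.prob
    have hm : MeasurableSet {s : ℕ × ℝ | s.1 ≤ k + 1 ∧ s.2 ≠ 0} :=
      (measurableSet_le measurable_fst measurable_const).inter
        (measurable_snd (measurableSet_singleton (0:ℝ)).compl)
    rw [chainLaw, ae_map_iff (measurable_chainStep c).aemeasurable hm]
    refine (Measure.ae_prod_iff_ae_ae (measurable_chainStep c hm)).mpr ?_
    filter_upwards [ih] with s hs
    filter_upwards [hN.fst_ne (fun b => c + b / s.2) (by fun_prop)] with p hp
    unfold chainStep
    simp only
    refine ⟨?_, fun h0 => hp (by linarith)⟩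
    split_ifs <;> omega

lemma integrable_chainLaw (h : ∀ k < N, IsNoise (μ k) v (k * v)) (hk : k ≤ N) {f : ℕ × ℝ → ℝ}
    (hf : Measurable f) {A : ℝ} (hA : ∀ s, |f s| ≤ A * (1 + s.1) ^ 2) :
    Integrable f (chainLaw c μ k) := by
  have := isProbabilityMeasure_chainLaw (c := c) h hk
  refine Integrable.of_bound (C := |A| * (1 + k) ^ 2) hf.aestronglyMeasurable ?_
  filter_upwards [ae_chainLaw h hk] with s hs
  have h1 : (s.1 : ℝ) ≤ k := by exact_mod_cast hs.1
  calc _ ≤ A * (1 + s.1) ^ 2 := hA s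
    _ ≤ |A| * (1 + s.1) ^ 2 := by gcongr; exact le_abs_self A
    _ ≤ _ := by gcongr

lemma integral_chainLaw_succ (h : ∀ k < N, IsNoise (μ k) v (k * v)) (hk : k < N) {f : ℕ × ℝ → ℝ}
    (hf : Measurable f) {A : ℝ} (hA : ∀ s, |f s| ≤ A * (1 + s.1) ^ 2) :
    Integrable (fun s => ∫ p, f (chainStep c s p) ∂μ k) (chainLaw c μ k) ∧
    ∫ s, f s ∂chainLaw c μ (k + 1) =
      ∫ s, ∫ p, f (chainStep c s p) ∂μ k ∂chainLaw c μ k := by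
  have := isProbabilityMeasure_chainLaw (c := c) h hk.le
  have := (h k hk).prob
  have hi := integrable_chainLaw (c := c) h (k := k + 1) hk hf hA
  rw [chainLaw, integrable_map_measure hf.aestronglyMeasurable
    (measurable_chainStep c).aemeasurable] at hi
  refine ⟨hi.integral_prod_left, ?_⟩
  rw [chainLaw, integral_map (measurable_chainStep c).aemeasurable hf.aestronglyMeasurable]
  exact integral_prod _ hi

lemma integrable_chainStep {ν : Measure (ℝ × ℝ)} [IsProbabilityMeasure ν] {f : ℕ × ℝ → ℝ}
    (hf : Measurable f) {A : ℝ} (hA : ∀ s, |f s| ≤ A * (1 + s.1) ^ 2) (c : ℝ) (s : ℕ × ℝ) :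
    Integrable (fun p => f (chainStep c s p)) ν := by
  refine Integrable.of_bound (C := |A| * (2 + s.1) ^ 2)
    (hf.comp ((measurable_chainStep c).comp measurable_prodMk_left)).aestronglyMeasurable
    (Filter.Eventually.of_forall fun p => ?_)
  have h1 : ((chainStep c s p).1 : ℝ) ≤ s.1 + 1 := by
    unfold chainStep
    simp only
    split_ifs <;> simp
  calc _ ≤ A * (1 + (chainStep c s p).1) ^ 2 := hA _
    _ ≤ |A| * (1 + (chainStep c s p).1) ^ 2 := by gcongr; exact le_abs_self A
    _ ≤ |A| * (1 + (s.1 + 1)) ^ 2 := by gcongr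
    _ = _ := by ring

lemma moment_step (h : ∀ k < N, IsNoise (μ k) v (k * v)) (hk : k < N) {F F' : ℕ × ℝ → ℝ}
    (hF : Measurable F) (hF' : Measurable F') {A : ℝ} (hA : ∀ s, |F s| ≤ A * (1 + s.1))
    (hA' : ∀ s, |F' s| ≤ A * (1 + s.1)) {e V : ℝ}
    (he : ∀ s : ℕ × ℝ, s.2 ≠ 0 → |∫ p, (F' (chainStep c s p) - F s) ∂μ k| ≤ e)
    (hV : ∀ s : ℕ × ℝ, s.2 ≠ 0 → ∫ p, (F' (chainStep c s p) - F s) ^ 2 ∂μ k ≤ V) :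
    |∫ s, F' s ∂chainLaw c μ (k + 1) - ∫ s, F s ∂chainLaw c μ k| ≤ e ∧
    1 + ∫ s, F' s ^ 2 ∂chainLaw c μ (k + 1) ≤
      (1 + e) * (1 + ∫ s, F s ^ 2 ∂chainLaw c μ k) + V := by
  have := isProbabilityMeasure_chainLaw (c := c) h hk.le
  have := (h k hk).prob
  have lin {f : ℕ × ℝ → ℝ} (hf : ∀ s, |f s| ≤ A * (1 + s.1)) (s : ℕ × ℝ) :
      |f s| ≤ A * (1 + s.1) ^ 2 := by
    refine (hf s).trans ?_
    have h1 : 0 ≤ A * (1 + s.1) := (abs_nonneg _).trans (hf s)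
    have h2 : (0:ℝ) ≤ s.1 := by positivity
    nlinarith
  have sqr {f : ℕ × ℝ → ℝ} (hf : ∀ s, |f s| ≤ A * (1 + s.1)) (s : ℕ × ℝ) :
      |f s ^ 2| ≤ A ^ 2 * (1 + s.1) ^ 2 := by
    rw [abs_pow, ← mul_pow]
    gcongr
    exact hf s
  have iF := integrable_chainLaw (c := c) h hk.le hF (lin hA)
  have iF2 := integrable_chainLaw (c := c) h hk.le (hF.pow_const 2) (sqr hA)
  obtain ⟨j1, e1⟩ := integral_chainLaw_succ (c := c) h hk hF' (lin hA')
  obtain ⟨j2, e2⟩ := integral_chainLaw_succ (c := c) h hk (hF'.pow_const 2) (sqr hA')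
  have iP (s) := integrable_chainStep (ν := μ k) hF' (lin hA') c s
  have iP2 (s) := integrable_chainStep (ν := μ k) (hF'.pow_const 2) (sqr hA') c s
  have hg (s) : ∫ p, (F' (chainStep c s p) - F s) ∂μ k =
      ∫ p, F' (chainStep c s p) ∂μ k - F s := by
    rw [integral_sub (iP s) (integrable_const _)]
    simp
  have hg2 (s) : ∫ p, (F' (chainStep c s p) - F s) ^ 2 ∂μ k =
      ∫ p, F' (chainStep c s p) ^ 2 ∂μ k - 2 * F s * ∫ p, F' (chainStep c s p) ∂μ k +
        F s ^ 2 := by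
    have e3 : ∀ p, (F' (chainStep c s p) - F s) ^ 2 =
        F' (chainStep c s p) ^ 2 - 2 * F s * F' (chainStep c s p) + F s ^ 2 := fun p => by ring
    have i3 : Integrable (fun p => F' (chainStep c s p) ^ 2 - 2 * F s * F' (chainStep c s p))
      (μ k) := (iP2 s).sub ((iP s).const_mul _)
    simp only [e3]
    rw [integral_add i3 (integrable_const _), integral_sub (iP2 s) ((iP s).const_mul _)]
    simp [integral_const_mul]
  constructor
  · rw [e1, ← integral_sub j1 iF]
    have := norm_integral_le_of_norm_le_const (μ := chainLaw c μ k)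
      (f := fun s => ∫ p, F' (chainStep c s p) ∂μ k - F s) (C := e) ?_
    · simpa using this
    filter_upwards [ae_chainLaw (c := c) h hk.le] with s hs
    rw [← hg]
    exact he s hs.2
  · have hmono : ∫ s, ∫ p, F' (chainStep c s p) ^ 2 ∂μ k ∂chainLaw c μ k ≤
        ∫ s, ((1 + e) * F s ^ 2 + (e + V)) ∂chainLaw c μ k := by
      refine integral_mono_ae j2 ((iF2.const_mul _).add (integrable_const _)) ?_
      filter_upwards [ae_chainLaw (c := c) h hk.le] with s hs
      have h1 := abs_le.mp (he s hs.2)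
      have h2 := hV s hs.2
      rw [hg] at h1
      rw [hg2] at h2
      have h3 : 2 * F s * (∫ p, F' (chainStep c s p) ∂μ k - F s) ≤ e * (1 + F s ^ 2) := by
        have he0 : 0 ≤ e := by linarith
        have h4 : |∫ p, F' (chainStep c s p) ∂μ k - F s| ≤ e := abs_le.mpr h1
        calc _ ≤ |2 * F s * (∫ p, F' (chainStep c s p) ∂μ k - F s)| := le_abs_self _
          _ = 2 * |F s| * |∫ p, F' (chainStep c s p) ∂μ k - F s| := by
            rw [abs_mul, abs_mul, abs_two]
          _ ≤ 2 * |F s| * e := by gcongr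
          _ ≤ (1 + |F s| ^ 2) * e := by gcongr; nlinarith [sq_nonneg (|F s| - 1)]
          _ = _ := by rw [sq_abs]; ring
      linarith
    rw [integral_add (iF2.const_mul _) (integrable_const _)] at hmono
    simp only [integral_const_mul, integral_const, probReal_univ, smul_eq_mul, one_mul] at hmono
    rw [e2]
    linarith

end chain

lemma gronwall_exp {M e V : ℕ → ℝ} {a b : ℕ} (hab : a ≤ b) (he : ∀ k, a ≤ k → k < b → 0 ≤ e k)
    (hV : ∀ k, a ≤ k → k < b → 0 ≤ V k) (hM0 : 0 ≤ M a)
    (hM : ∀ k, a ≤ k → k < b → M (k + 1) ≤ (1 + e k) * M k + V k) :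
    M b ≤ (M a + ∑ k ∈ Finset.Ico a b, V k) * Real.exp (∑ k ∈ Finset.Ico a b, e k) := by
  induction b, hab using Nat.le_induction with
  | base => simp
  | succ b hab ih =>
    have ih := ih (fun k h1 h2 => he k h1 (by omega)) (fun k h1 h2 => hV k h1 (by omega))
      (fun k h1 h2 => hM k h1 (by omega))
    have e0 := he b hab (by omega)
    have v0 := hV b hab (by omega)
    rw [Finset.sum_Ico_succ_top hab, Finset.sum_Ico_succ_top hab, Real.exp_add]
    have hV0 : 0 ≤ ∑ k ∈ Finset.Ico a b, V k := Finset.sum_nonneg fun k hk => by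
      rw [Finset.mem_Ico] at hk; exact hV k hk.1 (by omega)
    have he0 : 0 ≤ ∑ k ∈ Finset.Ico a b, e k := Finset.sum_nonneg fun k hk => by
      rw [Finset.mem_Ico] at hk; exact he k hk.1 (by omega)
    have h1 : 1 + e b ≤ Real.exp (e b) := by linarith [Real.add_one_le_exp (e b)]
    have h2 : 1 ≤ Real.exp (∑ k ∈ Finset.Ico a b, e k) * Real.exp (e b) := by
      rw [← Real.exp_add]; exact Real.one_le_exp (by positivity)
    calc M (b + 1) ≤ (1 + e b) * M b + V b := hM b hab (by omega)
      _ ≤ (1 + e b) * ((M a + ∑ k ∈ Finset.Ico a b, V k) *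
          Real.exp (∑ k ∈ Finset.Ico a b, e k)) + V b * 1 := by rw [mul_one]; gcongr
      _ ≤ Real.exp (e b) * ((M a + ∑ k ∈ Finset.Ico a b, V k) *
          Real.exp (∑ k ∈ Finset.Ico a b, e k)) + V b *
            (Real.exp (∑ k ∈ Finset.Ico a b, e k) * Real.exp (e b)) := by gcongr
      _ = _ := by ring

lemma abs_sub_le_sum {m e : ℕ → ℝ} {a b : ℕ} (hab : a ≤ b)
    (hm : ∀ k, a ≤ k → k < b → |m (k + 1) - m k| ≤ e k) :
    |m b - m a| ≤ ∑ k ∈ Finset.Ico a b, e k := by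
  induction b, hab using Nat.le_induction with
  | base => simp
  | succ b hab ih =>
    have ih := ih fun k h1 h2 => hm k h1 (by omega)
    rw [Finset.sum_Ico_succ_top hab]
    have := abs_add_le (m (b + 1) - m b) (m b - m a)
    rw [sub_add_sub_cancel] at this
    linarith [hm b hab (by omega)]

lemma sum_le_of_telescope {f g : ℕ → ℝ} {a b : ℕ} (hab : a ≤ b)
    (h : ∀ k, a ≤ k → k < b → f k ≤ g (k + 1) - g k) :
    ∑ k ∈ Finset.Ico a b, f k ≤ g b - g a := by
  induction b, hab using Nat.le_induction with
  | base => simp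
  | succ b hab ih =>
    rw [Finset.sum_Ico_succ_top hab]
    linarith [h b hab (by omega), ih fun k h1 h2 => h k h1 (by omega)]

section regions

variable {μ : ℕ → Measure (ℝ × ℝ)} {N k m : ℕ} {v c w : ℝ}

lemma hypJ_nonneg (κ c : ℝ) (s : ℕ × ℝ) : 0 ≤ hypJ κ c s := by
  unfold hypJ
  have := hypF_nonneg κ c s.2
  positivity

lemma hypJ_le (κ c : ℝ) (s : ℕ × ℝ) : hypJ κ c s ≤ (1 + s.1) ^ 2 := by
  unfold hypJ
  have h1 := hypF_le_one κ c s.2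
  have h2 : (2 * s.1 + 1) * hypF κ c s.2 ≤ (2 * s.1 + 1) * 1 := by gcongr
  linarith

lemma sq_le_hypJ (κ c : ℝ) (s : ℕ × ℝ) : (s.1 : ℝ) ^ 2 ≤ hypJ κ c s := by
  unfold hypJ
  have := hypF_nonneg κ c s.2
  have : 0 ≤ (2 * s.1 + 1) * hypF κ c s.2 := by positivity
  linarith

lemma div_pow_five_le {κ κ' : ℝ} (hκ : 0 < κ) (hκ' : 0 < κ') (hv : 0 < v)
    (h : κ' ^ 2 = κ ^ 2 - v) : v / κ ^ 5 ≤ 2 * (1 / κ' ^ 3 - 1 / κ ^ 3) := by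
  have h1 : κ' ≤ κ := by nlinarith
  have e : 1 / κ' ^ 3 - 1 / κ ^ 3 = (κ ^ 3 - κ' ^ 3) / (κ' ^ 3 * κ ^ 3) := by field_simp
  have h2 : κ * v ≤ 2 * (κ ^ 3 - κ' ^ 3) := by
    have : v = (κ - κ') * (κ + κ') := by linarith
    rw [this]
    have h3 : 0 ≤ κ - κ' := by linarith
    have : 2 * (κ ^ 3 - κ' ^ 3) - κ * ((κ - κ') * (κ + κ')) =
      (κ - κ') * (κ ^ 2 + κ * κ' + 2 * κ' ^ 2) := by ring
    have : 0 ≤ (κ - κ') * (κ ^ 2 + κ * κ' + 2 * κ' ^ 2) := by positivity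
    linarith
  rw [e]
  calc v / κ ^ 5 = (κ * v) / (κ ^ 3 * κ ^ 3) := by field_simp
    _ ≤ (2 * (κ ^ 3 - κ' ^ 3)) / (κ' ^ 3 * κ ^ 3) := by
      have : 0 ≤ κ ^ 3 - κ' ^ 3 := by
        have : κ' ^ 3 ≤ κ ^ 3 := by gcongr
        linarith
      gcongr
    _ = _ := by ring

lemma hyperbolic_region (h : ∀ k < N, IsNoise (μ k) v (k * v)) (hv : 0 < v)
    (hvN : (N : ℝ) * v ≤ 1) (hc1 : 1 ≤ c) (hc2 : c ≤ 2) (hw : 0 < w) (hwv : w ^ 3 = v)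
    (hmN : m ≤ N) (hm : m = 0 ∨ m * v ≤ c ^ 2 / 4 - 4 * w ^ 2) :
    ∫ s, (s.1 : ℝ) ^ 2 ∂chainLaw c μ m ≤ Real.exp 1400000 := by
  rcases hm with rfl | hm
  · simp [chainLaw, Real.exp_nonneg]
  set κ : ℕ → ℝ := fun k => Real.sqrt (c ^ 2 / 4 - k * v) with hκdef
  have hκ2 (k : ℕ) (hk : k ≤ m) : 4 * w ^ 2 ≤ c ^ 2 / 4 - k * v := by
    have : (k : ℝ) * v ≤ m * v := by gcongr
    linarith
  have hsq (k : ℕ) (hk : k ≤ m) : κ k ^ 2 = c ^ 2 / 4 - k * v :=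
    Real.sq_sqrt (by have := hκ2 k hk; have := sq_nonneg w; linarith)
  have hκw (k : ℕ) (hk : k ≤ m) : 2 * w ≤ κ k :=
    Real.le_sqrt_of_sq_le (by have := hκ2 k hk; linarith)
  have hκ0 (k : ℕ) (hk : k ≤ m) : 0 < κ k := by linarith [hκw k hk]
  have hκ8 (k : ℕ) (hk : k ≤ m) : 8 * v ≤ κ k ^ 3 := by
    calc 8 * v = (2 * w) ^ 3 := by rw [← hwv]; ring
      _ ≤ _ := by gcongr; exact hκw k hk
  have hstep (k : ℕ) (hk : k < m) : κ (k + 1) ^ 2 = κ k ^ 2 - v := by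
    rw [hsq _ hk, hsq _ hk.le]; push_cast; ring
  set E : ℕ → ℝ := fun k => 2 * (1400000 * v ^ 2 / κ k ^ 5) with hE
  set H : ℕ → ℝ := fun k => ∫ s, hypJ (κ k) c s ∂chainLaw c μ k with hH
  have hA (κ : ℝ) (s : ℕ × ℝ) : |hypJ κ c s| ≤ 1 * (1 + s.1) ^ 2 := by
    rw [abs_of_nonneg (hypJ_nonneg _ _ _), one_mul]; exact hypJ_le _ _ _
  have hrec (k : ℕ) (hk : k < m) : 1 + H (k + 1) ≤ (1 + E k) * (1 + H k) + 0 := by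
    have hkN : k < N := by omega
    have := isProbabilityMeasure_chainLaw (c := c) h hkN.le
    obtain ⟨j, e⟩ := integral_chainLaw_succ (c := c) h hkN (measurable_hypJ (κ (k + 1)) c) (hA _)
    have iJ := integrable_chainLaw (c := c) h hkN.le (measurable_hypJ (κ k) c) (hA _)
    have hkv : (k : ℝ) * v ≤ 1 := by
      refine le_trans ?_ hvN
      gcongr
    simp only [hH, e]
    have hE0 : 0 ≤ E k := by have := hκ0 k hk.le; positivity
    have : ∫ s, ∫ p, hypJ (κ (k + 1)) c (chainStep c s p) ∂μ k ∂chainLaw c μ k ≤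
        ∫ s, ((1 + E k) * hypJ (κ k) c s + E k) ∂chainLaw c μ k := by
      refine integral_mono j ((iJ.const_mul _).add (integrable_const _)) fun s => ?_
      have h1 := hyp_step (h k hkN) hv (by positivity) hkv hc1 hc2 (hκ0 k hk.le) (hκ0 _ hk)
        (hsq k hk.le) (hstep k hk) (hκ8 k hk.le) s
      refine h1.trans ?_
      have h2 := sq_le_hypJ (κ k) c s
      have h3 : (2 * s.1 + 1) * (1400000 * v ^ 2 / κ k ^ 5) ≤ (1 + hypJ (κ k) c s) * E k := by
        have hl : 2 * (s.1 : ℝ) + 1 ≤ 2 * (1 + hypJ (κ k) c s) := by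
          nlinarith only [sq_nonneg ((s.1 : ℝ) - 1), h2]
        have hq : 0 ≤ 1400000 * v ^ 2 / κ k ^ 5 := by have := hκ0 k hk.le; positivity
        calc _ ≤ (2 * (1 + hypJ (κ k) c s)) * (1400000 * v ^ 2 / κ k ^ 5) := by gcongr
          _ = _ := by simp only [hE]; ring
      linarith
    rw [integral_add (iJ.const_mul _) (integrable_const _)] at this
    simp only [integral_const_mul, integral_const, probReal_univ, smul_eq_mul, one_mul] at this
    linarith
  have hH0 : H 0 = 0 := by
    simp [hH, chainLaw, integral_dirac, hypJ, hypF]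
  have hg := gronwall_exp (M := fun k => 1 + H k) (e := E) (V := fun _ => 0) (Nat.zero_le m)
    (fun k _ hk => by have := hκ0 k hk.le; positivity) (fun _ _ _ => le_rfl)
    (by simp [hH0]) (fun k _ hk => hrec k hk)
  simp only [hH0, Finset.sum_const_zero, add_zero, one_mul] at hg
  have hs : ∑ k ∈ Finset.Ico 0 m, E k ≤ 1400000 := by
    have h1 := sum_le_of_telescope (f := E) (g := fun k => 5600000 * v * (1 / κ k ^ 3))
      (Nat.zero_le m) fun k _ hk => by
        have := div_pow_five_le (hκ0 k hk.le) (hκ0 _ hk) hv (hstep k hk)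
        have h2 : v * (v / κ k ^ 5) ≤ v * (2 * (1 / κ (k + 1) ^ 3 - 1 / κ k ^ 3)) := by gcongr
        have h3 : E k = 2800000 * (v * (v / κ k ^ 5)) := by simp only [hE]; ring
        linarith
    have h2 : 0 ≤ 5600000 * v * (1 / κ 0 ^ 3) := by have := hκ0 0 (Nat.zero_le m); positivity
    have h3 : v * (1 / κ m ^ 3) ≤ 1 / 8 := by
      have := hκ8 m le_rfl
      have h4 := hκ0 m le_rfl
      rw [mul_one_div, div_le_iff₀ (by positivity)]; linarith
    linarith
  have hmain : H m ≤ Real.exp 1400000 := by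
    have : Real.exp (∑ k ∈ Finset.Ico 0 m, E k) ≤ Real.exp 1400000 := Real.exp_le_exp.mpr hs
    linarith
  refine le_trans (integral_mono ?_ ?_ fun s => sq_le_hypJ (κ m) c s) hmain
  · refine integrable_chainLaw (c := c) h hmN (A := 1) ?_ fun s => ?_
    · exact (by fun_prop : Measurable fun s : ℕ × ℝ => (s.1 : ℝ)).pow_const 2
    · rw [abs_of_nonneg (sq_nonneg _), one_mul]; gcongr; linarith
  · exact integrable_chainLaw (c := c) h hmN (measurable_hypJ _ c) (hA _)

lemma abs_totalPhase_sub_le {η β : ℝ} (hβ : 0 ≤ β) (hβ1 : β ≤ 1) (hc1 : 1 ≤ c) (hc2 : c ≤ 2)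
    (s : ℕ × ℝ) : |totalPhase η β c s - Real.pi * s.1| ≤ 8 := by
  unfold totalPhase
  have h1 := phase_pos η c s.2
  have h2 := phase_lt_pi η c s.2
  have h3 := abs_le.mp (abs_phaseCor_le (by linarith) hc2 (phase η c s.2))
  have h4 : |β * phaseCor c (phase η c s.2)| ≤ 1 := by
    rw [abs_mul, abs_of_nonneg hβ]
    exact mul_le_one₀ hβ1 (abs_nonneg _) (abs_phaseCor_le (by linarith) hc2 _)
  have h4 := abs_le.mp h4
  have h5 := Real.pi_lt_d2
  rw [abs_le]
  split_ifs <;> constructor <;> linarith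

lemma abs_totalPhase_le {η β : ℝ} (hβ : 0 ≤ β) (hβ1 : β ≤ 1) (hc1 : 1 ≤ c) (hc2 : c ≤ 2)
    (s : ℕ × ℝ) : |totalPhase η β c s| ≤ 8 * (1 + s.1) := by
  have h1 := abs_le.mp (abs_totalPhase_sub_le (η := η) hβ hβ1 hc1 hc2 s)
  have h5 := Real.pi_lt_d2
  have h6 := Real.pi_pos
  have h7 : (0:ℝ) ≤ s.1 := by positivity
  have : Real.pi * s.1 ≤ 8 * s.1 := by gcongr; linarith
  have : 0 ≤ Real.pi * s.1 := by positivity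
  rw [abs_le]
  constructor <;> linarith

lemma turning_region (h : ∀ k < N, IsNoise (μ k) v (k * v)) (hv : 0 < v)
    (hvN : (N : ℝ) * v ≤ 1) (hc1 : 1 ≤ c) (hc2 : c ≤ 2) (hw : 0 < w) (hw1 : w ≤ 1)
    (hwv : w ^ 3 = v) (hmk : m ≤ k) (hkN : k ≤ N)
    (hm : c ^ 2 / 4 - 4 * w ^ 2 - v ≤ m * v) (hk : k * v ≤ c ^ 2 / 4 + 4 * w ^ 2 + v) :
    1 + ∫ s, totalPhase w 0 c s ^ 2 ∂chainLaw c μ k ≤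
      (1 + ∫ s, totalPhase w 0 c s ^ 2 ∂chainLaw c μ m + 500000) * Real.exp 500000 := by
  have hA (s : ℕ × ℝ) : |totalPhase w 0 c s| ≤ 8 * (1 + s.1) :=
    abs_totalPhase_le le_rfl zero_le_one hc1 hc2 s
  have hT := measurable_totalPhase w 0 c
  have hrec (j : ℕ) (h1 : m ≤ j) (h2 : j < k) := by
    have hn : IsNoise (μ j) (w ^ 3) (j * v) := by rw [hwv]; exact h j (by omega)
    have hx1 : (j : ℝ) * v ≤ 1 := by
      refine le_trans ?_ hvN
      gcongr
      omega
    have hx : |j * v - (c ^ 2 / 4 + w ^ 2)| ≤ 6 * w ^ 2 := by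
      have e1 : (m : ℝ) * v ≤ j * v := by gcongr
      have e2 : ((j + 1 : ℕ) : ℝ) * v ≤ k * v := by gcongr; omega
      push_cast at e2
      have e3 : v ≤ w ^ 2 := by rw [← hwv]; nlinarith [sq_nonneg w]
      rw [abs_le]; constructor <;> linarith [sq_nonneg w]
    exact (moment_step (c := c) h (k := j) (by omega) hT hT hA hA (e := 50000 * w)
      (V := 50000 * w) (fun s hs => (turning_step hn hw hw1 hx1 hc1 hx hs).1)
      (fun s hs => (turning_step hn hw hw1 hx1 hc1 hx hs).2)).2
  have hg := gronwall_exp (M := fun k => 1 + ∫ s, totalPhase w 0 c s ^ 2 ∂chainLaw c μ k)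
    (e := fun _ => 50000 * w) (V := fun _ => 50000 * w) hmk (fun _ _ _ => by positivity)
    (fun _ _ _ => by positivity)
    (by have : 0 ≤ ∫ s, totalPhase w 0 c s ^ 2 ∂chainLaw c μ m :=
          integral_nonneg fun _ => sq_nonneg _
        linarith) hrec
  have hs : ∑ j ∈ Finset.Ico m k, 50000 * w ≤ 500000 := by
    rw [Finset.sum_const, Nat.card_Ico, nsmul_eq_mul, Nat.cast_sub hmk]
    have e1 : ((k:ℝ) - m) * w * w ^ 2 ≤ 10 * w ^ 2 := by
      have e3 : v ≤ w ^ 2 := by rw [← hwv]; nlinarith [sq_nonneg w]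
      have : ((k:ℝ) - m) * v = ((k:ℝ) - m) * w * w ^ 2 := by rw [← hwv]; ring
      rw [← this]; linarith
    have := le_of_mul_le_mul_right e1 (by positivity)
    linarith
  refine hg.trans ?_
  have : 0 ≤ ∫ s, totalPhase w 0 c s ^ 2 ∂chainLaw c μ m := integral_nonneg fun _ => sq_nonneg _
  gcongr

end regions

section telescoping

variable {η η' v : ℝ}

lemma div_le_of_sq_add (hη : 0 < η) (hη' : 0 < η') (h : η' ^ 2 = η ^ 2 + v) (hv : 0 < v)
    (h2 : η' ≤ 2 * η) : v / η ≤ 3 * (η' - η) := by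
  have h1 : η ≤ η' := by nlinarith
  have e : v = (η' - η) * (η' + η) := by linarith
  rw [div_le_iff₀ hη, e]
  have : 0 ≤ (η' - η) * (2 * η - η') := mul_nonneg (by linarith) (by linarith)
  linarith

lemma div_pow_five_le_of_sq_add (hη : 0 < η) (hη' : 0 < η') (h : η' ^ 2 = η ^ 2 + v) (hv : 0 < v)
    (h2 : η' ≤ 2 * η) : v ^ 2 / η ^ 5 ≤ 8 * (v / η ^ 3 - v / η' ^ 3) := by
  have h1 : η ≤ η' := by nlinarith
  have e : v = (η' - η) * (η' + η) := by linarith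
  have h3 : v * η ≤ η' ^ 3 - η ^ 3 := by
    have : η' ^ 3 - η ^ 3 - v * η = (η' - η) * η' ^ 2 := by rw [e]; ring
    have : 0 ≤ (η' - η) * η' ^ 2 := mul_nonneg (by linarith) (by positivity)
    linarith
  have h4 : η' ^ 3 ≤ 8 * η ^ 3 := by
    calc η' ^ 3 ≤ (2 * η) ^ 3 := by gcongr
      _ = _ := by ring
  have e2 : v / η ^ 3 - v / η' ^ 3 = v * (η' ^ 3 - η ^ 3) / (η ^ 3 * η' ^ 3) := by field_simp
  rw [e2]
  have h5 : 0 ≤ v * (η' ^ 3 - η ^ 3) :=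
    mul_nonneg hv.le ((mul_pos hv hη).le.trans h3)
  calc v ^ 2 / η ^ 5 = 8 * (v * (v * η) / (η ^ 3 * (8 * η ^ 3))) := by field_simp
    _ ≤ _ := by gcongr

lemma div_sq_le_log (hη : 0 < η) (hη' : 0 < η') (h : η' ^ 2 = η ^ 2 + v) (hv : 0 < v)
    (h2 : η' ≤ 2 * η) : v / η ^ 2 ≤ 6 * (Real.log η' - Real.log η) := by
  have h1 : η ≤ η' := by nlinarith
  have e : v = (η' - η) * (η' + η) := by linarith
  rw [← Real.log_div hη'.ne' hη.ne']
  have h3 := Real.one_sub_inv_le_log_of_pos (div_pos hη' hη)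
  have h4 : v / η ^ 2 ≤ 6 * (1 - (η' / η)⁻¹) := by
    rw [inv_div, one_sub_div hη'.ne', ← mul_div_assoc, div_le_div_iff₀ (by positivity) hη', e]
    have : (η' + η) * η' ≤ 6 * η ^ 2 := by
      calc (η' + η) * η' ≤ (2 * η + η) * (2 * η) := by gcongr
        _ = _ := by ring
    have := mul_le_mul_of_nonneg_left this (by linarith : 0 ≤ η' - η)
    linarith
  linarith

end telescoping

section region

variable {μ : ℕ → Measure (ℝ × ℝ)} {N m : ℕ} {v c w : ℝ}

lemma elliptic_region (h : ∀ k < N, IsNoise (μ k) v (k * v)) (hv : 0 < v)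
    (hvN : (N : ℝ) * v ≤ 1) (hc1 : 1 ≤ c) (hc2 : c ≤ 2) (hw : 0 < w) (hwv : w ^ 3 = v)
    (hmN : m ≤ N) (hm : c ^ 2 / 4 + 4 * w ^ 2 ≤ m * v) {η : ℕ → ℝ}
    (hη : η = fun k : ℕ => √(k * v - c ^ 2 / 4)) {Θ : ℕ → ℝ}
    (hΘ : Θ = fun k => ∑ j ∈ Finset.Ico m k, Real.arctan (2 * η j / c)) :
    |∫ s, (totalPhase (η N) (v / η N ^ 3) c s - Θ N) ∂chainLaw c μ N -
      ∫ s, totalPhase (η m) (v / η m ^ 3) c s ∂chainLaw c μ m| ≤ 2000000 ∧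
    1 + ∫ s, (totalPhase (η N) (v / η N ^ 3) c s - Θ N) ^ 2 ∂chainLaw c μ N ≤
      (1 + ∫ s, totalPhase (η m) (v / η m ^ 3) c s ^ 2 ∂chainLaw c μ m +
        (24000 * (Real.log (η N) - Real.log (η m)) + 1)) * Real.exp 2000000 := by
  have hη2 (k : ℕ) (hk : m ≤ k) : 4 * w ^ 2 ≤ k * v - c ^ 2 / 4 := by
    have : (m : ℝ) * v ≤ k * v := by gcongr
    linarith
  have hsq (k : ℕ) (hk : m ≤ k) : η k ^ 2 = k * v - c ^ 2 / 4 := by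
    rw [hη]; exact Real.sq_sqrt (by have := hη2 k hk; have := sq_nonneg w; linarith)
  have hηw (k : ℕ) (hk : m ≤ k) : 2 * w ≤ η k := by
    rw [hη]; exact Real.le_sqrt_of_sq_le (by have := hη2 k hk; linarith)
  have hη0 (k : ℕ) (hk : m ≤ k) : 0 < η k := by linarith [hηw k hk]
  have hη8 (k : ℕ) (hk : m ≤ k) : 8 * v ≤ η k ^ 3 := by
    calc 8 * v = (2 * w) ^ 3 := by rw [← hwv]; ring
      _ ≤ _ := by gcongr; exact hηw k hk
  have hkv (k : ℕ) (hk : k ≤ N) : (k : ℝ) * v ≤ 1 := by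
    refine le_trans ?_ hvN
    gcongr
  have hη1 (k : ℕ) (hk : m ≤ k) (hkN : k ≤ N) : η k ≤ 1 := by
    have := hkv k hkN
    have h2 := hsq k hk
    have h3 := hη0 k hk
    have : η k ^ 2 ≤ 1 ^ 2 := by rw [h2]; linarith [sq_nonneg c]
    exact le_of_sq_le_sq this (by norm_num)
  have hstep (k : ℕ) (hk : m ≤ k) : η (k + 1) ^ 2 = η k ^ 2 + v := by
    rw [hsq _ hk, hsq _ (by omega)]; push_cast; ring
  have hmono (k : ℕ) (hk : m ≤ k) : η k ≤ η (k + 1) := by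
    have := hstep k hk
    exact le_of_sq_le_sq (by linarith) (hη0 (k + 1) (by omega)).le
  have htwo (k : ℕ) (hk : m ≤ k) (hkN : k ≤ N) : η (k + 1) ≤ 2 * η k := by
    refine le_of_sq_le_sq ?_ (by have := hη0 k hk; positivity)
    have h1 := hstep k hk
    have h2 := hη8 k hk
    have h3 : η k ^ 3 ≤ η k ^ 2 := by
      rw [pow_succ]
      exact mul_le_of_le_one_right (sq_nonneg _) (hη1 k hk hkN)
    linarith [sq_nonneg (η k)]
  clear hη
  set β : ℕ → ℝ := fun k => v / η k ^ 3 with hβ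
  have hβ0 (k : ℕ) (hk : m ≤ k) : 0 < β k := div_pos hv (pow_pos (hη0 k hk) 3)
  have hβ8 (k : ℕ) (hk : m ≤ k) : 8 * β k ≤ 1 := by
    have := pow_pos (hη0 k hk) 3
    rw [hβ, ← mul_div_assoc, div_le_one this]
    exact hη8 k hk
  have hβη (k : ℕ) (hk : m ≤ k) : β k * η k ^ 3 = v :=
    div_mul_cancel₀ v (pow_pos (hη0 k hk) 3).ne'
  have hββ (k : ℕ) (hk : m ≤ k) : β (k + 1) ≤ β k := by
    have := hη0 k hk
    have := hmono k hk
    simp only [hβ]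
    gcongr
  set F : ℕ → ℕ × ℝ → ℝ := fun k s => totalPhase (η k) (β k) c s - Θ k with hF
  have hFm (k : ℕ) : Measurable (F k) := (measurable_totalPhase _ _ _).sub_const _
  have hFA (k : ℕ) (hk : m ≤ k) (s : ℕ × ℝ) : |F k s| ≤ (8 + |Θ k|) * (1 + s.1) := by
    have h1 := abs_totalPhase_le (η := η k) (hβ0 k hk).le (by linarith [hβ8 k hk, hβ0 k hk])
      hc1 hc2 s
    have h2 := abs_sub (totalPhase (η k) (β k) c s) (Θ k)
    have h3 : 0 ≤ |Θ k| * s.1 := by positivity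
    simp only [hF]
    linarith
  set e : ℕ → ℝ := fun k => 460000 * (β k * η k ^ 2 + β k ^ 2 * η k) + 5 * (β k - β (k + 1))
    with he
  set V : ℕ → ℝ := fun k => 4000 * β k * η k + 4 * (β k - β (k + 1)) with hV
  have he0 (k : ℕ) (hk : m ≤ k) : 0 ≤ e k := by
    have h1 := hβ0 k hk
    have h2 := hη0 k hk
    have h3 := hββ k hk
    have : 0 ≤ 460000 * (β k * η k ^ 2 + β k ^ 2 * η k) := by positivity
    simp only [he]
    linarith
  have hV0 (k : ℕ) (hk : m ≤ k) : 0 ≤ V k := by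
    have h1 := hβ0 k hk
    have h2 := hη0 k hk
    have h3 := hββ k hk
    have : 0 ≤ 4000 * β k * η k := by positivity
    simp only [hV]
    linarith
  have hΘs (k : ℕ) (hk : m ≤ k) : Θ (k + 1) = Θ k + Real.arctan (2 * η k / c) := by
    simp only [hΘ]; rw [Finset.sum_Ico_succ_top hk]
  have hΘm : Θ m = 0 := by simp [hΘ]
  have hrec (k : ℕ) (hk : m ≤ k) (hkN : k < N) :
      |∫ s, F (k + 1) s ∂chainLaw c μ (k + 1) - ∫ s, F k s ∂chainLaw c μ k| ≤ e k ∧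
      1 + ∫ s, F (k + 1) s ^ 2 ∂chainLaw c μ (k + 1) ≤
        (1 + e k) * (1 + ∫ s, F k s ^ 2 ∂chainLaw c μ k) + V k := by
    have hn : IsNoise (μ k) (β k * η k ^ 3) (k * v) := by rw [hβη k hk]; exact h k hkN
    have hst (s : ℕ × ℝ) (hs : s.2 ≠ 0) := elliptic_step hn (hη0 k hk) (hη1 k hk hkN.le)
      (hkv k hkN.le) hc1 hc2 (by rw [hsq k hk]; ring) (hη0 (k + 1) (by omega))
      (by rw [hβη k hk]; exact hstep k hk) (hβ0 k hk) (hβ8 k hk) (hβ0 (k + 1) (by omega))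
      (hββ k hk) hs
    have heq (s : ℕ × ℝ) (p : ℝ × ℝ) : F (k + 1) (chainStep c s p) - F k s =
        totalPhase (η (k + 1)) (β (k + 1)) c (chainStep c s p) - totalPhase (η k) (β k) c s -
          Real.arctan (2 * η k / c) := by
      simp only [hF, hΘs k hk]; ring
    refine moment_step h hkN (hFm k) (hFm (k + 1)) (A := 8 + |Θ k| + |Θ (k + 1)|)
      (fun s => (hFA k hk s).trans ?_) (fun s => (hFA (k + 1) (by omega) s).trans ?_)
      (fun s hs => ?_) (fun s hs => ?_)
    · refine mul_le_mul_of_nonneg_right ?_ (by positivity)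
      linarith [abs_nonneg (Θ (k + 1))]
    · refine mul_le_mul_of_nonneg_right ?_ (by positivity)
      linarith [abs_nonneg (Θ k)]
    · simp only [heq]; exact (hst s hs).1
    · simp only [heq]; exact (hst s hs).2
  have hsum_e : ∑ k ∈ Finset.Ico m N, e k ≤ 2000000 := by
    have h1 := sum_le_of_telescope (f := e)
      (g := fun k => 1380000 * η k - 3680005 * β k) hmN fun k hk hkN => by
        have h1 := div_le_of_sq_add (hη0 k hk) (hη0 (k + 1) (by omega)) (hstep k hk) hv
          (htwo k hk hkN.le)
        have h2 := div_pow_five_le_of_sq_add (hη0 k hk) (hη0 (k + 1) (by omega)) (hstep k hk) hv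
          (htwo k hk hkN.le)
        have h0 := hη0 k hk
        have e1 : β k * η k ^ 2 = v / η k := by simp only [hβ]; field_simp
        have e2 : β k ^ 2 * η k = v ^ 2 / η k ^ 5 := by simp only [hβ]; field_simp
        simp only [he, e1, e2]
        change _ ≤ 8 * (β k - β (k + 1)) at h2
        linarith
    have := hη1 N hmN le_rfl
    have := hη0 m le_rfl
    have := hβ8 m le_rfl
    have := hβ0 N hmN
    linarith
  have hsum_V : ∑ k ∈ Finset.Ico m N, V k ≤ 24000 * (Real.log (η N) - Real.log (η m)) + 1 := by
    have h1 := sum_le_of_telescope (f := V)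
      (g := fun k => 24000 * Real.log (η k) - 4 * β k) hmN fun k hk hkN => by
        have h1 := div_sq_le_log (hη0 k hk) (hη0 (k + 1) (by omega)) (hstep k hk) hv
          (htwo k hk hkN.le)
        have h0 := hη0 k hk
        have e1 : 4000 * β k * η k = 4000 * (v / η k ^ 2) := by simp only [hβ]; field_simp
        simp only [hV, e1]
        linarith
    have := hβ8 m le_rfl
    have := hβ0 N hmN
    linarith
  have hmean := abs_sub_le_sum (m := fun k => ∫ s, F k s ∂chainLaw c μ k) hmN
    fun k hk hkN => (hrec k hk hkN).1
  have hpos : 0 ≤ ∫ s, F m s ^ 2 ∂chainLaw c μ m := integral_nonneg fun _ => sq_nonneg _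
  have hg := gronwall_exp (M := fun k => 1 + ∫ s, F k s ^ 2 ∂chainLaw c μ k) hmN
    (fun k hk _ => he0 k hk) (fun k hk _ => hV0 k hk) (by linarith)
    fun k hk hkN => (hrec k hk hkN).2
  have hFm0 : F m = fun s => totalPhase (η m) (v / η m ^ 3) c s := by
    funext s; simp [hF, hΘm, hβ]
  constructor
  · rw [hFm0] at hmean
    exact hmean.trans hsum_e
  · simp only [hFm0] at hg hpos
    refine hg.trans ?_
    have hs0 : 0 ≤ ∑ k ∈ Finset.Ico m N, V k :=
      Finset.sum_nonneg fun k hk => hV0 k (Finset.mem_Ico.mp hk).1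
    refine mul_le_mul (by linarith) (Real.exp_le_exp.mpr hsum_e) (Real.exp_nonneg _) (by linarith)

end region

section riemann

variable {v w r c : ℝ} {m N : ℕ} {η : ℕ → ℝ}

lemma abs_arctan_sub_le {x t : ℝ} (hx : 0 ≤ x) (ht1 : t ≤ 1) (ht0 : 0 ≤ t) (hc : c = 2 - t) :
    |Real.arctan (2 * x / c) - x| ≤ 8 * x ^ 3 + t * x := by
  have hc1 : 1 ≤ c := by linarith
  have hc0 : 0 < c := by linarith
  have hy : 0 ≤ 2 * x / c := by positivity
  have h1 := arctan_le_self hy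
  have h2 := sub_arctan_le hy
  have h3 : 2 * x / c ≤ 2 * x := div_le_self (by linarith) hc1
  have h4 : (2 * x / c) ^ 3 ≤ 8 * x ^ 3 := by
    calc (2 * x / c) ^ 3 ≤ (2 * x) ^ 3 := by gcongr
      _ = _ := by ring
  have h5 : x ≤ 2 * x / c := by
    rw [le_div_iff₀ hc0, hc]; nlinarith
  have h6 : 2 * x / c ≤ x + t * x := by
    rw [div_le_iff₀ hc0, hc]
    have : 0 ≤ t * (1 - t) * x := mul_nonneg (mul_nonneg ht0 (by linarith)) hx
    nlinarith
  have : 0 ≤ t * x := by positivity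
  rw [abs_le]
  constructor <;> linarith

lemma abs_sub_cube_le {x x' : ℝ} (hx : 0 < x) (hx' : 0 < x') (hv : 0 < v)
    (h : x' ^ 2 = x ^ 2 + v) :
    |x - (2 / (3 * v) * x' ^ 3 - 2 / (3 * v) * x ^ 3)| ≤ x' - x := by
  have h1 : x ≤ x' := by nlinarith
  have e : v = (x' - x) * (x' + x) := by linarith
  have e1 : x - (2 / (3 * v) * x' ^ 3 - 2 / (3 * v) * x ^ 3) =
      -((x' - x) ^ 2 * (2 * x' + x) / (3 * v)) := by
    field_simp
    rw [e]; ring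
  rw [e1, abs_neg, abs_of_nonneg (by positivity), div_le_iff₀ (by positivity)]
  have : 0 ≤ (x' - x) ^ 2 * (x' + 2 * x) := by positivity
  rw [e]
  linarith

lemma abs_sum_arctan_sub_le (hw : 0 < w) (hwv : w ^ 3 = v) (hmN : m ≤ N) (hr : 0 ≤ r)
    (ht : r ^ 2 * w ^ 2 ≤ 1) (hc : c = 2 - r ^ 2 * w ^ 2) (hr5 : r ^ 5 * w ^ 2 ≤ 1)
    (hη0 : ∀ k, m ≤ k → 0 < η k) (hη : ∀ k, m ≤ k → η (k + 1) ^ 2 = η k ^ 2 + v)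
    (hm : η m ≤ 3 * w) (hN : η N ^ 2 = r ^ 2 * w ^ 2 - (r ^ 2 * w ^ 2) ^ 2 / 4)
    (hcard : ((N : ℝ) - m) * v ≤ r ^ 2 * w ^ 2) :
    |∑ j ∈ Finset.Ico m N, Real.arctan (2 * η j / c) - 2 / 3 * r ^ 3| ≤ 40 := by
  have hv : 0 < v := by rw [← hwv]; positivity
  have hNr : η N ≤ r * w := le_of_sq_le_sq (by rw [hN, mul_pow]; linarith [sq_nonneg (r ^ 2 * w ^ 2)])
    (by positivity)
  have hr0 : 0 < r := by
    have := (hη0 N hmN).trans_le hNr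
    exact pos_of_mul_pos_left this hw.le
  have hmono (k : ℕ) (hk : m ≤ k) : η k ≤ η (k + 1) :=
    le_of_sq_le_sq (by rw [hη k hk]; linarith) (hη0 (k + 1) (by omega)).le
  have hle (k : ℕ) (hk : m ≤ k) (hkN : k ≤ N) : η k ≤ η N := by
    induction N, hkN using Nat.le_induction with
    | base => exact le_rfl
    | succ n hn ih =>
      have : ∀ n, k ≤ n → η k ≤ η n := fun n hn => by
        induction n, hn using Nat.le_induction with
        | base => exact le_rfl
        | succ n hn ih => exact ih.trans (hmono n (by omega))
      exact this _ (by omega)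
  have h1 : |∑ j ∈ Finset.Ico m N, (Real.arctan (2 * η j / c) - η j)| ≤ 9 := by
    refine (Finset.abs_sum_le_sum_abs _ _).trans ?_
    have : ∀ j ∈ Finset.Ico m N, |Real.arctan (2 * η j / c) - η j| ≤ 9 * (r ^ 3 * v) := by
      intro j hj
      obtain ⟨hj1, hj2⟩ := Finset.mem_Ico.mp hj
      have h0 := (hη0 j hj1).le
      have h3 := (hle j hj1 hj2.le).trans hNr
      refine (abs_arctan_sub_le h0 ht (by positivity) hc).trans ?_
      calc 8 * η j ^ 3 + r ^ 2 * w ^ 2 * η j ≤ 8 * (r * w) ^ 3 + r ^ 2 * w ^ 2 * (r * w) := by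
            gcongr
        _ = _ := by rw [← hwv]; ring
    refine (Finset.sum_le_sum this).trans ?_
    rw [Finset.sum_const, Nat.card_Ico, nsmul_eq_mul, Nat.cast_sub hmN]
    calc ((N : ℝ) - m) * (9 * (r ^ 3 * v)) = 9 * r ^ 3 * (((N : ℝ) - m) * v) := by ring
      _ ≤ 9 * r ^ 3 * (r ^ 2 * w ^ 2) := by gcongr
      _ = 9 * (r ^ 5 * w ^ 2) := by ring
      _ ≤ 9 := by linarith
  have h2 : |∑ j ∈ Finset.Ico m N, (η j -
      (2 / (3 * v) * η (j + 1) ^ 3 - 2 / (3 * v) * η j ^ 3))| ≤ 1 := by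
    refine (Finset.abs_sum_le_sum_abs _ _).trans ?_
    have := sum_le_of_telescope (f := fun j => |η j -
      (2 / (3 * v) * η (j + 1) ^ 3 - 2 / (3 * v) * η j ^ 3)|) (g := η) hmN fun k hk _ =>
      abs_sub_cube_le (hη0 k hk) (hη0 (k + 1) (by omega)) hv (hη k hk)
    have h3 : r * w ≤ 1 := le_of_sq_le_sq (by rw [mul_pow]; linarith) zero_le_one
    have := hη0 m le_rfl
    linarith
  rw [Finset.sum_sub_distrib] at h1 h2
  rw [Finset.sum_Ico_sub (fun j => 2 / (3 * v) * η j ^ 3) hmN] at h2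
  have h3 : 2 / (3 * v) * η m ^ 3 ≤ 18 := by
    rw [div_mul_eq_mul_div, div_le_iff₀ (by positivity)]
    have := (hη0 m le_rfl).le
    have : η m ^ 3 ≤ (3 * w) ^ 3 := by gcongr
    have : (3 * w) ^ 3 = 27 * v := by rw [← hwv]; ring
    linarith
  have h3' : 0 ≤ 2 / (3 * v) * η m ^ 3 := by have := hη0 m le_rfl; positivity
  have hN0 := hη0 N hmN
  have h4 : 2 / (3 * v) * η N ^ 3 ≤ 2 / 3 * r ^ 3 := by
    have : η N ^ 3 ≤ (r * w) ^ 3 := by gcongr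
    rw [mul_pow, hwv] at this
    rw [div_mul_eq_mul_div, div_le_iff₀ (by positivity)]
    linarith
  have h5 : 2 / 3 * r ^ 3 ≤ 2 / (3 * v) * η N ^ 3 + 1 := by
    have e1 : (r * w - η N) * (r * w) ≤ (r * w) ^ 4 / 4 := by
      have : (r * w - η N) * (r * w + η N) = (r * w) ^ 4 / 4 := by
        linear_combination -hN
      have : 0 ≤ (r * w - η N) * η N := mul_nonneg (by linarith) hN0.le
      linarith
    have e2 : (r * w) ^ 3 - η N ^ 3 ≤ (r * w - η N) * (r * w) * (3 * (r * w)) := by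
      have : (r * w - η N) * (r * w) * (3 * (r * w)) - ((r * w) ^ 3 - η N ^ 3) =
        (r * w - η N) ^ 2 * (2 * (r * w) + η N) := by ring
      have : 0 ≤ (r * w - η N) ^ 2 * (2 * (r * w) + η N) := by positivity
      linarith
    have e3 : (r * w - η N) * (r * w) * (3 * (r * w)) ≤ (r * w) ^ 4 / 4 * (3 * (r * w)) := by
      gcongr
    have e4 : (r * w) ^ 4 / 4 * (3 * (r * w)) = 3 / 4 * v * (r ^ 5 * w ^ 2) := by
      rw [← hwv]; ring
    have e5 : v * (r ^ 5 * w ^ 2) ≤ v * 1 := by gcongr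
    have e6 : r ^ 3 * v ≤ η N ^ 3 + v := by
      rw [← hwv, ← mul_pow, hwv]; linarith
    calc 2 / 3 * r ^ 3 = 2 / (3 * v) * (r ^ 3 * v) := by field_simp
      _ ≤ 2 / (3 * v) * (η N ^ 3 + v) := by gcongr
      _ = 2 / (3 * v) * η N ^ 3 + 2 / 3 := by field_simp
      _ ≤ _ := by linarith
  rw [abs_le] at h1 h2 ⊢
  constructor <;> linarith

end riemann

section combine

variable {μ : ℕ → Measure (ℝ × ℝ)} {N k m : ℕ} {v c w r : ℝ}

/-- A bound for the second moment of the phase at the end of the turning region. -/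
def turningBound : ℝ := (1 + (128 + 128 * Real.exp 1400000) + 500000) * Real.exp 500000

lemma turningBound_pos : 0 < turningBound := by unfold turningBound; positivity

lemma integrable_sq_chainLaw (h : ∀ k < N, IsNoise (μ k) v (k * v)) (hk : k ≤ N)
    {f : ℕ × ℝ → ℝ} (hf : Measurable f) {A : ℝ} (hA : ∀ s, |f s| ≤ A * (1 + s.1)) :
    Integrable (fun s => f s ^ 2) (chainLaw c μ k) := by
  refine integrable_chainLaw h hk (hf.pow_const 2) (A := A ^ 2) fun s => ?_
  rw [abs_of_nonneg (sq_nonneg _), ← sq_abs, ← mul_pow]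
  have := hA s
  gcongr

lemma integrable_one_chainLaw (h : ∀ k < N, IsNoise (μ k) v (k * v)) (hk : k ≤ N)
    {f : ℕ × ℝ → ℝ} (hf : Measurable f) {A : ℝ} (hA : ∀ s, |f s| ≤ A * (1 + s.1)) :
    Integrable f (chainLaw c μ k) := by
  have := isProbabilityMeasure_chainLaw (c := c) h hk
  exact ((memLp_two_iff_integrable_sq hf.aestronglyMeasurable).mpr
    (integrable_sq_chainLaw h hk hf hA)).integrable one_le_two

lemma abs_fst_le (s : ℕ × ℝ) : |(s.1 : ℝ)| ≤ 1 * (1 + s.1) := by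
  rw [abs_of_nonneg (by positivity)]; linarith

lemma measurable_fst_cast : Measurable fun s : ℕ × ℝ => (s.1 : ℝ) := by fun_prop

lemma integral_sq_le_chainLaw (h : ∀ k < N, IsNoise (μ k) v (k * v)) (hk : k ≤ N)
    {f g : ℕ × ℝ → ℝ} (hf : Measurable f) (hg : Measurable g) {A B b : ℝ}
    (hA : ∀ s, |f s| ≤ A * (1 + s.1)) (hB : ∀ s, |g s| ≤ B * (1 + s.1))
    (hfg : ∀ s, |f s - g s| ≤ b) :
    ∫ s, f s ^ 2 ∂chainLaw c μ k ≤ 2 * ∫ s, g s ^ 2 ∂chainLaw c μ k + 2 * b ^ 2 := by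
  have := isProbabilityMeasure_chainLaw (c := c) h hk
  have ig := integrable_sq_chainLaw (c := c) h hk hg hB
  have : ∫ s, f s ^ 2 ∂chainLaw c μ k ≤ ∫ s, (2 * g s ^ 2 + 2 * b ^ 2) ∂chainLaw c μ k := by
    refine integral_mono (integrable_sq_chainLaw h hk hf hA)
      ((ig.const_mul 2).add (integrable_const _)) fun s => ?_
    have h1 : (f s - g s) ^ 2 ≤ b ^ 2 := by
      rw [← sq_abs]
      have := hfg s
      gcongr
    change f s ^ 2 ≤ 2 * g s ^ 2 + 2 * b ^ 2
    nlinarith [sq_nonneg (f s - 2 * g s)]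
  rw [integral_add (ig.const_mul 2) (integrable_const _)] at this
  simpa only [integral_const_mul, integral_const, probReal_univ, smul_eq_mul, one_mul] using this

lemma abs_integral_sub_le_chainLaw (h : ∀ k < N, IsNoise (μ k) v (k * v)) (hk : k ≤ N)
    {f g : ℕ × ℝ → ℝ} (hf : Measurable f) (hg : Measurable g) {A B b : ℝ}
    (hA : ∀ s, |f s| ≤ A * (1 + s.1)) (hB : ∀ s, |g s| ≤ B * (1 + s.1))
    (hfg : ∀ s, |f s - g s| ≤ b) :
    |∫ s, f s ∂chainLaw c μ k - ∫ s, g s ∂chainLaw c μ k| ≤ b := by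
  have := isProbabilityMeasure_chainLaw (c := c) h hk
  rw [← integral_sub (integrable_one_chainLaw h hk hf hA) (integrable_one_chainLaw h hk hg hB)]
  have := norm_integral_le_of_norm_le_const (μ := chainLaw c μ k)
    (f := fun s => f s - g s) (Filter.Eventually.of_forall hfg)
  simpa using this

lemma abs_integral_le_chainLaw (h : ∀ k < N, IsNoise (μ k) v (k * v)) (hk : k ≤ N)
    {f : ℕ × ℝ → ℝ} (hf : Measurable f) {A : ℝ} (hA : ∀ s, |f s| ≤ A * (1 + s.1)) :
    |∫ s, f s ∂chainLaw c μ k| ≤ 1 + ∫ s, f s ^ 2 ∂chainLaw c μ k := by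
  have := isProbabilityMeasure_chainLaw (c := c) h hk
  have i2 := integrable_sq_chainLaw (c := c) h hk hf hA
  have i1 := integrable_one_chainLaw (c := c) h hk hf hA
  refine abs_integral_le_integral_abs.trans ?_
  have : ∫ s, |f s| ∂chainLaw c μ k ≤ ∫ s, (1 + f s ^ 2) ∂chainLaw c μ k := by
    refine integral_mono i1.abs ((integrable_const 1).add i2) fun s => ?_
    change |f s| ≤ 1 + f s ^ 2
    rw [← sq_abs (f s)]
    nlinarith [sq_nonneg (|f s| - 1)]
  rw [integral_add (integrable_const 1) i2] at this
  simpa using this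

lemma integral_totalPhase_sq_le (h : ∀ k < N, IsNoise (μ k) v (k * v)) (hv : 0 < v)
    (hvN : (N : ℝ) * v = 1) (hc1 : 1 ≤ c) (hc2 : c ≤ 2) (hw : 0 < w) (hw1 : w ≤ 1)
    (hwv : w ^ 3 = v) (hkN : k ≤ N) (hk : k * v ≤ c ^ 2 / 4 + 4 * w ^ 2 + v)
    (hk' : c ^ 2 / 4 - 4 * w ^ 2 - v ≤ k * v) :
    1 + ∫ s, totalPhase w 0 c s ^ 2 ∂chainLaw c μ k ≤ turningBound := by
  set m := min k ⌊(c ^ 2 / 4 - 4 * w ^ 2) / v⌋₊ with hmdef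
  have hmk : m ≤ k := min_le_left _ _
  have hm1 : m = 0 ∨ m * v ≤ c ^ 2 / 4 - 4 * w ^ 2 := by
    rcases lt_or_ge ((c ^ 2 / 4 - 4 * w ^ 2) / v) 0 with h0 | h0
    · left; rw [hmdef, Nat.floor_of_nonpos h0.le]; simp
    · right
      rw [← le_div_iff₀ hv]
      refine le_trans ?_ (Nat.floor_le h0)
      exact_mod_cast min_le_right _ _
  have hm2 : c ^ 2 / 4 - 4 * w ^ 2 - v ≤ m * v := by
    rcases min_choice k ⌊(c ^ 2 / 4 - 4 * w ^ 2) / v⌋₊ with h1 | h1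
    · rw [hmdef, h1]; exact hk'
    · rw [hmdef, h1]
      have := Nat.lt_floor_add_one ((c ^ 2 / 4 - 4 * w ^ 2) / v)
      rw [div_lt_iff₀ hv] at this
      linarith
  have h1 := hyperbolic_region h hv hvN.le hc1 hc2 hw hwv (hmk.trans hkN) hm1
  have h2 := turning_region h hv hvN.le hc1 hc2 hw hw1 hwv hmk hkN hm2 hk
  have h3 := integral_sq_le_chainLaw (c := c) h (hmk.trans hkN) (measurable_totalPhase w 0 c)
    (measurable_fst_cast.const_mul Real.pi) (A := 8) (B := 8) (b := 8)
    (abs_totalPhase_le le_rfl zero_le_one hc1 hc2) (fun s => by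
      rw [abs_of_nonneg (by positivity)]
      have : (0:ℝ) ≤ s.1 := by positivity
      nlinarith [Real.pi_lt_four]) (abs_totalPhase_sub_le le_rfl zero_le_one hc1 hc2)
  simp only [mul_pow, integral_const_mul] at h3
  have h4 : Real.pi ^ 2 ≤ 16 := by nlinarith [Real.pi_lt_four, Real.pi_pos]
  have h5 : 0 ≤ ∫ s, (s.1 : ℝ) ^ 2 ∂chainLaw c μ m := integral_nonneg fun _ => sq_nonneg _
  have h6 : Real.pi ^ 2 * ∫ s, (s.1 : ℝ) ^ 2 ∂chainLaw c μ m ≤ 16 * Real.exp 1400000 := by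
    gcongr
  refine h2.trans ?_
  unfold turningBound
  have := Real.exp_pos 1400000
  gcongr
  linarith

/-- A constant that is good enough for all counting estimates. -/
def countingBound : ℝ := 2000000 + 200 + (4 * turningBound + 2000000) * Real.exp 2000000

set_option maxHeartbeats 1000000 in
lemma chain_counting (h : ∀ k < N, IsNoise (μ k) v (k * v)) (hv : 0 < v)
    (hvN : (N : ℝ) * v = 1) (hw : 0 < w) (hw1 : w ≤ 1)
    (hwv : w ^ 3 = v) (hr : 0 ≤ r) (ht : r ^ 2 * w ^ 2 ≤ 1) (hc : c = 2 - r ^ 2 * w ^ 2) :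
    (1 ≤ r → ∃ a : ℝ, ∫ s, (s.1 - a) ^ 2 ∂chainLaw c μ N ≤ countingBound * (1 + Real.log r)) ∧
    (r ^ 5 * w ^ 2 ≤ 1 →
      |∫ s, (s.1 : ℝ) ∂chainLaw c μ N - 2 / (3 * Real.pi) * r ^ 3| ≤ countingBound) := by
  have ht0 : 0 ≤ r ^ 2 * w ^ 2 := by positivity
  have hc1 : 1 ≤ c := by linarith
  have hc2 : c ≤ 2 := by linarith
  have hB := turningBound_pos
  have hexp : 1 ≤ Real.exp 2000000 := Real.one_le_exp (by norm_num)
  have hBe : turningBound ≤ turningBound * Real.exp 2000000 := le_mul_of_one_le_right hB.le hexp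
  have hX : c ^ 2 / 4 = 1 - r ^ 2 * w ^ 2 + (r ^ 2 * w ^ 2) ^ 2 / 4 := by rw [hc]; ring
  have hX1 : c ^ 2 / 4 ≤ 1 := by nlinarith
  have hw2 := sq_nonneg w
  have hvw : v ≤ w ^ 2 := by rw [← hwv]; nlinarith
  have hpi := Real.pi_gt_three
  have hpi4 := Real.pi_lt_four
  have hπn (s : ℕ × ℝ) : |Real.pi * s.1| ≤ 8 * (1 + s.1) := by
    rw [abs_of_nonneg (by positivity)]
    have : (0:ℝ) ≤ s.1 := by positivity
    nlinarith
  rcases le_or_gt N ⌈(c ^ 2 / 4 + 4 * w ^ 2) / v⌉₊ with hN | hN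
  · have hN1 : N * v ≤ c ^ 2 / 4 + 4 * w ^ 2 + v := by
      have h1 := Nat.ceil_lt_add_one (a := (c ^ 2 / 4 + 4 * w ^ 2) / v) (by positivity)
      have h2 : (N : ℝ) < (c ^ 2 / 4 + 4 * w ^ 2) / v + 1 := lt_of_le_of_lt (by exact_mod_cast hN) h1
      have h3 := mul_lt_mul_of_pos_right h2 hv
      rw [add_mul, div_mul_cancel₀ _ hv.ne'] at h3
      linarith
    have h1 := integral_totalPhase_sq_le h hv hvN hc1 hc2 hw hw1 hwv le_rfl hN1 (by linarith)
    have h2 := integral_sq_le_chainLaw (c := c) h le_rfl (measurable_fst_cast.const_mul Real.pi)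
      (measurable_totalPhase w 0 c) (A := 8) (B := 8) (b := 8) hπn
      (abs_totalPhase_le le_rfl zero_le_one hc1 hc2)
      (fun s => by rw [abs_sub_comm]; exact abs_totalPhase_sub_le le_rfl zero_le_one hc1 hc2 s)
    simp only [mul_pow, integral_const_mul] at h2
    have h3 : 0 ≤ ∫ s, (s.1 : ℝ) ^ 2 ∂chainLaw c μ N := integral_nonneg fun _ => sq_nonneg _
    have h4 : ∫ s, (s.1 : ℝ) ^ 2 ∂chainLaw c μ N ≤
        Real.pi ^ 2 * ∫ s, (s.1 : ℝ) ^ 2 ∂chainLaw c μ N :=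
      le_mul_of_one_le_left h3 (by nlinarith)
    constructor
    · intro hr1
      refine ⟨0, ?_⟩
      simp only [sub_zero]
      have := Real.log_nonneg hr1
      unfold countingBound
      have h5 : 0 ≤ (2000000 + 200 + (4 * turningBound + 2000000) * Real.exp 2000000) * Real.log r := by
        positivity
      linarith
    · intro _
      have h5 := abs_integral_le_chainLaw (c := c) h le_rfl measurable_fst_cast abs_fst_le
      have h6 : r ≤ 3 := by
        have : r ^ 2 * w ^ 2 * (3 / 4) ≤ 5 * w ^ 2 := by nlinarith
        have : r ^ 2 * (3 / 4) ≤ 5 := by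
          refine le_of_mul_le_mul_right ?_ (pow_pos hw 2)
          linarith
        nlinarith
      have h7 : r ^ 3 ≤ 27 := by
        calc r ^ 3 ≤ 3 ^ 3 := by gcongr
          _ = _ := by norm_num
      have h8 : 2 / (3 * Real.pi) ≤ 1 := by rw [div_le_one (by positivity)]; linarith
      have h9 : 2 / (3 * Real.pi) * r ^ 3 ≤ 27 := by
        calc 2 / (3 * Real.pi) * r ^ 3 ≤ 1 * 27 := by gcongr
          _ = _ := by norm_num
      have h10 : 0 ≤ 2 / (3 * Real.pi) * r ^ 3 := by positivity
      have h11 := abs_sub (∫ s, (s.1 : ℝ) ∂chainLaw c μ N) (2 / (3 * Real.pi) * r ^ 3)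
      rw [abs_of_nonneg h10] at h11
      unfold countingBound
      linarith
  · set m := ⌈(c ^ 2 / 4 + 4 * w ^ 2) / v⌉₊ with hmdef
    have hm1 : c ^ 2 / 4 + 4 * w ^ 2 ≤ m * v := by
      rw [← div_le_iff₀ hv]; exact Nat.le_ceil _
    have hm2 : m * v ≤ c ^ 2 / 4 + 4 * w ^ 2 + v := by
      have h1 := Nat.ceil_lt_add_one (a := (c ^ 2 / 4 + 4 * w ^ 2) / v) (by positivity)
      have h3 := mul_lt_mul_of_pos_right h1 hv
      rw [add_mul, div_mul_cancel₀ _ hv.ne'] at h3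
      linarith
    have h1 := integral_totalPhase_sq_le h hv hvN hc1 hc2 hw hw1 hwv hN.le hm2 (by linarith)
    set η : ℕ → ℝ := fun k : ℕ => √(k * v - c ^ 2 / 4) with hη
    set Θ : ℕ → ℝ := fun k => ∑ j ∈ Finset.Ico m k, Real.arctan (2 * η j / c) with hΘ
    obtain ⟨hmean, hvar⟩ := elliptic_region h hv hvN.le hc1 hc2 hw hwv hN.le hm1 hη hΘ
    have hη2 (k : ℕ) (hk : m ≤ k) : 4 * w ^ 2 ≤ k * v - c ^ 2 / 4 := by
      have : (m : ℝ) * v ≤ k * v := by gcongr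
      linarith
    have hsq (k : ℕ) (hk : m ≤ k) : η k ^ 2 = k * v - c ^ 2 / 4 :=
      Real.sq_sqrt (by have := hη2 k hk; linarith)
    have hηw (k : ℕ) (hk : m ≤ k) : 2 * w ≤ η k :=
      Real.le_sqrt_of_sq_le (by have := hη2 k hk; linarith)
    have hη0 (k : ℕ) (hk : m ≤ k) : 0 < η k := by linarith [hηw k hk]
    have hstep (k : ℕ) (hk : m ≤ k) : η (k + 1) ^ 2 = η k ^ 2 + v := by
      rw [hsq _ hk, hsq _ (by omega)]; push_cast; ring
    have hηN : η N ^ 2 = r ^ 2 * w ^ 2 - (r ^ 2 * w ^ 2) ^ 2 / 4 := by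
      rw [hsq N hN.le, hvN, hX]; ring
    have hNr : η N ≤ r * w := le_of_sq_le_sq
      (by rw [hηN, mul_pow]; linarith [sq_nonneg (r ^ 2 * w ^ 2)]) (by positivity)
    have hβ (k : ℕ) (hk : m ≤ k) : 0 ≤ v / η k ^ 3 ∧ v / η k ^ 3 ≤ 1 := by
      have h2 := pow_pos (hη0 k hk) 3
      refine ⟨(div_pos hv h2).le, ?_⟩
      rw [div_le_one h2]
      calc v ≤ (2 * w) ^ 3 := by rw [mul_pow, hwv]; linarith
        _ ≤ _ := by gcongr; exact hηw k hk
    clear_value η Θ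
    have hFA (k : ℕ) (hk : m ≤ k) (a : ℝ) (s : ℕ × ℝ) :
        |totalPhase (η k) (v / η k ^ 3) c s - a| ≤ (8 + |a|) * (1 + s.1) := by
      have h1 := abs_totalPhase_le (η := η k) (hβ k hk).1 (hβ k hk).2 hc1 hc2 s
      have h2 := abs_sub (totalPhase (η k) (v / η k ^ 3) c s) a
      have h3 : 0 ≤ |a| * s.1 := by positivity
      linarith
    have hπΘ (s : ℕ × ℝ) : |Real.pi * s.1 - Θ N| ≤ (8 + |Θ N|) * (1 + s.1) := by
      have h1 := hπn s
      have h2 := abs_sub (Real.pi * s.1) (Θ N)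
      have h3 : 0 ≤ |Θ N| * s.1 := by positivity
      linarith
    have hTm (k : ℕ) := measurable_totalPhase (η k) (v / η k ^ 3) c
    have hFm (k : ℕ) (hk : m ≤ k) := abs_totalPhase_le (η := η k) (hβ k hk).1 (hβ k hk).2 hc1 hc2
    have hπm : Measurable fun s : ℕ × ℝ => Real.pi * s.1 - Θ N :=
      (measurable_fst_cast.const_mul Real.pi).sub_const _
    have hm0 := integral_sq_le_chainLaw (c := c) h hN.le (hTm m) (measurable_totalPhase w 0 c)
      (hFm m le_rfl) (abs_totalPhase_le le_rfl zero_le_one hc1 hc2) (b := 16) fun s => by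
        have h1 := abs_le.mp (abs_totalPhase_sub_le (η := w) le_rfl zero_le_one hc1 hc2 s)
        have h2 := abs_le.mp
          (abs_totalPhase_sub_le (η := η m) (hβ m le_rfl).1 (hβ m le_rfl).2 hc1 hc2 s)
        rw [abs_le]; constructor <;> linarith
    have hdiff (s : ℕ × ℝ) : |Real.pi * s.1 - Θ N -
        (totalPhase (η N) (v / η N ^ 3) c s - Θ N)| ≤ 8 := by
      rw [sub_sub_sub_cancel_right, abs_sub_comm]
      exact abs_totalPhase_sub_le (hβ N hN.le).1 (hβ N hN.le).2 hc1 hc2 s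
    have hn2 := integral_sq_le_chainLaw (c := c) h le_rfl hπm ((hTm N).sub_const _) hπΘ
      (hFA N hN.le (Θ N)) hdiff
    have hn1 := abs_integral_sub_le_chainLaw (c := c) h le_rfl hπm ((hTm N).sub_const _) hπΘ
      (hFA N hN.le (Θ N)) hdiff
    have hm01 := abs_integral_le_chainLaw (c := c) h hN.le (hTm m) (hFm m le_rfl)
    constructor
    · intro hr1
      refine ⟨Θ N / Real.pi, ?_⟩
      have hl : Real.log (η N) - Real.log (η m) ≤ Real.log r := by
        have h2 := Real.log_le_log (hη0 N hN.le) hNr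
        have h3 : Real.log w ≤ Real.log (η m) :=
          Real.log_le_log hw (by linarith [hηw m le_rfl])
        rw [Real.log_mul (by positivity) hw.ne'] at h2
        linarith
      have hl0 := Real.log_nonneg hr1
      have e1 (s : ℕ × ℝ) : (Real.pi * s.1 - Θ N) ^ 2 =
          Real.pi ^ 2 * (s.1 - Θ N / Real.pi) ^ 2 := by field_simp
      simp only [e1, integral_const_mul] at hn2
      have h3 : 0 ≤ ∫ s, (s.1 - Θ N / Real.pi : ℝ) ^ 2 ∂chainLaw c μ N :=
        integral_nonneg fun _ => sq_nonneg _
      have h4 : ∫ s, (s.1 - Θ N / Real.pi : ℝ) ^ 2 ∂chainLaw c μ N ≤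
          Real.pi ^ 2 * ∫ s, (s.1 - Θ N / Real.pi : ℝ) ^ 2 ∂chainLaw c μ N :=
        le_mul_of_one_le_left h3 (by nlinarith)
      have h5 : (1 + ∫ s, totalPhase (η m) (v / η m ^ 3) c s ^ 2 ∂chainLaw c μ m +
          (24000 * (Real.log (η N) - Real.log (η m)) + 1)) * Real.exp 2000000 ≤
          (2 * turningBound + 600 + 24000 * Real.log r) * Real.exp 2000000 := by
        refine mul_le_mul_of_nonneg_right ?_ (Real.exp_nonneg _)
        linarith
      have h6 : 0 ≤ turningBound * Real.exp 2000000 * Real.log r := by positivity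
      have h7 : 0 ≤ Real.exp 2000000 * Real.log r := by positivity
      unfold countingBound
      linarith
    · intro hr5
      have hm3 : η m ≤ 3 * w := by
        refine le_of_sq_le_sq ?_ (by positivity)
        rw [hsq m le_rfl, mul_pow]
        linarith only [hm2, hvw, hw2]
      have hcard : ((N : ℝ) - m) * v ≤ r ^ 2 * w ^ 2 := by
        rw [sub_mul, hvN]
        linarith only [hm1, hX, sq_nonneg (r ^ 2 * w ^ 2), hw2]
      have hS := abs_sum_arctan_sub_le (m := m) (N := N) hw hwv hN.le hr ht hc hr5 hη0 hstep
        hm3 hηN hcard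
      have hΘN : Θ N = ∑ j ∈ Finset.Ico m N, Real.arctan (2 * η j / c) := by rw [hΘ]
      rw [← hΘN] at hS
      have := isProbabilityMeasure_chainLaw (c := c) h le_rfl
      have i1 : Integrable (fun s : ℕ × ℝ => Real.pi * s.1) (chainLaw c μ N) :=
        (integrable_one_chainLaw h le_rfl measurable_fst_cast abs_fst_le).const_mul _
      rw [integral_sub i1 (integrable_const _)] at hn1
      simp only [integral_const_mul, integral_const, probReal_univ, smul_eq_mul, one_mul] at hn1
      have e : ∫ s, (s.1 : ℝ) ∂chainLaw c μ N - 2 / (3 * Real.pi) * r ^ 3 =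
          (Real.pi * ∫ s, (s.1 : ℝ) ∂chainLaw c μ N - 2 / 3 * r ^ 3) / Real.pi := by
        field_simp
      rw [e, abs_div, abs_of_pos Real.pi_pos]
      refine (div_le_self (abs_nonneg _) (by linarith)).trans ?_
      have h6 : 0 ≤ Real.exp 2000000 := (Real.exp_nonneg _)
      have h7 := abs_le.mp hm01
      have h8 := abs_le.mp hmean
      have h9 := abs_le.mp hn1
      have h10 := abs_le.mp hS
      unfold countingBound
      rw [abs_le]
      constructor <;> linarith only [h1, h6, h7, h8, h9, h10, hm0, hBe, hexp]

end combine

section gaussianMoments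

lemma integrable_pow_gaussianReal (n : ℕ) : Integrable (fun x : ℝ => x ^ n) (gaussianReal 0 1) := by
  have h := (memLp_id_gaussianReal' (μ := 0) (v := 1) (n : ENNReal) (by simp)).integrable_norm_pow'
  refine h.mono' (by fun_prop) (Filter.Eventually.of_forall fun x => ?_)
  simp

lemma integrable_pow_mul_gaussianPDFReal (n : ℕ) :
    Integrable (fun x : ℝ => x ^ n * gaussianPDFReal 0 1 x) := by
  have h := integrable_pow_gaussianReal n
  rw [gaussianReal_of_var_ne_zero 0 one_ne_zero,
    integrable_withDensity_iff (measurable_gaussianPDF 0 1)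
      (Filter.Eventually.of_forall fun x => by simp [gaussianPDF])] at h
  simpa [toReal_gaussianPDF] using h

lemma integral_pow_add_two_gaussianReal (n : ℕ) :
    ∫ x, x ^ (n + 2) ∂gaussianReal 0 1 = (n + 1) * ∫ x, x ^ n ∂gaussianReal 0 1 := by
  simp only [integral_gaussianReal_eq_integral_smul (one_ne_zero : (1 : NNReal) ≠ 0), smul_eq_mul]
  have hd (x : ℝ) : HasDerivAt (gaussianPDFReal 0 1) (-x * gaussianPDFReal 0 1 x) x := by
    unfold gaussianPDFReal
    have h1 : HasDerivAt (fun x : ℝ => -(x - 0) ^ 2 / (2 * (1 : NNReal))) (-x) x := by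
      have := ((((hasDerivAt_id x).sub_const 0).pow 2).neg).div_const (2 * ((1 : NNReal) : ℝ))
      refine this.congr_deriv ?_
      simp; ring
    refine ((h1.exp).const_mul _).congr_deriv ?_
    ring
  have hu (x : ℝ) : HasDerivAt (fun x : ℝ => x ^ (n + 1)) ((n + 1) * x ^ n) x := by
    have := hasDerivAt_pow (n + 1) x
    simpa using this
  have h := integral_mul_deriv_eq_deriv_mul_of_integrable (u := fun x : ℝ => x ^ (n + 1))
    (v := gaussianPDFReal 0 1) (u' := fun x => (n + 1) * x ^ n)
    (v' := fun x => -x * gaussianPDFReal 0 1 x) (fun x _ => hu x) (fun x _ => hd x) ?_ ?_ ?_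
  · have e1 (x : ℝ) : x ^ (n + 1) * (-x * gaussianPDFReal 0 1 x) =
      -(gaussianPDFReal 0 1 x * x ^ (n + 2)) := by ring
    have e2 (x : ℝ) : (n + 1) * x ^ n * gaussianPDFReal 0 1 x =
      (n + 1) * (gaussianPDFReal 0 1 x * x ^ n) := by ring
    simp only [e1, e2, integral_neg, integral_const_mul] at h
    linarith
  · refine (integrable_pow_mul_gaussianPDFReal (n + 2)).neg.congr
      (Filter.Eventually.of_forall fun x => ?_)
    simp only [Pi.neg_apply, Pi.mul_apply]; ring
  · refine ((integrable_pow_mul_gaussianPDFReal n).const_mul (n + 1 : ℝ)).congr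
      (Filter.Eventually.of_forall fun x => ?_)
    simp only [Pi.mul_apply]; ring
  · exact integrable_pow_mul_gaussianPDFReal (n + 1)

lemma integral_gaussianReal_pow_two : ∫ x, x ^ 2 ∂gaussianReal 0 1 = 1 := by
  have := integral_pow_add_two_gaussianReal 0
  simpa using this

lemma integral_gaussianReal_pow_four : ∫ x, x ^ 4 ∂gaussianReal 0 1 = 3 := by
  have := integral_pow_add_two_gaussianReal 2
  rw [integral_gaussianReal_pow_two] at this
  norm_num at this ⊢; exact this

lemma integral_gaussianReal_pow_six : ∫ x, x ^ 6 ∂gaussianReal 0 1 = 15 := by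
  have := integral_pow_add_two_gaussianReal 4
  rw [integral_gaussianReal_pow_four] at this
  norm_num at this ⊢; exact this

lemma integral_gaussianReal_pow_eight : ∫ x, x ^ 8 ∂gaussianReal 0 1 = 105 := by
  have := integral_pow_add_two_gaussianReal 6
  rw [integral_gaussianReal_pow_six] at this
  norm_num at this ⊢; exact this

lemma integrable_sq_sub_one_pow (n : ℕ) :
    Integrable (fun x : ℝ => (x ^ 2 - 1) ^ n) (gaussianReal 0 1) := by
  have : (fun x : ℝ => (x ^ 2 - 1) ^ n) = fun x : ℝ =>
      ∑ m ∈ Finset.range (n + 1), (-1) ^ (m + n) * (x ^ 2) ^ m * 1 ^ (n - m) * (n.choose m) := by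
    funext x
    exact sub_pow (x ^ 2) 1 n
  rw [this]
  refine integrable_finsetSum _ fun m _ => ?_
  have h := (integrable_pow_gaussianReal (2 * m)).const_mul ((-1) ^ (m + n) * (n.choose m : ℝ))
  refine h.congr (Filter.Eventually.of_forall fun x => ?_)
  simp only [one_pow, pow_mul]; ring

lemma integral_sq_sub_one : ∫ x, (x ^ 2 - 1) ∂gaussianReal 0 1 = 0 := by
  rw [integral_sub (integrable_pow_gaussianReal 2) (integrable_const _),
    integral_gaussianReal_pow_two]
  simp

lemma integral_sq_sub_one_pow_two : ∫ x, (x ^ 2 - 1) ^ 2 ∂gaussianReal 0 1 = 2 := by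
  have e (x : ℝ) : (x ^ 2 - 1) ^ 2 = x ^ 4 - (2 * x ^ 2 - 1) := by ring
  have i2 := (integrable_pow_gaussianReal 2).const_mul 2
  have j2 : Integrable (fun x : ℝ => 2 * x ^ 2 - 1) (gaussianReal 0 1) :=
    i2.sub (integrable_const _)
  simp only [e]
  rw [integral_sub (integrable_pow_gaussianReal 4) j2,
    integral_sub i2 (integrable_const _), integral_const_mul, integral_gaussianReal_pow_two,
    integral_gaussianReal_pow_four]
  simp; norm_num

lemma integral_sq_sub_one_pow_four : ∫ x, (x ^ 2 - 1) ^ 4 ∂gaussianReal 0 1 = 60 := by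
  have e (x : ℝ) : (x ^ 2 - 1) ^ 4 = x ^ 8 - (4 * x ^ 6 - (6 * x ^ 4 - (4 * x ^ 2 - 1))) := by ring
  have i2 := (integrable_pow_gaussianReal 2).const_mul 4
  have i4 := (integrable_pow_gaussianReal 4).const_mul 6
  have i6 := (integrable_pow_gaussianReal 6).const_mul 4
  have j2 : Integrable (fun x : ℝ => 4 * x ^ 2 - 1) (gaussianReal 0 1) :=
    i2.sub (integrable_const _)
  have j4 : Integrable (fun x : ℝ => 6 * x ^ 4 - (4 * x ^ 2 - 1)) (gaussianReal 0 1) := i4.sub j2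
  have j6 : Integrable (fun x : ℝ => 4 * x ^ 6 - (6 * x ^ 4 - (4 * x ^ 2 - 1)))
    (gaussianReal 0 1) := i6.sub j4
  simp only [e]
  rw [integral_sub (integrable_pow_gaussianReal 8) j6, integral_sub i6 j4, integral_sub i4 j2,
    integral_sub i2 (integrable_const _)]
  simp only [integral_const_mul, integral_gaussianReal_pow_two, integral_gaussianReal_pow_four,
    integral_gaussianReal_pow_six, integral_gaussianReal_pow_eight, integral_const, probReal_univ,
    smul_eq_mul]
  norm_num

end gaussianMoments

section chi

/-- The standard Gaussian measure on `Fin k → ℝ`. -/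
abbrev stdPi (k : ℕ) : Measure (Fin k → ℝ) := Measure.pi fun _ => gaussianReal 0 1

/-- The centred squared norm. -/
def chiDev {k : ℕ} (h : Fin k → ℝ) : ℝ := ∑ i, (h i ^ 2 - 1)

lemma measurable_chiDev {k : ℕ} : Measurable (chiDev (k := k)) := by
  unfold chiDev; fun_prop

lemma map_chiDev_succ (k : ℕ) : (stdPi (k + 1)).map chiDev =
    ((gaussianReal 0 1).prod (stdPi k)).map fun p => (p.1 ^ 2 - 1) + chiDev p.2 := by
  have h := (measurePreserving_piFinSuccAbove (fun _ : Fin (k + 1) => gaussianReal 0 1) 0)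
  rw [← h.map_eq, Measure.map_map (by have := measurable_chiDev (k := k); fun_prop) h.measurable]
  congr 1
  funext x
  simp [chiDev, Fin.sum_univ_succ, MeasurableEquiv.piFinSuccAbove, Fin.insertNthEquiv, Fin.tail]
  ring

lemma integrable_chiDev_pow (k n : ℕ) : Integrable (fun h => chiDev h ^ n) (stdPi k) := by
  induction k generalizing n with
  | zero => simp [chiDev]
  | succ k ih =>
    have : Integrable (fun y : ℝ => y ^ n) ((stdPi (k + 1)).map chiDev) := by
      rw [map_chiDev_succ, integrable_map_measure (by fun_prop)
        (by have := measurable_chiDev (k := k); fun_prop)]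
      simp only [Function.comp_def, add_pow]
      refine integrable_finsetSum _ fun m _ => Integrable.mul_const ?_ _
      exact (integrable_sq_sub_one_pow m).mul_prod (ih (n - m))
    rwa [integrable_map_measure (by fun_prop) measurable_chiDev.aemeasurable] at this

lemma integral_chiDev_pow_succ (k n : ℕ) : ∫ h, chiDev h ^ n ∂stdPi (k + 1) =
    ∑ m ∈ Finset.range (n + 1), (∫ x, (x ^ 2 - 1) ^ m ∂gaussianReal 0 1) *
      (∫ h, chiDev h ^ (n - m) ∂stdPi k) * n.choose m := by
  have h1 : ∫ h, chiDev h ^ n ∂stdPi (k + 1) = ∫ y, y ^ n ∂(stdPi (k + 1)).map chiDev := by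
    rw [integral_map measurable_chiDev.aemeasurable (by fun_prop)]
  rw [h1, map_chiDev_succ, integral_map (by have := measurable_chiDev (k := k); fun_prop)
    (by fun_prop)]
  simp only [add_pow]
  rw [integral_finsetSum]
  · refine Finset.sum_congr rfl fun m _ => ?_
    rw [integral_mul_const, integral_prod_mul (fun x : ℝ => (x ^ 2 - 1) ^ m)
      (fun h => chiDev h ^ (n - m))]
  · intro m _
    exact ((integrable_sq_sub_one_pow m).mul_prod (integrable_chiDev_pow k (n - m))).mul_const _

lemma integral_chiDev (k : ℕ) : ∫ h, chiDev h ∂stdPi k = 0 := by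
  induction k with
  | zero => simp [chiDev]
  | succ k ih =>
    have := integral_chiDev_pow_succ k 1
    simpa [Finset.sum_range_succ, ih, integral_sq_sub_one] using this

lemma integral_chiDev_pow_two (k : ℕ) : ∫ h, chiDev h ^ 2 ∂stdPi k = 2 * k := by
  induction k with
  | zero => simp [chiDev]
  | succ k ih =>
    rw [integral_chiDev_pow_succ]
    simp [Finset.sum_range_succ, ih, integral_sq_sub_one, integral_sq_sub_one_pow_two]
    ring

lemma integral_chiDev_pow_four (k : ℕ) :
    ∫ h, chiDev h ^ 4 ∂stdPi k = 12 * k ^ 2 + 48 * k := by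
  induction k with
  | zero => simp [chiDev]
  | succ k ih =>
    rw [integral_chiDev_pow_succ]
    simp [Finset.sum_range_succ, ih, integral_sq_sub_one, integral_sq_sub_one_pow_two,
      integral_sq_sub_one_pow_four, integral_chiDev, integral_chiDev_pow_two,
      (by decide : Nat.choose 4 2 = 6)]
    ring

/-- The map producing the noise of the pivot recursion from a Gaussian and a Gaussian vector. -/
def noiseMap (N : ℕ) {k : ℕ} (p : ℝ × (Fin k → ℝ)) : ℝ × ℝ :=
  (√(2 / N) * p.1, (∑ i, p.2 i ^ 2) / N)

lemma measurable_noiseMap (N k : ℕ) : Measurable (noiseMap N (k := k)) := by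
  unfold noiseMap; fun_prop

/-- The law of the noise of the pivot recursion. -/
def noiseLaw (N k : ℕ) : Measure (ℝ × ℝ) :=
  ((gaussianReal 0 1).prod (stdPi k)).map (noiseMap N)

lemma isNoise_noiseLaw {N k : ℕ} (hN : 0 < N) (hk : k < N) :
    IsNoise (noiseLaw N k) (1 / N) (k * (1 / N)) := by
  have hN' : (0 : ℝ) < N := by exact_mod_cast hN
  have hkN : (k : ℝ) ≤ N := by exact_mod_cast hk.le
  have hm := measurable_noiseMap N k
  have e1 (p : ℝ × (Fin k → ℝ)) : (noiseMap N p).1 = √(2 / N) * p.1 := rfl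
  have e2 (p : ℝ × (Fin k → ℝ)) : (noiseMap N p).2 - k * (1 / N) = chiDev p.2 / N := by
    simp [noiseMap, chiDev]; ring
  have hs2 : √(2 / N : ℝ) ^ 2 = 2 / N := Real.sq_sqrt (by positivity)
  have hs4 : √(2 / N : ℝ) ^ 4 = (2 / N) ^ 2 := by
    calc √(2 / N : ℝ) ^ 4 = (√(2 / N : ℝ) ^ 2) ^ 2 := by ring
      _ = _ := by rw [hs2]
  have hint (f : ℝ × ℝ → ℝ) (hf : Measurable f) :
      ∫ p, f p ∂noiseLaw N k = ∫ p, f (noiseMap N p) ∂(gaussianReal 0 1).prod (stdPi k) :=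
    integral_map hm.aemeasurable hf.aestronglyMeasurable
  have hI (f : ℝ × ℝ → ℝ) (hf : Measurable f) : Integrable f (noiseLaw N k) ↔
      Integrable (fun p => f (noiseMap N p)) ((gaussianReal 0 1).prod (stdPi k)) :=
    integrable_map_measure hf.aestronglyMeasurable hm.aemeasurable
  have hfst (f : ℝ → ℝ) : ∫ p, f p.1 ∂(gaussianReal 0 1).prod (stdPi k) =
      ∫ x, f x ∂gaussianReal 0 1 := by
    simpa using integral_prod_mul (μ := gaussianReal 0 1) (ν := stdPi k) f (fun _ => (1:ℝ))
  have hsnd (f : (Fin k → ℝ) → ℝ) : ∫ p, f p.2 ∂(gaussianReal 0 1).prod (stdPi k) =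
      ∫ x, f x ∂stdPi k := by
    simpa using integral_prod_mul (μ := gaussianReal 0 1) (ν := stdPi k) (fun _ => (1:ℝ)) f
  refine ⟨Measure.isProbabilityMeasure_map hm.aemeasurable, ?_, ?_, ?_, ?_, ?_, ?_, ?_, ?_, ?_,
    ?_, ?_⟩
  · rw [hI _ (by fun_prop)]
    simp only [e1, mul_pow]
    exact ((integrable_pow_gaussianReal 4).comp_fst _).const_mul _
  · rw [hI _ (by fun_prop)]
    simp only [e2, div_pow]
    exact ((integrable_chiDev_pow k 4).comp_snd _).div_const _
  · rw [hint _ (by fun_prop)]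
    simp only [e1, integral_const_mul]
    rw [hfst (fun x => x), integral_id_gaussianReal, mul_zero]
  · rw [hint _ (by fun_prop)]
    simp only [e2, integral_div]
    rw [hsnd chiDev, integral_chiDev, zero_div]
  · rw [hint _ (by fun_prop)]
    simp only [e1, e2]
    rw [integral_prod_mul (μ := gaussianReal 0 1) (ν := stdPi k) (fun x => √(2 / N) * x)
      (fun h => chiDev h / N), integral_div, integral_chiDev]
    simp
  · rw [hint _ (by fun_prop)]
    simp only [e1, mul_pow, integral_const_mul]
    rw [hfst (fun x => x ^ 2), integral_gaussianReal_pow_two, hs2]; ring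
  · rw [hint _ (by fun_prop)]
    simp only [e2, div_pow, integral_div]
    rw [hsnd (fun h => chiDev h ^ 2), integral_chiDev_pow_two]
    field_simp
  · rw [hint _ (by fun_prop)]
    simp only [e1, mul_pow, integral_const_mul]
    rw [hfst (fun x => x ^ 4), integral_gaussianReal_pow_four, hs4]
    field_simp; norm_num
  · rw [hint _ (by fun_prop)]
    simp only [e2, div_pow, integral_div]
    rw [hsnd (fun h => chiDev h ^ 4), integral_chiDev_pow_four]
    have hk2 : (k : ℝ) ≤ N ^ 2 := hkN.trans (by
      have : (1 : ℝ) ≤ N := by exact_mod_cast hN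
      nlinarith)
    have hk3 : (k : ℝ) ^ 2 ≤ N ^ 2 := by gcongr
    rw [div_le_iff₀ (by positivity)]
    have : 60 * (1 ^ 2 / (N : ℝ) ^ 2) * N ^ 4 = 60 * N ^ 2 := by field_simp
    rw [this]
    linarith
  · refine (ae_map_iff hm.aemeasurable (measurableSet_le measurable_const measurable_snd)).mpr
      (Filter.Eventually.of_forall fun p => ?_)
    unfold noiseMap
    positivity
  · intro f hf
    have hms : MeasurableSet {p : ℝ × ℝ | p.1 ≠ f p.2} :=
      (measurableSet_eq_fun measurable_fst (hf.comp measurable_snd)).compl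
    refine (ae_map_iff hm.aemeasurable hms).mpr ?_
    have hms' : MeasurableSet {p : ℝ × (Fin k → ℝ) | (noiseMap N p).1 ≠ f (noiseMap N p).2} :=
      hm hms
    rw [Measure.ae_prod_iff_ae_ae hms', Measure.ae_ae_comm
      (p := fun (x : ℝ) (h : Fin k → ℝ) => (noiseMap N (x, h)).1 ≠ f (noiseMap N (x, h)).2) hms']
    refine Filter.Eventually.of_forall fun h => ?_
    have := nullSingletonClass_gaussianReal (μ := 0) (v := 1) one_ne_zero
    have hne : √(2 / N : ℝ) ≠ 0 := by positivity
    have : ∀ᵐ x ∂gaussianReal 0 1, x ≠ f ((∑ i, h i ^ 2) / N) / √(2 / N) := by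
      simp [ae_iff]
    filter_upwards [this] with x hx he
    apply hx
    rw [eq_div_iff hne, mul_comm]
    exact he

end chi

section pivots

open Matrix

variable {k : ℕ}

/-- The number of positive squares of the quadratic form of a matrix. -/
def posIndex (A : Matrix (Fin k) (Fin k) ℝ) : ℕ := sigPos A.toQuadraticForm'

lemma toQuadraticForm_apply (A : Matrix (Fin k) (Fin k) ℝ) (x : Fin k → ℝ) :
    A.toQuadraticForm' x = x ⬝ᵥ A *ᵥ x := by
  simp [Matrix.toQuadraticForm', Matrix.toLinearMap₂'_apply']

lemma posIndex_eq_of_sum_sq {A : Matrix (Fin k) (Fin k) ℝ} {w : Fin k → ℝ}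
    (e : (Fin k → ℝ) ≃ₗ[ℝ] (Fin k → ℝ)) (h : ∀ x, x ⬝ᵥ A *ᵥ x = ∑ i, w i * e x i ^ 2) :
    posIndex A = (Finset.univ.filter fun i => 0 < w i).card := by
  have he : QuadraticMap.Equivalent A.toQuadraticForm' (QuadraticMap.weightedSumSquares ℝ w) :=
    ⟨{ toLinearEquiv := e
       map_app' := fun x => by
        change QuadraticMap.weightedSumSquares ℝ w (e x) = _
        rw [toQuadraticForm_apply, h, QuadraticMap.weightedSumSquares_apply]
        simp [pow_two] }⟩
  rw [posIndex, QuadraticForm.sigPos_of_equiv_weightedSumSquares he, Set.ncard_eq_toFinset_card']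
  congr 1
  ext; simp

/-- Rows and columns of a matrix after the first. -/
def trailing (A : Matrix (Fin (k + 1)) (Fin (k + 1)) ℝ) : Matrix (Fin k) (Fin k) ℝ :=
  A.submatrix Fin.succ Fin.succ

/-- The Schur complement of the trailing submatrix. -/
def schur (A : Matrix (Fin (k + 1)) (Fin (k + 1)) ℝ) : ℝ :=
  A 0 0 - (fun i => A 0 i.succ) ⬝ᵥ (trailing A)⁻¹ *ᵥ fun i => A i.succ 0

/-- The number of positive pivots and the last pivot of a matrix, eliminating from the end. -/
def pivotState : ∀ {k : ℕ}, Matrix (Fin k) (Fin k) ℝ → ℕ × ℝ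
  | 0, _ => (0, 1)
  | _ + 1, A => ((pivotState (trailing A)).1 + if 0 < schur A then 1 else 0, schur A)

/-- All pivots of the matrix are nonzero. -/
def IsRegularPivot : ∀ {k : ℕ}, Matrix (Fin k) (Fin k) ℝ → Prop
  | 0, _ => True
  | _ + 1, A => IsRegularPivot (trailing A) ∧ schur A ≠ 0

lemma mulVec_zero_eq (A : Matrix (Fin (k + 1)) (Fin (k + 1)) ℝ) (x : Fin (k + 1) → ℝ) :
    (A *ᵥ x) 0 = A 0 0 * x 0 + (fun i => A 0 i.succ) ⬝ᵥ Fin.tail x := by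
  simp [mulVec, dotProduct, Fin.sum_univ_succ, Fin.tail]

lemma tail_mulVec (A : Matrix (Fin (k + 1)) (Fin (k + 1)) ℝ) (x : Fin (k + 1) → ℝ) :
    Fin.tail (A *ᵥ x) = x 0 • (fun i => A i.succ 0) + trailing A *ᵥ Fin.tail x := by
  funext i
  simp [mulVec, dotProduct, Fin.sum_univ_succ, Fin.tail, trailing, mul_comm]

lemma IsRegularPivot.isUnit_det {A : Matrix (Fin k) (Fin k) ℝ} (h : IsRegularPivot A) :
    IsUnit A.det := by
  induction k with
  | zero => simp
  | succ k ih =>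
    have h1 := ih h.1
    rw [← Matrix.isUnit_iff_isUnit_det, ← Matrix.mulVec_injective_iff_isUnit]
    refine (injective_iff_map_eq_zero A.mulVecLin).mpr fun x hx => ?_
    have hx : A *ᵥ x = 0 := hx
    have t := tail_mulVec A x
    have z := mulVec_zero_eq A x
    rw [hx] at t z
    have t' : Fin.tail x = -(x 0 • ((trailing A)⁻¹ *ᵥ fun i => A i.succ 0)) := by
      have : (trailing A)⁻¹ *ᵥ (x 0 • (fun i => A i.succ 0) + trailing A *ᵥ Fin.tail x) = 0 := by
        rw [← t]; exact mulVec_zero _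
      rw [mulVec_add, mulVec_mulVec, nonsing_inv_mul _ h1, one_mulVec, mulVec_smul] at this
      exact eq_neg_of_add_eq_zero_right this
    have hx0 : x 0 = 0 := by
      rw [t', dotProduct_neg, dotProduct_smul] at z
      have : x 0 * schur A = 0 := by
        rw [schur, mul_sub]
        simp only [Pi.zero_apply, smul_eq_mul] at z
        linarith
      exact (mul_eq_zero.mp this).resolve_right h.2
    funext i
    refine Fin.cases hx0 (fun j => ?_) i
    have := congrFun t' j
    simpa [hx0, Fin.tail] using this

lemma inv_apply_zero_zero {A : Matrix (Fin (k + 1)) (Fin (k + 1)) ℝ} (h : IsRegularPivot A) :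
    A⁻¹ 0 0 = (pivotState A).2⁻¹ := by
  have h1 := h.1.isUnit_det
  set u := (trailing A)⁻¹ *ᵥ fun i => A i.succ 0 with hu
  set x : Fin (k + 1) → ℝ := (schur A)⁻¹ • Fin.cons 1 (-u) with hx
  have ht : Fin.tail x = -((schur A)⁻¹ • u) := by
    funext i; simp [hx, Fin.tail]
  have hx0 : x 0 = (schur A)⁻¹ := by simp [hx]
  have hAu : trailing A *ᵥ u = fun i => A i.succ 0 := by
    rw [hu, mulVec_mulVec, mul_nonsing_inv _ h1, one_mulVec]
  clear_value x
  have hAx : A *ᵥ x = Pi.single 0 1 := by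
    have z := mulVec_zero_eq A x
    have t := tail_mulVec A x
    rw [ht, hx0, mulVec_neg, mulVec_smul, hAu, add_neg_cancel] at t
    rw [ht, hx0, dotProduct_neg, dotProduct_smul] at z
    funext i
    refine Fin.cases ?_ (fun j => ?_) i
    · rw [z, Pi.single_eq_same, smul_eq_mul]
      have := inv_mul_cancel₀ h.2
      rw [schur, mul_sub] at this
      rw [schur]
      linarith
    · have := congrFun t j
      simpa [Fin.tail] using this
  have : A⁻¹ *ᵥ (A *ᵥ x) = x := by
    rw [mulVec_mulVec, nonsing_inv_mul _ h.isUnit_det, one_mulVec]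
  rw [hAx, mulVec_single_one] at this
  have := congrFun this 0
  rw [hx0] at this
  exact this

lemma exists_sum_sq_of_isRegularPivot {A : Matrix (Fin k) (Fin k) ℝ} (h : IsRegularPivot A)
    (hA : A.IsSymm) : ∃ w : Fin k → ℝ, (Finset.univ.filter fun i => 0 < w i).card =
      (pivotState A).1 ∧ ∃ e : (Fin k → ℝ) ≃ₗ[ℝ] (Fin k → ℝ),
        ∀ x, x ⬝ᵥ A *ᵥ x = ∑ i, w i * e x i ^ 2 := by
  induction k with
  | zero => exact ⟨0, by simp [pivotState], LinearEquiv.refl _ _, fun x => by simp [dotProduct]⟩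
  | succ k ih =>
    have h1 := h.1.isUnit_det
    have hs : (trailing A).IsSymm := hA.submatrix _
    obtain ⟨w, hw, e, he⟩ := ih h.1 hs
    have hrow : (fun i : Fin k => A 0 i.succ) = fun i => A i.succ 0 := by
      funext i; exact hA.apply _ _
    set c : Fin k → ℝ := fun i => A i.succ 0 with hc
    set u := (trailing A)⁻¹ *ᵥ c with hu
    have hAu : trailing A *ᵥ u = c := by
      rw [hu, mulVec_mulVec, mul_nonsing_inv _ h1, one_mulVec]
    let f : (Fin (k + 1) → ℝ) →ₗ[ℝ] (Fin (k + 1) → ℝ) :=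
      { toFun := fun x => Fin.cons (x 0) (e (Fin.tail x + x 0 • u))
        map_add' := fun x y => by
          funext i
          refine Fin.cases (by simp) (fun j => ?_) i
          have : Fin.tail (x + y) = Fin.tail x + Fin.tail y := rfl
          simp only [Fin.cons_succ, Pi.add_apply, this, add_smul]
          rw [← Pi.add_apply (e _), ← map_add]
          exact congrFun (congrArg e (by module)) j
        map_smul' := fun a x => by
          funext i
          refine Fin.cases (by simp) (fun j => ?_) i
          have : Fin.tail (a • x) = a • Fin.tail x := rfl
          simp only [Fin.cons_succ, Pi.smul_apply, this, smul_eq_mul, mul_smul, ← smul_add,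
            map_smul, RingHom.id_apply] }
    have hf (x) : f x = Fin.cons (x 0) (e (Fin.tail x + x 0 • u)) := rfl
    have hinj : Function.Injective f := by
      refine (injective_iff_map_eq_zero f).mpr fun x hx => ?_
      rw [hf] at hx
      have hx0 : x 0 = 0 := by simpa using congrFun hx 0
      have hx1 : e (Fin.tail x + x 0 • u) = 0 := by
        funext j; simpa using congrFun hx j.succ
      rw [hx0, zero_smul, add_zero, LinearEquiv.map_eq_zero_iff] at hx1
      funext i
      exact Fin.cases hx0 (fun j => congrFun hx1 j) i
    refine ⟨Fin.cons (schur A) w, ?_, LinearEquiv.ofInjectiveEndo f hinj, fun x => ?_⟩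
    · rw [pivotState, ← hw, Finset.card_filter, Finset.card_filter, Fin.sum_univ_succ]
      simp [add_comm]
    · rw [LinearEquiv.coe_ofInjectiveEndo, hf, Fin.sum_univ_succ]
      simp only [Fin.cons_zero, Fin.cons_succ]
      rw [← he]
      have e0 : x ⬝ᵥ A *ᵥ x = x 0 * (A *ᵥ x) 0 + Fin.tail x ⬝ᵥ Fin.tail (A *ᵥ x) := by
        simp [dotProduct, Fin.sum_univ_succ, Fin.tail]
      rw [e0, mulVec_zero_eq, tail_mulVec, schur, hrow, mulVec_add, mulVec_smul, hAu, ← hc, ← hu]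
      simp only [dotProduct_add, add_dotProduct, smul_dotProduct, dotProduct_smul, smul_eq_mul]
      have s1 : u ⬝ᵥ trailing A *ᵥ Fin.tail x = c ⬝ᵥ Fin.tail x := by
        rw [dotProduct_mulVec, ← mulVec_transpose, hs.eq, hAu]
      rw [s1, dotProduct_comm (Fin.tail x) c, dotProduct_comm u c]
      ring

lemma posIndex_eq_pivotState {A : Matrix (Fin k) (Fin k) ℝ} (h : IsRegularPivot A)
    (hA : A.IsSymm) : posIndex A = (pivotState A).1 := by
  obtain ⟨w, hw, e, he⟩ := exists_sum_sq_of_isRegularPivot h hA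
  rw [posIndex_eq_of_sum_sq e he, hw]

lemma posIndex_conj {O : Matrix (Fin k) (Fin k) ℝ} (hO : Oᵀ * O = 1)
    (A : Matrix (Fin k) (Fin k) ℝ) : posIndex (O * A * Oᵀ) = posIndex A := by
  have hO' : O * Oᵀ = 1 := mul_eq_one_comm.mp hO
  have he : QuadraticMap.Equivalent (O * A * Oᵀ).toQuadraticForm' A.toQuadraticForm' :=
    ⟨{ toLinearEquiv := LinearEquiv.ofInjectiveEndo Oᵀ.mulVecLin fun x y hxy => by
        have : O *ᵥ (Oᵀ *ᵥ x) = O *ᵥ (Oᵀ *ᵥ y) := congrArg _ hxy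
        simpa [mulVec_mulVec, hO'] using this
       map_app' := fun x => by
        change A.toQuadraticForm' (Oᵀ *ᵥ x) = _
        rw [toQuadraticForm_apply, toQuadraticForm_apply, ← mulVec_mulVec, ← mulVec_mulVec,
          dotProduct_mulVec x O, ← mulVec_transpose] }⟩
  exact he.sigPos_eq

lemma posIndex_sub_eq_card_eigenvalues {A : Matrix (Fin k) (Fin k) ℝ} (hA : A.IsHermitian)
    (c : ℝ) : posIndex (A - c • 1) = (Finset.univ.filter fun i => c < hA.eigenvalues i).card := by
  set U : Matrix (Fin k) (Fin k) ℝ :=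
    (hA.eigenvectorUnitary : Matrix (Fin k) (Fin k) ℝ) with hU
  have h1 : Uᵀ * U = 1 := Unitary.coe_star_mul_self hA.eigenvectorUnitary
  have h1' : U * Uᵀ = 1 := mul_eq_one_comm.mp h1
  have h2 : A = U * diagonal hA.eigenvalues * Uᵀ := by
    have := hA.spectral_theorem
    rw [Unitary.conjStarAlgAut_apply] at this
    exact this
  have h3 : A - c • 1 = U * diagonal (fun i => hA.eigenvalues i - c) * Uᵀ := by
    have : diagonal (fun i => hA.eigenvalues i - c) = diagonal hA.eigenvalues - c • 1 := by
      rw [smul_one_eq_diagonal, diagonal_sub]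
    rw [this, mul_sub, sub_mul, ← h2]
    simp [h1']
  rw [h3, posIndex_conj h1, posIndex_eq_of_sum_sq (LinearEquiv.refl ℝ _)
    (w := fun i => hA.eigenvalues i - c)]
  · simp
  · intro x
    simp only [dotProduct, mulVec_diagonal, LinearEquiv.refl_apply]
    exact Finset.sum_congr rfl fun i _ => by ring

lemma card_le_eigenvalues_eq_posIndex {A : Matrix (Fin k) (Fin k) ℝ} (hA : A.IsHermitian)
    {c : ℝ} (h : IsUnit (A - c • 1).det) :
    (Finset.univ.filter fun i => c ≤ hA.eigenvalues i).card = posIndex (A - c • 1) := by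
  rw [posIndex_sub_eq_card_eigenvalues hA]
  congr 1
  ext i
  simp only [Finset.mem_filter, Finset.mem_univ, true_and]
  refine ⟨fun hi => lt_of_le_of_ne hi fun he => ?_, le_of_lt⟩
  have hv := hA.mulVec_eigenvectorBasis i
  have hz : (A - c • 1) *ᵥ (hA.eigenvectorBasis i).ofLp = 0 := by
    rw [sub_mulVec, hv, smul_mulVec, one_mulVec, he, sub_self]
  have hinj := Matrix.mulVec_injective_iff_isUnit.mpr ((Matrix.isUnit_iff_isUnit_det _).mpr h)
  have h0 : (hA.eigenvectorBasis i).ofLp = 0 := hinj (by rw [hz, mulVec_zero])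
  have hn := hA.eigenvectorBasis.orthonormal.1 i
  have : hA.eigenvectorBasis i = 0 := by
    ext j; exact congrFun h0 j
  rw [this, norm_zero] at hn
  exact zero_ne_one hn

/-- A reflection mapping the first basis vector to the direction of a given vector. -/
lemma exists_orthogonal_mulVec_single (h : Fin (k + 1) → ℝ) :
    ∃ O : Matrix (Fin (k + 1)) (Fin (k + 1)) ℝ, Oᵀ * O = 1 ∧
      O *ᵥ Pi.single 0 (√(h ⬝ᵥ h)) = h := by
  set r := √(h ⬝ᵥ h)
  have hr : r * r = h ⬝ᵥ h := Real.mul_self_sqrt (by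
    simpa using dotProduct_self_star_nonneg h)
  set z : Fin (k + 1) → ℝ := Pi.single 0 r with hz
  set v := h - z with hv
  have hzz : z ⬝ᵥ z = r * r := by simp [hz]
  have hvz : 2 * (v ⬝ᵥ z) = -(v ⬝ᵥ v) := by
    simp only [hv, sub_dotProduct, dotProduct_sub, hzz, ← hr, dotProduct_comm z h]
    ring
  by_cases h0 : v ⬝ᵥ v = 0
  · refine ⟨1, by simp, ?_⟩
    rw [one_mulVec]
    exact (sub_eq_zero.mp (dotProduct_self_eq_zero.mp h0)).symm
  · refine ⟨1 - (2 / (v ⬝ᵥ v)) • vecMulVec v v, ?_, ?_⟩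
    · rw [transpose_sub, transpose_one, transpose_smul, transpose_vecMulVec, sub_mul, mul_sub,
        mul_sub, smul_mul_smul_comm, vecMulVec_mul_vecMulVec, one_mul, mul_one, one_mul]
      clear_value v
      ext i j
      simp [vecMulVec_apply]
      field_simp
      ring_nf
    · rw [sub_mulVec, one_mulVec, smul_mulVec, vecMulVec_mulVec]
      have : v ⬝ᵥ z = -(v ⬝ᵥ v) / 2 := by linarith
      rw [this]
      have hi : h = z + v := by rw [hv]; abel
      rw [hi]
      clear_value v
      funext i
      simp
      field_simp

end pivots

section gaussianMatrix

open Matrix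

variable {k N : ℕ}

/-- The law of a square array of independent standard Gaussians. -/
abbrev stdPiPi (k : ℕ) : Measure (Fin k → Fin k → ℝ) := Measure.pi fun _ => stdPi k

/-- The symmetrized Gaussian array, with the normalization of dimension `N`. -/
def goeMat (N : ℕ) {k : ℕ} (g : Fin k → Fin k → ℝ) : Matrix (Fin k) (Fin k) ℝ :=
  fun i j => (g i j + g j i) / √(2 * N)

lemma measurePreserving_transpose (k : ℕ) :
    MeasurePreserving (fun (g : Fin k → Fin k → ℝ) i j => g j i) (stdPiPi k) (stdPiPi k) := by
  have hc : MeasurePreserving (MeasurableEquiv.curry (Fin k) (Fin k) ℝ)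
      (Measure.pi fun _ => gaussianReal 0 1) (stdPiPi k) := by
    refine ⟨MeasurableEquiv.measurable _, ?_⟩
    have := Measure.infinitePi_map_curry (fun (_ _ : Fin k) => gaussianReal 0 1)
    simpa only [Measure.infinitePi_eq_pi] using this
  have hs := measurePreserving_piCongrLeft
    (fun _ : Fin k × Fin k => gaussianReal 0 1) (Equiv.prodComm (Fin k) (Fin k))
  have h := (hc.comp hs).comp hc.symm
  convert h using 1
  funext g i j
  change _ = MeasurableEquiv.piCongrLeft (fun _ => ℝ) (Equiv.prodComm (Fin k) (Fin k))
    ((MeasurableEquiv.curry (Fin k) (Fin k) ℝ).symm g) (Equiv.prodComm (Fin k) (Fin k) (j, i))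
  rw [MeasurableEquiv.coe_piCongrLeft, Equiv.piCongrLeft_apply_apply]
  rfl

lemma measurePreserving_mulVec {O : Matrix (Fin k) (Fin k) ℝ} (hO : Oᵀ * O = 1) :
    MeasurePreserving (fun x => O *ᵥ x) (stdPi k) (stdPi k) := by
  let f : EuclideanSpace ℝ (Fin k) →ₗᵢ[ℝ] EuclideanSpace ℝ (Fin k) :=
    { toLinearMap := Matrix.toEuclideanLin O
      norm_map' := fun x => by
        rw [← sq_eq_sq₀ (norm_nonneg _) (norm_nonneg _), EuclideanSpace.real_norm_sq_eq,
          EuclideanSpace.real_norm_sq_eq]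
        have h1 : (O *ᵥ x.ofLp) ⬝ᵥ (O *ᵥ x.ofLp) = x.ofLp ⬝ᵥ x.ofLp := by
          rw [Matrix.dotProduct_mulVec, ← Matrix.mulVec_transpose, Matrix.mulVec_mulVec, hO,
            Matrix.one_mulVec]
        simpa [dotProduct, pow_two, Matrix.toLpLin_apply] using h1 }
  let e := f.toLinearIsometryEquiv rfl
  have h0 : MeasurePreserving (WithLp.toLp 2) (stdPi k) (stdGaussian (EuclideanSpace ℝ (Fin k))) :=
    ⟨by fun_prop, map_pi_eq_stdGaussian⟩
  have h1 : MeasurePreserving e (stdGaussian (EuclideanSpace ℝ (Fin k)))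
      (stdGaussian (EuclideanSpace ℝ (Fin k))) := ⟨by fun_prop, stdGaussian_map e⟩
  have h2 : MeasurePreserving (WithLp.ofLp : EuclideanSpace ℝ (Fin k) → Fin k → ℝ)
      (stdGaussian (EuclideanSpace ℝ (Fin k))) (stdPi k) := by
    refine ⟨by fun_prop, ?_⟩
    rw [← map_pi_eq_stdGaussian, Measure.map_map (by fun_prop) (by fun_prop)]
    exact Measure.map_id
  exact (h2.comp h1).comp h0

/-- Conjugation of a square array by a matrix. -/
def conjArray (O : Matrix (Fin k) (Fin k) ℝ) (g : Fin k → Fin k → ℝ) : Fin k → Fin k → ℝ :=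
  Matrix.of.symm (O * Matrix.of g * Oᵀ)

lemma measurePreserving_conjArray {O : Matrix (Fin k) (Fin k) ℝ} (hO : Oᵀ * O = 1) :
    MeasurePreserving (conjArray O) (stdPiPi k) (stdPiPi k) := by
  have hR : MeasurePreserving (fun (g : Fin k → Fin k → ℝ) i => O *ᵥ g i)
      (stdPiPi k) (stdPiPi k) := measurePreserving_pi _ _ fun _ => measurePreserving_mulVec hO
  have hT := measurePreserving_transpose k
  have h := ((hT.comp hR).comp hT).comp hR
  convert h using 1
  funext g i j
  change (O * Matrix.of g * Oᵀ) i j = ∑ a, O i a * ∑ b, O j b * g a b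
  simp only [Matrix.mul_apply, Matrix.transpose_apply, Matrix.of_apply, Finset.mul_sum,
    Finset.sum_mul]
  rw [Finset.sum_comm]
  exact Finset.sum_congr rfl fun _ _ => Finset.sum_congr rfl fun _ _ => by ring

lemma goeMat_eq (N : ℕ) (g : Fin k → Fin k → ℝ) :
    goeMat N g = (√(2 * N))⁻¹ • (Matrix.of g + (Matrix.of g)ᵀ) := by
  ext i j
  simp only [goeMat, Matrix.smul_apply, Matrix.add_apply, Matrix.of_apply, Matrix.transpose_apply,
    smul_eq_mul]
  ring

lemma goeMat_conjArray (N : ℕ) {O : Matrix (Fin k) (Fin k) ℝ} (hO : Oᵀ * O = 1) (c : ℝ)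
    (g : Fin k → Fin k → ℝ) :
    goeMat N (conjArray O g) - c • 1 = O * (goeMat N g - c • 1) * Oᵀ := by
  have hO' : O * Oᵀ = 1 := mul_eq_one_comm.mp hO
  rw [goeMat_eq, goeMat_eq, conjArray, Equiv.apply_symm_apply, Matrix.transpose_mul,
    Matrix.transpose_mul, Matrix.transpose_transpose, mul_sub, sub_mul, Matrix.mul_smul,
    Matrix.smul_mul, Matrix.mul_smul, Matrix.smul_mul, mul_one, hO', mul_add, add_mul,
    mul_assoc O (Matrix.of g)ᵀ]

/-- Splitting off the first row and column of an array. -/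
def splitMap (k : ℕ) (g : Fin (k + 1) → Fin (k + 1) → ℝ) :
    (ℝ × (Fin k → ℝ)) × (Fin k → Fin k → ℝ) :=
  ((g 0 0, fun i => (g 0 i.succ + g i.succ 0) / √2), fun i j => g i.succ j.succ)

lemma measurePreserving_add_div_sqrt_two :
    MeasurePreserving (fun p : ℝ × ℝ => (p.1 + p.2) / √2)
      ((gaussianReal 0 1).prod (gaussianReal 0 1)) (gaussianReal 0 1) := by
  refine ⟨by fun_prop, ?_⟩
  have h := gaussianReal_conv_gaussianReal (m₁ := 0) (m₂ := 0) (v₁ := 1) (v₂ := 1)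
  have h2 := gaussianReal_map_div_const (μ := 0) (v := 1 + 1) (√2)
  rw [add_zero] at h
  rw [← h, Measure.conv, Measure.map_map (by fun_prop) (by fun_prop)] at h2
  refine h2.trans ?_
  congr 1
  · simp
  · ext; simp

lemma measurePreserving_splitMap (k : ℕ) : MeasurePreserving (splitMap k) (stdPiPi (k + 1))
    (((gaussianReal 0 1).prod (stdPi k)).prod (stdPiPi k)) := by
  have h1 := measurePreserving_piFinSuccAbove (fun _ : Fin (k + 1) => stdPi (k + 1)) 0
  have h2 := measurePreserving_piFinSuccAbove (fun _ : Fin (k + 1) => gaussianReal 0 1) 0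
  have h3 : MeasurePreserving _ (Measure.pi fun _ : Fin k => stdPi (k + 1))
      (Measure.pi fun _ : Fin k => (gaussianReal 0 1).prod (stdPi k)) :=
    measurePreserving_pi _ _ fun _ => h2
  have h4 := (measurePreserving_arrowProdEquivProdArrow ℝ (Fin k → ℝ) (Fin k)
    (fun _ => gaussianReal 0 1) (fun _ => stdPi k)).comp h3
  have h5 := (h2.prod h4).comp h1
  have h6 : MeasurePreserving (fun q : (Fin k → ℝ) × (Fin k → ℝ) => fun i => (q.1 i + q.2 i) / √2)
      ((stdPi k).prod (stdPi k)) (stdPi k) := by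
    have ha := (measurePreserving_arrowProdEquivProdArrow ℝ ℝ (Fin k)
      (fun _ => gaussianReal 0 1) (fun _ => gaussianReal 0 1)).symm
    have hb : MeasurePreserving _ (Measure.pi fun _ : Fin k => (gaussianReal 0 1).prod
      (gaussianReal 0 1)) (stdPi k) :=
      measurePreserving_pi _ _ fun _ => measurePreserving_add_div_sqrt_two
    exact hb.comp ha
  have h7 : MeasurePreserving (fun q : (ℝ × (Fin k → ℝ)) × ((Fin k → ℝ) × (Fin k → Fin k → ℝ)) =>
      ((q.1.1, fun i => (q.1.2 i + q.2.1 i) / √2), q.2.2))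
      (((gaussianReal 0 1).prod (stdPi k)).prod ((stdPi k).prod (stdPiPi k)))
      (((gaussianReal 0 1).prod (stdPi k)).prod (stdPiPi k)) := by
    have ha := (measurePreserving_prodAssoc ((gaussianReal 0 1).prod (stdPi k)) (stdPi k)
      (stdPiPi k)).symm
    have hb := measurePreserving_prodAssoc (gaussianReal 0 1) (stdPi k) (stdPi k)
    have hc := ((MeasurePreserving.id (gaussianReal 0 1)).prod h6).comp hb
    exact (hc.prod (MeasurePreserving.id (stdPiPi k))).comp ha
  have h := h7.comp h5
  convert h using 1
  funext g
  simp [splitMap, MeasurableEquiv.piFinSuccAbove, Fin.insertNthEquiv, Fin.tail,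
    MeasurableEquiv.arrowProdEquivProdArrow, Equiv.arrowProdEquivProdArrow]
  rfl

end gaussianMatrix

section measurability

open Matrix

variable {α : Type*} [MeasurableSpace α]

lemma measurable_matrix_det {k : ℕ} {M : α → Matrix (Fin k) (Fin k) ℝ}
    (hM : ∀ i j, Measurable fun x => M x i j) : Measurable fun x => (M x).det := by
  simp only [Matrix.det_apply']
  exact Finset.measurable_sum _ fun σ _ =>
    (Finset.measurable_prod _ fun i _ => hM _ _).const_mul _

lemma measurable_matrix_inv {k : ℕ} {M : α → Matrix (Fin k) (Fin k) ℝ}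
    (hM : ∀ i j, Measurable fun x => M x i j) (i j : Fin k) :
    Measurable fun x => (M x)⁻¹ i j := by
  simp only [Matrix.inv_def, Ring.inverse_eq_inv', Matrix.smul_apply, Matrix.adjugate_apply,
    smul_eq_mul]
  refine (measurable_matrix_det hM).inv.mul (measurable_matrix_det fun a b => ?_)
  by_cases h : a = j
  · subst h; simp
  · simpa [Matrix.updateRow_ne h] using hM a b

lemma measurable_dotProduct_inv_mulVec {k : ℕ} {M : α → Matrix (Fin k) (Fin k) ℝ}
    (hM : ∀ i j, Measurable fun x => M x i j) {u v : α → Fin k → ℝ} (hu : Measurable u)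
    (hv : Measurable v) : Measurable fun x => u x ⬝ᵥ (M x)⁻¹ *ᵥ v x := by
  simp only [dotProduct, mulVec]
  refine Finset.measurable_sum _ fun i _ => ((measurable_pi_apply i).comp hu).mul
    (Finset.measurable_sum _ fun j _ =>
      (measurable_matrix_inv hM i j).mul ((measurable_pi_apply j).comp hv))

lemma measurable_schur {k : ℕ} {M : α → Matrix (Fin (k + 1)) (Fin (k + 1)) ℝ}
    (hM : ∀ i j, Measurable fun x => M x i j) : Measurable fun x => schur (M x) :=
  (hM 0 0).sub (measurable_dotProduct_inv_mulVec (fun i j => hM i.succ j.succ)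
    (measurable_pi_lambda _ fun i => hM 0 i.succ) (measurable_pi_lambda _ fun i => hM i.succ 0))

lemma measurable_pivotState {k : ℕ} {M : α → Matrix (Fin k) (Fin k) ℝ}
    (hM : ∀ i j, Measurable fun x => M x i j) : Measurable fun x => pivotState (M x) := by
  induction k with
  | zero => exact measurable_const
  | succ k ih =>
    have h1 := ih (M := fun x => trailing (M x)) fun i j => hM i.succ j.succ
    have h2 := measurable_schur hM
    exact (h1.fst.add (Measurable.ite (measurableSet_lt measurable_const h2) measurable_const
      measurable_const)).prodMk h2

lemma measurableSet_isRegularPivot {k : ℕ} {M : α → Matrix (Fin k) (Fin k) ℝ}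
    (hM : ∀ i j, Measurable fun x => M x i j) : MeasurableSet {x | IsRegularPivot (M x)} := by
  induction k with
  | zero => exact MeasurableSet.univ
  | succ k ih =>
    exact (ih (M := fun x => trailing (M x)) fun i j => hM i.succ j.succ).inter
      (measurable_schur hM (measurableSet_singleton 0).compl)

end measurability

section pivotLaw

open Matrix

variable {N k : ℕ} {c : ℝ}

/-- The symmetrized Gaussian array shifted by the level `c`. -/
def shifted (N : ℕ) (c : ℝ) {k : ℕ} (g : Fin k → Fin k → ℝ) : Matrix (Fin k) (Fin k) ℝ :=
  goeMat N g - c • 1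

lemma measurable_shifted (N : ℕ) (c : ℝ) (i j : Fin k) :
    Measurable fun g : Fin k → Fin k → ℝ => shifted N c g i j := by
  simp only [shifted, goeMat, Matrix.sub_apply]
  fun_prop

lemma isSymm_shifted (N : ℕ) (c : ℝ) (g : Fin k → Fin k → ℝ) : (shifted N c g).IsSymm := by
  ext i j
  simp [shifted, goeMat, Matrix.one_apply, eq_comm, add_comm]

lemma trailing_shifted (N : ℕ) (c : ℝ) (g : Fin (k + 1) → Fin (k + 1) → ℝ) :
    trailing (shifted N c g) = shifted N c (splitMap k g).2 := by
  ext i j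
  simp [trailing, shifted, goeMat, splitMap, Matrix.one_apply]

/-- The pivot obtained from the diagonal entry and a value of the quadratic form. -/
def pivotStep (N : ℕ) (c : ℝ) (a : ℝ) (p : ℕ × ℝ) : ℕ × ℝ :=
  (p.1 + if 0 < √(2 / N) * a - c - p.2 / N then 1 else 0, √(2 / N) * a - c - p.2 / N)

lemma measurable_pivotStep (N : ℕ) (c : ℝ) :
    Measurable fun q : ℝ × (ℕ × ℝ) => pivotStep N c q.1 q.2 := by
  have h : Measurable fun q : ℝ × (ℕ × ℝ) => √(2 / N) * q.1 - c - q.2.2 / N := by fun_prop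
  exact (measurable_snd.fst.add (Measurable.ite (measurableSet_lt measurable_const h)
    measurable_const measurable_const)).prodMk h

lemma schur_shifted (hN : 0 < N) (c : ℝ) (g : Fin (k + 1) → Fin (k + 1) → ℝ) :
    schur (shifted N c g) = √(2 / N) * (splitMap k g).1.1 - c -
      ((splitMap k g).1.2 ⬝ᵥ (shifted N c (splitMap k g).2)⁻¹ *ᵥ (splitMap k g).1.2) / N := by
  have hN' : (0:ℝ) < N := by exact_mod_cast hN
  have hs : 0 < √(N:ℝ) := Real.sqrt_pos.mpr hN'
  have h2 : 0 < √(2:ℝ) := by positivity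
  have hss : √(N:ℝ) * √(N:ℝ) = N := Real.mul_self_sqrt hN'.le
  have h22 : √(2:ℝ) * √(2:ℝ) = 2 := Real.mul_self_sqrt (by norm_num)
  have e1 : (fun i : Fin k => shifted N c g 0 i.succ) = (√(N:ℝ))⁻¹ • (splitMap k g).1.2 := by
    funext i
    simp [shifted, goeMat, splitMap, (Fin.succ_ne_zero i).symm]
    field_simp
  have e2 : (fun i : Fin k => shifted N c g i.succ 0) = (√(N:ℝ))⁻¹ • (splitMap k g).1.2 := by
    rw [← e1]
    funext i
    exact (isSymm_shifted N c g).apply _ _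
  rw [schur, trailing_shifted, e1, e2, Matrix.mulVec_smul, dotProduct_smul, smul_dotProduct,
    smul_eq_mul, smul_eq_mul]
  have e3 : shifted N c g 0 0 = √(2 / N) * (splitMap k g).1.1 - c := by
    simp [shifted, goeMat, splitMap]
    field_simp
    linear_combination (-g 0 0) * h22
  rw [e3]
  have e4 : (√(N:ℝ))⁻¹ * (√(N:ℝ))⁻¹ = (N:ℝ)⁻¹ := by rw [← mul_inv, hss]
  rw [← mul_assoc, e4]
  ring

lemma pivotState_shifted (hN : 0 < N) (c : ℝ) (g : Fin (k + 1) → Fin (k + 1) → ℝ) :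
    pivotState (shifted N c g) = pivotStep N c (splitMap k g).1.1
      ((pivotState (shifted N c (splitMap k g).2)).1,
        (splitMap k g).1.2 ⬝ᵥ (shifted N c (splitMap k g).2)⁻¹ *ᵥ (splitMap k g).1.2) := by
  simp only [pivotState, pivotStep]
  rw [trailing_shifted, schur_shifted hN]

lemma chainStep_noiseMap (N : ℕ) (c : ℝ) (s : ℕ × ℝ) (p : ℝ × (Fin k → ℝ)) :
    chainStep c s (noiseMap N p) = pivotStep N c p.1 (s.1, p.2 ⬝ᵥ p.2 / s.2) := by
  have e : (∑ i, p.2 i ^ 2) / N / s.2 = p.2 ⬝ᵥ p.2 / s.2 / N := by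
    simp only [dotProduct, pow_two]
    exact div_right_comm _ _ _
  simp only [chainStep, noiseMap, pivotStep, e]

lemma ae_isRegularPivot (hN : 0 < N) (c : ℝ) (k : ℕ) :
    ∀ᵐ g ∂stdPiPi k, IsRegularPivot (shifted N c g) := by
  have hN' : (0:ℝ) < N := by exact_mod_cast hN
  induction k with
  | zero => exact Filter.Eventually.of_forall fun _ => trivial
  | succ k ih =>
    let σ : (ℝ × (Fin k → ℝ)) × (Fin k → Fin k → ℝ) → ℝ := fun q => √(2 / N) * q.1.1 - c -
      (q.1.2 ⬝ᵥ (shifted N c q.2)⁻¹ *ᵥ q.1.2) / N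
    have hm (i j : Fin k) : Measurable fun q : (ℝ × (Fin k → ℝ)) × (Fin k → Fin k → ℝ) =>
      shifted N c q.2 i j := (measurable_shifted N c i j).comp measurable_snd
    have hσ : Measurable σ := by
      have := measurable_dotProduct_inv_mulVec hm measurable_fst.snd measurable_fst.snd
      exact ((measurable_fst.fst.const_mul _).sub_const c).sub (this.div_const _)
    have hms : MeasurableSet {q | IsRegularPivot (shifted N c q.2) ∧ σ q ≠ 0} :=
      (measurableSet_isRegularPivot hm).inter (hσ (measurableSet_singleton 0).compl)
    have hq : ∀ᵐ q ∂((gaussianReal 0 1).prod (stdPi k)).prod (stdPiPi k),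
        IsRegularPivot (shifted N c q.2) ∧ σ q ≠ 0 := by
      refine Filter.Eventually.and ?_ ?_
      · exact Measure.quasiMeasurePreserving_snd.ae ih
      · have hne : MeasurableSet {q | σ q ≠ 0} := hσ (measurableSet_singleton 0).compl
        refine (Measure.ae_prod_iff_ae_ae hne).mpr ((Measure.ae_ae_comm
          (p := fun p g => σ (p, g) ≠ 0) hne).mpr (Filter.Eventually.of_forall fun g => ?_))
        have hne' : MeasurableSet {p | σ (p, g) ≠ 0} := measurable_prodMk_right hne
        refine (Measure.ae_prod_iff_ae_ae hne').mpr ((Measure.ae_ae_comm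
          (p := fun a y => σ ((a, y), g) ≠ 0) hne').mpr (Filter.Eventually.of_forall fun y => ?_))
        have hs : √(2 / (N:ℝ)) ≠ 0 := by positivity
        have : NullSingletonClass (gaussianReal 0 1) := nullSingletonClass_gaussianReal one_ne_zero
        filter_upwards [(Set.countable_singleton
          ((c + y ⬝ᵥ (shifted N c g)⁻¹ *ᵥ y / N) / √(2 / N))).ae_notMem (gaussianReal 0 1)] with a ha
        contrapose! ha
        rw [Set.mem_singleton_iff, eq_div_iff hs]
        have : √(2 / N) * a - c - (y ⬝ᵥ (shifted N c g)⁻¹ *ᵥ y) / N = 0 := ha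
        linarith only [this]
    filter_upwards [(measurePreserving_splitMap k).quasiMeasurePreserving.ae hq] with g hg
    refine ⟨?_, ?_⟩
    · rw [trailing_shifted]; exact hg.1
    · rw [schur_shifted hN]; exact hg.2

lemma lintegral_pivotState_rotation (hN : 0 < N) (c : ℝ) {F : ℕ × ℝ → ENNReal} (hF : Measurable F)
    (y : Fin k → ℝ) :
    ∫⁻ g, F ((pivotState (shifted N c g)).1, y ⬝ᵥ (shifted N c g)⁻¹ *ᵥ y) ∂stdPiPi k =
      ∫⁻ g, F ((pivotState (shifted N c g)).1, y ⬝ᵥ y / (pivotState (shifted N c g)).2)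
        ∂stdPiPi k := by
  cases k with
  | zero => simp [dotProduct]
  | succ k =>
    obtain ⟨O, hO, hy⟩ := exists_orthogonal_mulVec_single y
    have hO' : O * Oᵀ = 1 := mul_eq_one_comm.mp hO
    have hmp := measurePreserving_conjArray hO
    have hF' : Measurable fun g : Fin (k + 1) → Fin (k + 1) → ℝ =>
        F ((pivotState (shifted N c g)).1, y ⬝ᵥ (shifted N c g)⁻¹ *ᵥ y) :=
      hF.comp ((measurable_pivotState (measurable_shifted N c)).fst.prodMk
        (measurable_dotProduct_inv_mulVec (measurable_shifted N c) measurable_const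
          measurable_const))
    rw [← hmp.lintegral_comp hF']
    have hr := ae_isRegularPivot hN c (k + 1)
    refine lintegral_congr_ae ?_
    filter_upwards [hr, hmp.quasiMeasurePreserving.ae hr] with g h1 h2
    have e : shifted N c (conjArray O g) = O * shifted N c g * Oᵀ := goeMat_conjArray N hO c g
    have e1 : (pivotState (shifted N c (conjArray O g))).1 = (pivotState (shifted N c g)).1 := by
      rw [← posIndex_eq_pivotState h2 (isSymm_shifted _ _ _),
        ← posIndex_eq_pivotState h1 (isSymm_shifted _ _ _), e, posIndex_conj hO]
    have e2 : (O * shifted N c g * Oᵀ)⁻¹ = O * (shifted N c g)⁻¹ * Oᵀ := by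
      rw [Matrix.mul_inv_rev, Matrix.mul_inv_rev, Matrix.inv_eq_left_inv hO,
        Matrix.inv_eq_left_inv hO', mul_assoc]
    have e3 : Oᵀ *ᵥ y = Pi.single 0 (√(y ⬝ᵥ y)) := by
      conv_lhs => rw [← hy]
      rw [Matrix.mulVec_mulVec, hO, Matrix.one_mulVec]
    have e4 : y ⬝ᵥ (shifted N c (conjArray O g))⁻¹ *ᵥ y =
        y ⬝ᵥ y / (pivotState (shifted N c g)).2 := by
      rw [e, e2, ← Matrix.mulVec_mulVec, ← Matrix.mulVec_mulVec, Matrix.dotProduct_mulVec,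
        ← Matrix.mulVec_transpose, e3, single_dotProduct, Matrix.mulVec_single]
      have hyy : √(y ⬝ᵥ y) * √(y ⬝ᵥ y) = y ⬝ᵥ y :=
        Real.mul_self_sqrt (Finset.sum_nonneg fun i _ => mul_self_nonneg (y i))
      simp only [Pi.smul_apply, Matrix.col_apply, MulOpposite.smul_eq_mul_unop,
        MulOpposite.unop_op, inv_apply_zero_zero h1]
      rw [div_eq_mul_inv, mul_comm (_⁻¹), ← mul_assoc, hyy]
    rw [e1, e4]

lemma map_pivotState (hN : 0 < N) (c : ℝ) (k : ℕ) :
    (stdPiPi k).map (fun g => pivotState (shifted N c g)) = chainLaw c (noiseLaw N) k := by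
  induction k with
  | zero =>
    change (stdPiPi 0).map (fun _ => ((0, 1) : ℕ × ℝ)) = _
    rw [Measure.map_const]
    simp [chainLaw]
  | succ k ih =>
    have hS (k : ℕ) := measurable_pivotState (measurable_shifted (k := k) N c)
    have : IsProbabilityMeasure (chainLaw c (noiseLaw N) k) :=
      ih ▸ Measure.isProbabilityMeasure_map (hS k).aemeasurable
    have : IsProbabilityMeasure (noiseLaw N k) :=
      Measure.isProbabilityMeasure_map (measurable_noiseMap N k).aemeasurable
    refine Measure.ext_of_lintegral _ fun F hF => ?_
    have hm (i j : Fin k) : Measurable fun q : (ℝ × (Fin k → ℝ)) × (Fin k → Fin k → ℝ) =>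
      shifted N c q.2 i j := (measurable_shifted N c i j).comp measurable_snd
    have hG : Measurable fun q : (ℝ × (Fin k → ℝ)) × (Fin k → Fin k → ℝ) =>
        F (pivotStep N c q.1.1 ((pivotState (shifted N c q.2)).1,
          q.1.2 ⬝ᵥ (shifted N c q.2)⁻¹ *ᵥ q.1.2)) :=
      hF.comp ((measurable_pivotStep N c).comp (measurable_fst.fst.prodMk
        ((measurable_pivotState hm).fst.prodMk
          (measurable_dotProduct_inv_mulVec hm measurable_fst.snd measurable_fst.snd))))
    have hC : Measurable fun q : (ℝ × (Fin k → ℝ)) × (ℕ × ℝ) =>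
        F (chainStep c q.2 (noiseMap N q.1)) :=
      hF.comp ((measurable_chainStep c).comp
        (measurable_snd.prodMk ((measurable_noiseMap N k).comp measurable_fst)))
    calc ∫⁻ s, F s ∂(stdPiPi (k + 1)).map (fun g => pivotState (shifted N c g))
        = ∫⁻ g, F (pivotState (shifted N c g)) ∂stdPiPi (k + 1) := lintegral_map hF (hS (k + 1))
      _ = ∫⁻ q, F (pivotStep N c q.1.1 ((pivotState (shifted N c q.2)).1,
            q.1.2 ⬝ᵥ (shifted N c q.2)⁻¹ *ᵥ q.1.2))
            ∂((gaussianReal 0 1).prod (stdPi k)).prod (stdPiPi k) := by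
        rw [← (measurePreserving_splitMap k).lintegral_comp hG]
        simp only [pivotState_shifted hN]
      _ = ∫⁻ p, ∫⁻ g, F (pivotStep N c p.1 ((pivotState (shifted N c g)).1,
            p.2 ⬝ᵥ (shifted N c g)⁻¹ *ᵥ p.2)) ∂stdPiPi k
            ∂(gaussianReal 0 1).prod (stdPi k) := lintegral_prod _ hG.aemeasurable
      _ = ∫⁻ p, ∫⁻ g, F (chainStep c (pivotState (shifted N c g)) (noiseMap N p)) ∂stdPiPi k
            ∂(gaussianReal 0 1).prod (stdPi k) := by
        refine lintegral_congr fun p => ?_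
        simp only [chainStep_noiseMap]
        exact lintegral_pivotState_rotation hN c (F := fun s => F (pivotStep N c p.1 s))
          (hF.comp ((measurable_pivotStep N c).comp measurable_prodMk_left)) p.2
      _ = ∫⁻ p, ∫⁻ s, F (chainStep c s (noiseMap N p)) ∂chainLaw c (noiseLaw N) k
            ∂(gaussianReal 0 1).prod (stdPi k) := by
        refine lintegral_congr fun p => ?_
        rw [← ih]
        exact (lintegral_map (f := fun s => F (chainStep c s (noiseMap N p)))
          (hC.comp measurable_prodMk_left) (hS k)).symm
      _ = ∫⁻ s, ∫⁻ p, F (chainStep c s (noiseMap N p)) ∂(gaussianReal 0 1).prod (stdPi k)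
            ∂chainLaw c (noiseLaw N) k := lintegral_lintegral_swap hC.aemeasurable
      _ = ∫⁻ s, ∫⁻ x, F (chainStep c s x) ∂noiseLaw N k ∂chainLaw c (noiseLaw N) k := by
        refine lintegral_congr fun s => ?_
        exact (lintegral_map (f := fun x => F (chainStep c s x))
          (hF.comp ((measurable_chainStep c).comp measurable_prodMk_left))
          (measurable_noiseMap N k)).symm
      _ = ∫⁻ s, F s ∂chainLaw c (noiseLaw N) (k + 1) := by
        rw [chainLaw, lintegral_map hF (measurable_chainStep c)]
        exact (lintegral_prod (fun q : (ℕ × ℝ) × (ℝ × ℝ) => F (chainStep c q.1 q.2))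
          (hF.comp (measurable_chainStep c)).aemeasurable).symm

end pivotLaw

section counting

variable {N : ℕ} {c : ℝ}

lemma Hmat_eq_goeMat (hN : 0 < N) (g : Fin N → Fin N → ℝ) : Hmat N g = goeMat N g := by
  have hN' : (0:ℝ) < N := by exact_mod_cast hN
  have h22 : √(2:ℝ) * √(2:ℝ) = 2 := Real.mul_self_sqrt (by norm_num)
  have hs : 0 < √(N:ℝ) := Real.sqrt_pos.mpr hN'
  ext i j
  by_cases h : i = j
  · subst h
    simp only [Hmat, goeMat, if_true]
    rw [Real.sqrt_div zero_le_two, Real.sqrt_mul zero_le_two]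
    field_simp
    linear_combination (g i i) * h22
  · simp [Hmat, goeMat, h]

lemma countAboveH_eq_card (N : ℕ) (g : Fin N → Fin N → ℝ) (c : ℝ) :
    countAboveH N g c =
      (Finset.univ.filter fun i => c ≤ (Hmat_isHermitian N g).eigenvalues i).card := by
  refine Finset.card_equiv (Tuple.sort fun j => -(Hmat_isHermitian N g).eigenvalues j) fun i => ?_
  simp [evalsH, evalsDesc]

lemma ae_countAboveH_eq (hN : 0 < N) (c : ℝ) :
    ∀ᵐ g ∂gMeasure N, countAboveH N g c = (pivotState (shifted N c g)).1 := by
  filter_upwards [ae_isRegularPivot hN c N] with g hg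
  have e : Hmat N g - c • 1 = shifted N c g := by rw [Hmat_eq_goeMat hN, shifted]
  rw [countAboveH_eq_card, card_le_eigenvalues_eq_posIndex (Hmat_isHermitian N g)
    (by rw [e]; exact hg.isUnit_det), e, posIndex_eq_pivotState hg (isSymm_shifted N c g)]

lemma integral_countAboveH (hN : 0 < N) (c : ℝ) (f : ℝ → ℝ) (hf : Measurable f) :
    ∫ g, f (countAboveH N g c) ∂gMeasure N = ∫ s, f s.1 ∂chainLaw c (noiseLaw N) N := by
  rw [← map_pivotState hN c N]
  refine Eq.trans ?_ (integral_map (f := fun s : ℕ × ℝ => f s.1)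
    (measurable_pivotState (measurable_shifted N c)).aemeasurable
    (hf.comp measurable_fst_cast).aestronglyMeasurable).symm
  exact integral_congr_ae ((ae_countAboveH_eq hN c).mono fun g hg => by simp only [hg])

lemma aestronglyMeasurable_countAboveH (hN : 0 < N) (c : ℝ) :
    AEStronglyMeasurable (fun g => (countAboveH N g c : ℝ)) (gMeasure N) := by
  have h : Measurable fun g : Fin N → Fin N → ℝ => ((pivotState (shifted N c g)).1 : ℝ) :=
    measurable_fst_cast.comp (measurable_pivotState (measurable_shifted N c))
  exact ⟨_, h.stronglyMeasurable, (ae_countAboveH_eq hN c).mono fun g hg => by simp only [hg]⟩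

instance (N : ℕ) : IsProbabilityMeasure (gMeasure N) := by
  unfold gMeasure
  infer_instance

lemma countAboveH_estimates (hN : 0 < N) {s : ℝ} (hs : 0 ≤ s)
    (hsN : s ≤ (N:ℝ) ^ ((2:ℝ) / 3)) :
    (1 ≤ s → variance (fun g => (countAboveH N g (2 - s * (N:ℝ) ^ (-(2:ℝ)/3)) : ℝ)) (gMeasure N)
      ≤ countingBound * (1 + Real.log s / 2)) ∧
    (s ≤ (N:ℝ) ^ ((4:ℝ) / 15) →
      |(∫ g, (countAboveH N g (2 - s * (N:ℝ) ^ (-(2:ℝ)/3)) : ℝ) ∂(gMeasure N))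
          - (2 / (3 * Real.pi)) * s ^ ((3:ℝ)/2)| ≤ countingBound) := by
  have hN' : (0:ℝ) < N := by exact_mod_cast hN
  have hN1 : (1:ℝ) ≤ N := by exact_mod_cast hN
  set c := 2 - s * (N:ℝ) ^ (-(2:ℝ)/3) with hc
  set w := (N:ℝ) ^ (-(1:ℝ)/3) with hwdef
  have hw : 0 < w := Real.rpow_pos_of_pos hN' _
  have hw2 : (N:ℝ) ^ (-(2:ℝ)/3) = w ^ 2 := by
    rw [hwdef, ← Real.rpow_natCast, ← Real.rpow_mul hN'.le]; norm_num
  have hr2 : √s ^ 2 = s := Real.sq_sqrt hs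
  have hr3 : s ^ ((3:ℝ)/2) = √s ^ 3 := by
    rw [Real.sqrt_eq_rpow, ← Real.rpow_natCast, ← Real.rpow_mul hs]; norm_num
  have hr5 : √s ^ 5 = s ^ ((5:ℝ)/2) := by
    rw [Real.sqrt_eq_rpow, ← Real.rpow_natCast, ← Real.rpow_mul hs]; norm_num
  have h := chain_counting (μ := noiseLaw N) (v := 1 / N) (N := N) (w := w) (r := √s) (c := c)
    (fun k hk => isNoise_noiseLaw hN hk) (by positivity) (by field_simp) hw
    (Real.rpow_le_one_of_one_le_of_nonpos hN1 (by norm_num))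
    (by rw [hwdef, ← Real.rpow_natCast, ← Real.rpow_mul hN'.le]; norm_num [Real.rpow_neg_one])
    (Real.sqrt_nonneg s)
    (by
      rw [hr2, ← hw2]
      refine (mul_le_mul_of_nonneg_right hsN (Real.rpow_nonneg hN'.le _)).trans ?_
      rw [← Real.rpow_add hN']; norm_num)
    (by rw [hc, hr2, hw2])
  refine ⟨fun hs1 => ?_, fun hs4 => ?_⟩
  · obtain ⟨a, ha⟩ := h.1 (Real.one_le_sqrt.mpr hs1)
    have hm := aestronglyMeasurable_countAboveH hN c
    rw [← variance_sub_const hm a]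
    refine (variance_le_expectation_sq (hm.sub aestronglyMeasurable_const)).trans ?_
    have e := integral_countAboveH hN c (fun x => (x - a) ^ 2) (by fun_prop)
    rw [Real.log_sqrt hs] at ha
    exact e.trans_le ha
  · have e := integral_countAboveH hN c (fun x => x) measurable_id
    rw [e, hr3]
    refine h.2 ?_
    rw [hr5, ← hw2]
    refine (mul_le_mul_of_nonneg_right (Real.rpow_le_rpow hs hs4 (by norm_num))
      (Real.rpow_nonneg hN'.le _)).trans ?_
    rw [← Real.rpow_mul hN'.le, ← Real.rpow_add hN']; norm_num

lemma countingBound_pos : 0 < countingBound := by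
  have := turningBound_pos
  unfold countingBound
  positivity

end counting

/-- expectation and variance of the GOE edge counting function. -/
theorem goe_edge_counting
    (ε : ℝ) (hε : 0 < ε) :
    ∃ C > (0:ℝ), ∃ C₁ > (0:ℝ), ∀ N : ℕ, 0 < N → ∀ s : ℝ,
      (0 ≤ s → s ≤ (N:ℝ) ^ ((4:ℝ)/15) →
        |(∫ g, (countAboveH N g (2 - s * (N:ℝ) ^ (-(2:ℝ)/3)) : ℝ) ∂(gMeasure N))
          - (2 / (3 * Real.pi)) * s ^ ((3:ℝ)/2)| ≤ C)
      ∧ (C₁ ≤ s → s ≤ (N:ℝ) ^ ((2:ℝ)/3 - ε) →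
        ProbabilityTheory.variance
            (fun g => (countAboveH N g (2 - s * (N:ℝ) ^ (-(2:ℝ)/3)) : ℝ)) (gMeasure N)
          ≤ C * Real.log s) := by
  have hB := countingBound_pos
  refine ⟨2 * countingBound, by positivity, Real.exp 1, Real.exp_pos 1, fun N hN s => ⟨?_, ?_⟩⟩
  · intro hs hs4
    have hN1 : (1:ℝ) ≤ N := by exact_mod_cast hN
    refine ((countAboveH_estimates hN hs (hs4.trans
      (Real.rpow_le_rpow_of_exponent_le hN1 (by norm_num)))).2 hs4).trans ?_
    linarith only [hB]
  · intro hs hsN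
    have hN1 : (1:ℝ) ≤ N := by exact_mod_cast hN
    have hs1 : 1 ≤ s := (Real.one_le_exp zero_le_one).trans hs
    have hlog : 1 ≤ Real.log s := (Real.le_log_iff_exp_le (by linarith)).mpr hs
    refine ((countAboveH_estimates hN (by linarith) (hsN.trans
      (Real.rpow_le_rpow_of_exponent_le hN1 (by linarith)))).1 hs1).trans ?_
    nlinarith

end
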